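/- Let 1 < p < ∞, m ∈ ℝ and α < 2. Let A = [[Q, qᵗ],[q, γ]] be a real symmetric positive definite (N+1)×(N+1) matrix (Q ∈ ℝ^{N×N}, q ∈ ℝ^N, γ > 0), and let v = (d,c) ∈ ℝ^{N+1} with c ≠ 0. Assume max(−α,0) < (m+1)/p < c/γ + 1 − α. Then there exists a constant C > 0 such that for every u ∈ 𝒞_v, setting ℒu := y^{α} Tr(A D²u) + y^{α−1} v·∇u, one has Σ_{i,j=1}^{N} ‖y^{α} ∂²u/∂x_i∂x_j‖_{L^p_m} + ‖y^{α} ∂²u/∂y²‖_{L^p_m} + Σ_{i=1}^{N} ‖y^{α} ∂²u/∂x_i∂y‖_{L^p_m} + ‖y^{α−1} v·∇u‖_{L^p_m} ≤ C ‖ℒu‖_{L^p_m}. -/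

import Mathlib

open MeasureTheory Real

noncomputable section

/-- Points of `ℝ^{N+1} = ℝ^N × ℝ`; we write `z = (x, y)` with `x : Fin N → ℝ` and `y : ℝ`. -/
abbrev Pt (N : ℕ) := (Fin N → ℝ) × ℝ

/-- Directional (partial) derivative of `u` at `z` in the direction `v`. -/
def pd {N : ℕ} (v : Pt N) (u : Pt N → ℝ) (z : Pt N) : ℝ := fderiv ℝ u z v

/-- The unit vector in the `i`-th `x`-direction. -/
def ex {N : ℕ} (i : Fin N) : Pt N := (Pi.single i 1, 0)

/-- The unit vector in the `y`-direction. -/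
def ey {N : ℕ} : Pt N := (0, 1)

/-- The `i`-th coordinate direction of `ℝ^{N+1}`, `(x_1, …, x_N, y)`. -/
def bvec {N : ℕ} (i : Fin (N + 1)) : Pt N :=
  if h : (i : ℕ) < N then ex ⟨i, h⟩ else ey

/-- The block matrix `[[Q, qᵗ], [q, γ]]`. -/
def blockA {N : ℕ} (Q : Matrix (Fin N) (Fin N) ℝ) (q : Fin N → ℝ) (γ : ℝ) :
    Matrix (Fin (N + 1)) (Fin (N + 1)) ℝ := Matrix.of fun i j =>
  if hi : (i : ℕ) < N then
    if hj : (j : ℕ) < N then Q ⟨i, hi⟩ ⟨j, hj⟩ else q ⟨i, hi⟩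
  else if hj : (j : ℕ) < N then q ⟨j, hj⟩ else γ

/-- `Tr (A D² u)` at the point `z`: `∑_{i,j} a_{ij} ∂²u/∂z_i∂z_j`. -/
def trHess {N : ℕ} (A : Matrix (Fin (N + 1)) (Fin (N + 1)) ℝ) (u : Pt N → ℝ) (z : Pt N) : ℝ :=
  ∑ i, ∑ j, A i j * pd (bvec i) (pd (bvec j) u) z

/-- The norm of `L^p_m(ℝ^{N+1}_+) = L^p(ℝ^{N+1}_+ ; y^m dx dy)`. -/
def LpmNorm (N : ℕ) (p m : ℝ) (f : Pt N → ℝ) : ℝ :=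
  (∫ z in {z : Pt N | 0 < z.2}, |f z| ^ p * z.2 ^ m) ^ (1 / p)

/-! ### Scalar Bellman function -/

/-- Huber function. -/
def hub (R t : ℝ) : ℝ := if |t| ≤ R then t ^ 2 else 2 * R * |t| - R ^ 2

def clampR (R t : ℝ) : ℝ := if |t| ≤ R then t else if 0 ≤ t then R else -R

lemma hub_nonneg {R : ℝ} (hR : 0 < R) (t : ℝ) : 0 ≤ hub R t := by
  unfold hub; split_ifs with h
  · positivity
  · push Not at h; nlinarith

lemma hub_le {R : ℝ} (hR : 0 < R) (t : ℝ) : hub R t ≤ 2 * R * |t| := by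
  unfold hub; split_ifs with h
  · rw [← sq_abs]; nlinarith [abs_nonneg t]
  · nlinarith

lemma hub_sub {R : ℝ} (hR : 0 < R) (z w : ℝ) :
    hub R z + 2 * clampR R z * (w - z) ≤ hub R w := by
  have key : ∀ s, |s| ≤ R → 2 * s * w - s ^ 2 ≤ hub R w := by
    intro s hs
    unfold hub; split_ifs with h
    · nlinarith [sq_nonneg (s - w)]
    · push Not at h
      have h1 : s * w ≤ |s| * |w| := by rw [← abs_mul]; exact le_abs_self _
      rw [← sq_abs s]
      nlinarith [abs_nonneg s, mul_nonneg (sub_nonneg.2 hs) (sub_nonneg.2 h.le), mul_nonneg (sub_nonneg.2 hs) (sub_nonneg.2 hs)]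
  have hc : |clampR R z| ≤ R := by
    unfold clampR; split_ifs with h h' 
    · exact h
    · rw [abs_of_pos hR]
    · rw [abs_neg, abs_of_pos hR]
  have := key _ hc
  have h2 : hub R z = 2 * clampR R z * z - (clampR R z) ^ 2 := by
    unfold hub clampR; split_ifs with h h'
    · ring
    · rw [abs_of_nonneg h']
    · rw [abs_of_neg (not_le.1 h')]; ring
  linarith

lemma hub_convex {R : ℝ} (hR : 0 < R) : ConvexOn ℝ Set.univ (hub R) := by
  refine ⟨convex_univ, fun x _ y _ a b ha hb hab => ?_⟩
  have h1 := hub_sub hR (a • x + b • y) x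
  have h2 := hub_sub hR (a • x + b • y) y
  simp only [smul_eq_mul] at *
  have h3 := mul_le_mul_of_nonneg_left h1 ha
  have h4 := mul_le_mul_of_nonneg_left h2 hb
  have hb' : b = 1 - a := by linarith
  subst hb'
  nlinarith

def bel (R : ℝ) (z : ℝ × ℝ) : ℝ := max 0 (hub R z.1 + hub R z.2 - 1)

lemma bel_nonneg (R : ℝ) (z : ℝ × ℝ) : 0 ≤ bel R z := le_max_left _ _

lemma bel_convex {R : ℝ} (hR : 0 < R) : ConvexOn ℝ Set.univ (bel R) := by
  have h1 : ConvexOn ℝ Set.univ (fun z : ℝ × ℝ => hub R z.1) :=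
    (hub_convex hR).comp_linearMap (LinearMap.fst ℝ ℝ ℝ)
  have h2 : ConvexOn ℝ Set.univ (fun z : ℝ × ℝ => hub R z.2) :=
    (hub_convex hR).comp_linearMap (LinearMap.snd ℝ ℝ ℝ)
  exact (convexOn_const (0:ℝ) convex_univ).sup ((h1.add h2).sub (concaveOn_const 1 convex_univ))

lemma bel_measurable (R : ℝ) : Measurable (bel R) := by
  have : Measurable (hub R) := by
    unfold hub
    exact Measurable.ite (measurableSet_le measurable_norm measurable_const) (by fun_prop) (by fun_prop)
  unfold bel; fun_prop

lemma bel_two (R : ℝ) (hR : 0 < R) (z d : ℝ × ℝ) : 2 * bel R z ≤ bel R (z + d) + bel R (z - d) := by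
  have := (bel_convex hR).2 (Set.mem_univ (z+d)) (Set.mem_univ (z-d)) (show (0:ℝ) ≤ 1/2 by norm_num) (show (0:ℝ) ≤ 1/2 by norm_num) (by norm_num)
  have e : (1/2 : ℝ) • (z + d) + (1/2 : ℝ) • (z - d) = z := by
    ext <;> simp <;> ring
  rw [e] at this
  simp only [smul_eq_mul] at this
  linarith

lemma bel_gap {R : ℝ} (hR : 1 ≤ R) (z d : ℝ × ℝ) (h1 : |(z+d).1| ≤ R) (h2 : |(z+d).2| ≤ R)
    (h3 : |(z-d).1| ≤ R) (h4 : |(z-d).2| ≤ R)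
    (hbig : 2 ≤ bel R (z + d) + 1 ∨ 2 ≤ bel R (z - d) + 1) :
    2 * bel R z + (R ^ 2)⁻¹ * |d.1 * d.2| ≤ bel R (z + d) + bel R (z - d) := by
  obtain ⟨a, b⟩ := z
  obtain ⟨x, y⟩ := d
  simp only [Prod.mk_add_mk, Prod.mk_sub_mk] at *
  have hR2 : 0 < R ^ 2 := by positivity
  rw [abs_le] at h1 h2 h3 h4
  have ha : |a| ≤ R := abs_le.2 ⟨by linarith, by linarith⟩
  have hb : |b| ≤ R := abs_le.2 ⟨by linarith, by linarith⟩
  have hx : |x| ≤ R := abs_le.2 ⟨by linarith, by linarith⟩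
  have hy : |y| ≤ R := abs_le.2 ⟨by linarith, by linarith⟩
  rw [abs_mul]
  have e0 : bel R (a, b) = max 0 (a ^ 2 + b ^ 2 - 1) := by
    simp [bel, hub, ha, hb]
  by_cases hz : 1 ≤ a ^ 2 + b ^ 2
  · have e1 : (a + x)^2 + (b + y)^2 - 1 ≤ bel R (a + x, b + y) := by
      simp [bel, hub, abs_le.2 h1, abs_le.2 h2]
    have e2 : (a - x)^2 + (b - y)^2 - 1 ≤ bel R (a - x, b - y) := by
      simp [bel, hub, abs_le.2 h3, abs_le.2 h4]
    rw [e0, max_eq_right (by linarith)]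
    have : (R^2)⁻¹ * (|x| * |y|) ≤ |x| * |y| := by
      apply mul_le_of_le_one_left (by positivity)
      exact inv_le_one_of_one_le₀ (one_le_pow₀ hR)
    have h5 : 2 * (|x| * |y|) ≤ x ^ 2 + y ^ 2 := by
      rw [← sq_abs x, ← sq_abs y]; nlinarith [sq_nonneg (|x| - |y|)]
    nlinarith [mul_nonneg (abs_nonneg x) (abs_nonneg y)]
  · rw [e0, max_eq_left (by linarith)]
    have : (R^2)⁻¹ * (|x| * |y|) ≤ 1 := by
      rw [inv_mul_le_iff₀ hR2, mul_one, sq]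
      exact mul_le_mul hx hy (abs_nonneg _) (by linarith)
    have := bel_nonneg R (a + x, b + y)
    have := bel_nonneg R (a - x, b - y)
    rcases hbig with h | h <;> linarith

lemma bel_le {R : ℝ} (hR : 0 < R) (z : ℝ × ℝ) :
    bel R z ≤ max 0 (2 * R * |z.1| - 1/2) + max 0 (2 * R * |z.2| - 1/2) := by
  unfold bel
  apply max_le (by positivity)
  have := hub_le hR z.1
  have := hub_le hR z.2
  have := le_max_right 0 (2 * R * |z.1| - 1/2)
  have := le_max_right 0 (2 * R * |z.2| - 1/2)
  linarith

lemma bel_ge_of_fst {R : ℝ} (hR : 0 < R) (z : ℝ × ℝ) (h : |z.1| ≤ R) (h' : 2 ≤ |z.1|) : 2 ≤ bel R z + 1 := by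
  have : hub R z.1 + hub R z.2 - 1 ≤ bel R z := le_max_right _ _
  have h0 := hub_nonneg hR z.2
  have : hub R z.1 = |z.1| ^ 2 := by simp [hub, h]
  nlinarith

lemma bel_ge_of_snd {R : ℝ} (hR : 0 < R) (z : ℝ × ℝ) (h : |z.2| ≤ R) (h' : 2 ≤ |z.2|) : 2 ≤ bel R z + 1 := by
  have : hub R z.1 + hub R z.2 - 1 ≤ bel R z := le_max_right _ _
  have h0 := hub_nonneg hR z.1
  have : hub R z.2 = |z.2| ^ 2 := by simp [hub, h]
  nlinarith

/-- scaled point -/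
def scl (p q l : ℝ) : ℝ × ℝ →ₗ[ℝ] ℝ × ℝ :=
  LinearMap.prodMap ((l ^ (-1/p)) • LinearMap.id) ((l ^ (-1/q)) • LinearMap.id)

lemma scl_fst (p q l : ℝ) (z : ℝ × ℝ) : (scl p q l z).1 = l ^ (-1/p) * z.1 := by simp [scl]
lemma scl_snd (p q l : ℝ) (z : ℝ × ℝ) : (scl p q l z).2 = l ^ (-1/q) * z.2 := by simp [scl]

/-- The Bellman function. -/
def Bel (p q R : ℝ) (z : ℝ × ℝ) : ENNReal := ∫⁻ l in Set.Ioi (0:ℝ), ENNReal.ofReal (bel R (scl p q l z))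

lemma scl_meas (p q : ℝ) : Measurable (fun w : (ℝ × ℝ) × ℝ => scl p q w.2 w.1) := by
  have : (fun w : (ℝ × ℝ) × ℝ => scl p q w.2 w.1) = fun w => (w.2 ^ (-1/p) * w.1.1, w.2 ^ (-1/q) * w.1.2) := by
    ext w <;> simp [scl]
  rw [this]; fun_prop

lemma Bel_meas (p q R : ℝ) : Measurable (Bel p q R) := by
  unfold Bel
  apply Measurable.lintegral_prod_right' (f := fun w : (ℝ × ℝ) × ℝ => ENNReal.ofReal (bel R (scl p q w.2 w.1)))
  exact ((bel_measurable R).comp (scl_meas p q)).ennreal_ofReal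

lemma scl_abs_le {p l A t : ℝ} (hp : 1 < p) (hl : 0 < l) (hA : 1 ≤ A) (h : |t| ^ p ≤ A * l) :
    |l ^ (-1/p) * t| ≤ A := by
  have hp0 : 0 < p := by linarith
  rw [abs_mul, abs_of_pos (rpow_pos_of_pos hl _)]
  have h1 : |t| ≤ A ^ (1/p) * l ^ (1/p) := by
    rw [← mul_rpow (by linarith) hl.le]
    rw [← rpow_le_rpow_iff (abs_nonneg t) (by positivity) hp0, ← rpow_mul (by positivity)]
    rw [one_div_mul_cancel hp0.ne', rpow_one]; exact h
  have h2 : A ^ (1/p) ≤ A := by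
    conv_rhs => rw [← rpow_one A]
    exact rpow_le_rpow_of_exponent_le hA (by rw [div_le_one hp0]; exact hp.le)
  have h3 : l ^ (-1/p) * l ^ (1/p) = 1 := by
    rw [← rpow_add hl]; simp [neg_div]
  calc l ^ (-1/p) * |t| ≤ l ^ (-1/p) * (A ^ (1/p) * l ^ (1/p)) := by gcongr
    _ = A ^ (1/p) * (l ^ (-1/p) * l ^ (1/p)) := by ring
    _ ≤ A := by rw [h3, mul_one]; exact h2

lemma scl_abs_ge {p l A t : ℝ} (hp : 1 < p) (hl : 0 < l) (hA : 2 ^ p ≤ A) (h : A * l ≤ |t| ^ p) :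
    2 ≤ |l ^ (-1/p) * t| := by
  have hp0 : 0 < p := by linarith
  have hA0 : 0 < A := lt_of_lt_of_le (by positivity) hA
  rw [abs_mul, abs_of_pos (rpow_pos_of_pos hl _)]
  have h1 : A ^ (1/p) * l ^ (1/p) ≤ |t| := by
    rw [← mul_rpow hA0.le hl.le]
    rw [← rpow_le_rpow_iff (by positivity) (abs_nonneg t) hp0, ← rpow_mul (by positivity)]
    rw [one_div_mul_cancel hp0.ne', rpow_one]; exact h
  have h2 : 2 ≤ A ^ (1/p) := by
    rw [← rpow_le_rpow_iff (by positivity) (by positivity) hp0, ← rpow_mul hA0.le]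
    rw [one_div_mul_cancel hp0.ne', rpow_one]; exact hA
  have h3 : l ^ (-1/p) * l ^ (1/p) = 1 := by
    rw [← rpow_add hl]; simp [neg_div]
  calc 2 ≤ A ^ (1/p) := h2
    _ = l ^ (-1/p) * (A ^ (1/p) * l ^ (1/p)) := by rw [mul_left_comm, h3, mul_one]
    _ ≤ _ := by gcongr

lemma Bel_ofReal_meas (p q R : ℝ) (z : ℝ × ℝ) :
    Measurable fun l => ENNReal.ofReal (bel R (scl p q l z)) := by
  have := (bel_measurable R).comp ((scl_meas p q).comp (measurable_prodMk_left (x := z)))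
  exact this.ennreal_ofReal

def RR (p q : ℝ) : ℝ := 2 * 2 ^ (p + q)

lemma RR_ge {p q : ℝ} (hp : 1 < p) (hq : 1 < q) : 2 ≤ RR p q := by
  have : (1:ℝ) ≤ 2 ^ (p+q) := one_le_rpow (by norm_num) (by linarith)
  unfold RR; linarith

lemma Bel_gap {p q : ℝ} (hpq : p.HolderConjugate q) (z d : ℝ × ℝ) :
    2 * Bel p q (RR p q) z + ENNReal.ofReal ((2 * RR p q ^ 2)⁻¹ * |d.1 * d.2|) ≤
      Bel p q (RR p q) (z + d) + Bel p q (RR p q) (z - d) := by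
  have hp := hpq.lt
  have hq := hpq.symm.lt
  set R := RR p q with hRdef
  set A : ℝ := 2 ^ (p + q) with hA
  have hRA : R = 2 * A := rfl
  have hA1 : 1 ≤ A := one_le_rpow (by norm_num) (by linarith)
  have hAp : (2:ℝ) ^ p ≤ A := rpow_le_rpow_of_exponent_le (by norm_num) (by linarith)
  have hAq : (2:ℝ) ^ q ≤ A := rpow_le_rpow_of_exponent_le (by norm_num) (by linarith)
  have hR1 : 1 ≤ R := by linarith
  set n := max (max (|(z+d).1| ^ p) (|(z+d).2| ^ q)) (max (|(z-d).1| ^ p) (|(z-d).2| ^ q)) with hn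
  have hn0 : 0 ≤ n := le_max_of_le_left (le_max_of_le_left (by positivity))
  have b1 : |(z+d).1| ^ p ≤ n := (le_max_left _ _).trans (le_max_left _ _)
  have b2 : |(z+d).2| ^ q ≤ n := (le_max_right _ _).trans (le_max_left _ _)
  have b3 : |(z-d).1| ^ p ≤ n := (le_max_left _ _).trans (le_max_right _ _)
  have b4 : |(z-d).2| ^ q ≤ n := (le_max_right _ _).trans (le_max_right _ _)
  set w : ℝ → ℝ := Set.indicator (Set.Icc (n/(2*A)) (n/A)) (fun _ => (R^2)⁻¹ * |d.1 * d.2| * (A / n)) with hw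
  have hw0 : ∀ l, 0 ≤ w l := fun l => Set.indicator_nonneg (fun _ _ => by positivity) _
  have main : ∀ l ∈ Set.Ioi (0:ℝ), 2 * bel R (scl p q l z) + w l ≤ bel R (scl p q l (z + d)) + bel R (scl p q l (z - d)) := by
    intro l hl
    have hl : 0 < l := hl
    by_cases hl' : l ∈ Set.Icc (n/(2*A)) (n/A)
    · have hwl : w l = (R^2)⁻¹ * |d.1 * d.2| * (A / n) := by simp only [hw, Set.indicator_of_mem hl']
      obtain ⟨l1, l2⟩ := hl'
      rw [div_le_iff₀ (by positivity)] at l1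
      rw [le_div_iff₀ (by positivity)] at l2
      have hnpos : 0 < n := lt_of_lt_of_le (by positivity) l2
      rw [map_add, map_sub]
      have g := bel_gap hR1 (scl p q l z) (scl p q l d)
      rw [← map_add, ← map_sub] at g
      have c1 : |(scl p q l (z+d)).1| ≤ R := by
        rw [scl_fst]; exact scl_abs_le hp hl hR1 (by rw [hRA]; linarith)
      have c2 : |(scl p q l (z+d)).2| ≤ R := by
        rw [scl_snd]; exact scl_abs_le hq hl hR1 (by rw [hRA]; linarith)
      have c3 : |(scl p q l (z-d)).1| ≤ R := by
        rw [scl_fst]; exact scl_abs_le hp hl hR1 (by rw [hRA]; linarith)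
      have c4 : |(scl p q l (z-d)).2| ≤ R := by
        rw [scl_snd]; exact scl_abs_le hq hl hR1 (by rw [hRA]; linarith)
      have hbig : 2 ≤ bel R (scl p q l (z + d)) + 1 ∨ 2 ≤ bel R (scl p q l (z - d)) + 1 := by
        rcases le_total (max (|(z+d).1| ^ p) (|(z+d).2| ^ q)) (max (|(z-d).1| ^ p) (|(z-d).2| ^ q)) with h | h
        · right
          rw [max_eq_right h] at hn
          rcases le_total (|(z-d).1| ^ p) (|(z-d).2| ^ q) with h' | h'
          · rw [max_eq_right h'] at hn
            exact bel_ge_of_snd (by linarith) _ c4 (by rw [scl_snd]; exact scl_abs_ge hq hl hAq (by linarith))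
          · rw [max_eq_left h'] at hn
            exact bel_ge_of_fst (by linarith) _ c3 (by rw [scl_fst]; exact scl_abs_ge hp hl hAp (by linarith))
        · left
          rw [max_eq_left h] at hn
          rcases le_total (|(z+d).1| ^ p) (|(z+d).2| ^ q) with h' | h'
          · rw [max_eq_right h'] at hn
            exact bel_ge_of_snd (by linarith) _ c2 (by rw [scl_snd]; exact scl_abs_ge hq hl hAq (by linarith))
          · rw [max_eq_left h'] at hn
            exact bel_ge_of_fst (by linarith) _ c1 (by rw [scl_fst]; exact scl_abs_ge hp hl hAp (by linarith))
      have g' := g c1 c2 c3 c4 hbig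
      rw [← map_add, ← map_sub]
      refine le_trans ?_ g'
      rw [hwl, mul_assoc]
      gcongr
      rw [scl_fst, scl_snd]
      have : l ^ (-1/p) * d.1 * (l ^ (-1/q) * d.2) = (l ^ (-1/p) * l ^ (-1/q)) * (d.1 * d.2) := by ring
      rw [this, ← rpow_add hl]
      have e : -1/p + -1/q = -1 := by
        have := hpq.inv_add_inv_eq_one
        rw [neg_div, neg_div, one_div, one_div]; linarith
      rw [e, rpow_neg_one, abs_mul (l⁻¹), abs_of_pos (inv_pos.2 hl), mul_comm]
      gcongr
      rw [div_le_iff₀ hnpos, inv_mul_eq_div, le_div_iff₀ hl]; linarith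
    · simp only [hw, Set.indicator_of_notMem hl', add_zero, map_add, map_sub]
      exact bel_two R (by linarith) _ _
  have hmw : Measurable w := measurable_const.indicator measurableSet_Icc
  have e1 : 2 * Bel p q R z + ∫⁻ l in Set.Ioi (0:ℝ), ENNReal.ofReal (w l) ≤ Bel p q R (z + d) + Bel p q R (z - d) := by
    unfold Bel
    rw [← lintegral_const_mul _ (Bel_ofReal_meas _ _ _ _), ← lintegral_add_left ((Bel_ofReal_meas _ _ _ _).const_mul _), ← lintegral_add_left (Bel_ofReal_meas _ _ _ _)]
    apply setLIntegral_mono ((Bel_ofReal_meas _ _ _ _).add (Bel_ofReal_meas _ _ _ _))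
    intro l hl
    have := ENNReal.ofReal_le_ofReal (main l hl)
    rw [ENNReal.ofReal_add (mul_nonneg zero_le_two (bel_nonneg _ _)) (hw0 _), ENNReal.ofReal_add (bel_nonneg _ _) (bel_nonneg _ _),
      ENNReal.ofReal_mul zero_le_two] at this
    simpa using this
  refine le_trans ?_ e1
  gcongr
  by_cases hnpos : n = 0
  · have hz : ∀ {t s : ℝ}, 1 < s → |t| ^ s ≤ n → t = 0 := by
      intro t s hs h
      rw [hnpos] at h
      by_contra h0
      exact absurd h (not_le.2 (by positivity))
    have q1 := hz hp b1
    have q3 := hz hp b3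
    simp only [Prod.fst_add, Prod.fst_sub] at q1 q3
    have : d.1 = 0 := by linarith
    simp [this]
  · have hnpos : 0 < n := lt_of_le_of_ne hn0 (Ne.symm hnpos)
    have hsub : Set.Icc (n/(2*A)) (n/A) ⊆ Set.Ioi 0 := fun l hl => lt_of_lt_of_le (by positivity) hl.1
    have : ∫⁻ l in Set.Ioi (0:ℝ), ENNReal.ofReal (w l) = ENNReal.ofReal ((R^2)⁻¹ * |d.1 * d.2| * (A / n)) * ENNReal.ofReal (n/A - n/(2*A)) := by
      have : ∀ l, ENNReal.ofReal (w l) = Set.indicator (Set.Icc (n/(2*A)) (n/A)) (fun _ => ENNReal.ofReal ((R^2)⁻¹ * |d.1 * d.2| * (A / n))) l := by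
        intro l
        simp only [hw, Set.indicator]; split_ifs <;> simp
      simp_rw [this]
      rw [setLIntegral_indicator measurableSet_Icc, Set.inter_eq_left.2 hsub]
      simp
    rw [this, ← ENNReal.ofReal_mul (by positivity)]
    apply ENNReal.ofReal_le_ofReal
    apply le_of_eq
    field_simp
    norm_num

lemma Bel_jensen {p q R : ℝ} (hR : 0 < R) {ι : Type} [Fintype ι] [Nonempty ι] (z : ι → ℝ × ℝ) :
    (Fintype.card ι : ENNReal) * Bel p q R ((Fintype.card ι : ℝ)⁻¹ • ∑ i, z i) ≤ ∑ i, Bel p q R (z i) := by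
  unfold Bel
  rw [← lintegral_const_mul _ (Bel_ofReal_meas _ _ _ _), ← lintegral_finsetSum _ (fun i _ => Bel_ofReal_meas _ _ _ _)]
  refine lintegral_mono fun l => ?_
  have hc : (0:ℝ) < Fintype.card ι := by exact_mod_cast Fintype.card_pos
  rw [← ENNReal.ofReal_sum_of_nonneg (fun i _ => bel_nonneg _ _), ← ENNReal.ofReal_natCast, ← ENNReal.ofReal_mul hc.le]
  apply ENNReal.ofReal_le_ofReal
  have := (bel_convex hR).map_sum_le (t := Finset.univ) (w := fun _ => (Fintype.card ι : ℝ)⁻¹) (p := fun i => scl p q l (z i))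
    (fun _ _ => by positivity) (by simp [hc.ne']) (fun _ _ => Set.mem_univ _)
  rw [← Finset.smul_sum, ← Finset.smul_sum, ← map_sum, ← map_smul, smul_eq_mul] at this
  calc _ ≤ (Fintype.card ι : ℝ) * ((Fintype.card ι : ℝ)⁻¹ * ∑ i, bel R (scl p q l (z i))) := by gcongr
    _ = _ := by rw [mul_inv_cancel_left₀ hc.ne']

lemma Bel_one_var {p R : ℝ} (hp : 1 < p) (hR : 0 < R) : ∃ C : ℝ, 0 < C ∧ ∀ t : ℝ, 
    ∫⁻ l in Set.Ioi (0:ℝ), ENNReal.ofReal (max 0 (2 * R * |l ^ (-1/p) * t| - 1/2)) ≤ ENNReal.ofReal (C * |t| ^ p) := by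
  have hp0 : 0 < p := by linarith
  have hp1 : 0 < 1 - 1/p := by rw [sub_pos, div_lt_one hp0]; exact hp
  refine ⟨2 * R * ((4 * R) ^ (p - 1) / (1 - 1/p)), by positivity, fun t => ?_⟩
  by_cases ht : t = 0
  · subst ht; simp 
  have ht : 0 < |t| := abs_pos.2 ht
  set Λ := (4 * R * |t|) ^ p with hΛ
  have hΛ0 : 0 < Λ := by positivity
  calc _ ≤ ∫⁻ l in Set.Ioi (0:ℝ), Set.indicator (Set.Ioc 0 Λ) (fun l => ENNReal.ofReal (2 * R * |t| * l ^ (-1/p))) l := by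
        apply lintegral_mono_ae
        filter_upwards [ae_restrict_mem measurableSet_Ioi] with l hl
        have hl : 0 < l := hl
        rw [abs_mul, abs_of_pos (rpow_pos_of_pos hl _)]
        by_cases h : l ≤ Λ
        · rw [Set.indicator_of_mem (show l ∈ Set.Ioc 0 Λ from ⟨hl, h⟩)]
          apply ENNReal.ofReal_le_ofReal
          have : 0 < l ^ (-1/p) := by positivity
          apply max_le (by positivity)
          nlinarith
        · rw [max_eq_left, ENNReal.ofReal_zero]; exact zero_le
          push Not at h
          have : 4 * R * |t| ≤ l ^ (1/p) := by
            rw [← rpow_le_rpow_iff (by positivity) (by positivity) hp0, ← rpow_mul hl.le, one_div_mul_cancel hp0.ne', rpow_one]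
            exact h.le
          have h3 : l ^ (-1/p) * l ^ (1/p) = 1 := by
            rw [← rpow_add hl]; simp [neg_div]
          have : l ^ (-1/p) * (4 * R * |t|) ≤ 1 := (mul_le_mul_of_nonneg_left this (rpow_pos_of_pos hl _).le).trans h3.le
          linarith
    _ = ∫⁻ l in Set.Ioc 0 Λ, ENNReal.ofReal (2 * R * |t| * l ^ (-1/p)) := by
        rw [setLIntegral_indicator measurableSet_Ioc, Set.inter_eq_left.2 (fun l hl => hl.1)]
    _ = ENNReal.ofReal (∫ l in Set.Ioc 0 Λ, 2 * R * |t| * l ^ (-1/p)) := by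
        rw [ofReal_integral_eq_lintegral_ofReal]
        · have := (intervalIntegral.intervalIntegrable_rpow' (a := 0) (b := Λ) (r := -1/p) (by rw [neg_div]; linarith)).const_mul (2 * R * |t|)
          rwa [intervalIntegrable_iff_integrableOn_Ioc_of_le hΛ0.le] at this
        · filter_upwards [ae_restrict_mem measurableSet_Ioc] with l hl
          have := hl.1
          positivity
    _ ≤ _ := by
        apply ENNReal.ofReal_le_ofReal
        apply le_of_eq
        rw [← intervalIntegral.integral_of_le hΛ0.le, intervalIntegral.integral_const_mul, integral_rpow (by left; rw [neg_div]; linarith)]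
        have e : -1/p + 1 = 1 - 1/p := by ring
        rw [e, zero_rpow hp1.ne', sub_zero, hΛ, ← rpow_mul (by positivity)]
        have e2 : p * (1 - 1/p) = p - 1 := by field_simp
        rw [e2, mul_rpow (by positivity) (by positivity)]
        have e3 : |t| ^ p = |t| * |t| ^ (p-1) := by
          rw [← rpow_one_add' (by positivity) (by linarith)]; ring_nf
        rw [e3]; ring

lemma Bel_upper {p q : ℝ} (hpq : p.HolderConjugate q) : ∃ C : ℝ, 0 < C ∧ ∀ z : ℝ × ℝ,
    Bel p q (RR p q) z ≤ ENNReal.ofReal (C * (|z.1| ^ p + |z.2| ^ q)) := by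
  have hR : 0 < RR p q := by linarith [RR_ge hpq.lt hpq.symm.lt]
  obtain ⟨C1, h1, H1⟩ := Bel_one_var hpq.lt hR
  obtain ⟨C2, h2, H2⟩ := Bel_one_var hpq.symm.lt hR
  refine ⟨max C1 C2, by positivity, fun z => ?_⟩
  calc Bel p q (RR p q) z ≤ ∫⁻ l in Set.Ioi (0:ℝ), (ENNReal.ofReal (max 0 (2 * RR p q * |l ^ (-1/p) * z.1| - 1/2)) + ENNReal.ofReal (max 0 (2 * RR p q * |l ^ (-1/q) * z.2| - 1/2))) := by
        apply lintegral_mono fun l => ?_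
        rw [← ENNReal.ofReal_add (le_max_left _ _) (le_max_left _ _)]
        apply ENNReal.ofReal_le_ofReal
        have := bel_le hR (scl p q l z)
        rwa [scl_fst, scl_snd] at this
    _ ≤ ENNReal.ofReal (C1 * |z.1| ^ p) + ENNReal.ofReal (C2 * |z.2| ^ q) := by
        rw [lintegral_add_left (by fun_prop)]
        exact add_le_add (H1 _) (H2 _)
    _ ≤ _ := by
        rw [← ENNReal.ofReal_add (by positivity) (by positivity)]
        apply ENNReal.ofReal_le_ofReal
        rw [mul_add]
        gcongr
        · exact le_max_left _ _
        · exact le_max_right _ _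

def Cc {N : ℕ} (f : Pt N → ℝ) : Prop := Continuous f ∧ HasCompactSupport f

def Mop {N : ℕ} {ι : Type} [Fintype ι] (v : ι → Pt N) (f : Pt N → ℝ) : Pt N → ℝ := fun x =>
  (Fintype.card ι : ℝ)⁻¹ * ∑ i, (1/2 : ℝ) * (f (x + v i) + f (x - v i))

def Del {N : ℕ} (w : Pt N) (f : Pt N → ℝ) : Pt N → ℝ := fun x => f (x + w) - f (x - w)

section
variable {N : ℕ} {f g : Pt N → ℝ}

instance ptHaar : (volume : Measure (Pt N)).IsAddHaarMeasure := Measure.prod.instIsAddHaarMeasure _ _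

lemma Cc.shift (hf : Cc f) (w : Pt N) : Cc (fun x => f (x + w)) :=
  ⟨hf.1.comp (by fun_prop), hf.2.comp_homeomorph (Homeomorph.addRight w)⟩
lemma Cc.add (hf : Cc f) (hg : Cc g) : Cc (fun x => f x + g x) := ⟨hf.1.add hg.1, hf.2.add hg.2⟩
lemma Cc.sub (hf : Cc f) (hg : Cc g) : Cc (fun x => f x - g x) := ⟨hf.1.sub hg.1, hf.2.sub hg.2⟩
lemma Cc.const_mul (hf : Cc f) (c : ℝ) : Cc (fun x => c * f x) :=
  ⟨hf.1.const_mul c, hf.2.mul_left (f := fun _ => c)⟩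
lemma Cc.zero : Cc (fun _ : Pt N => (0:ℝ)) := ⟨continuous_const, HasCompactSupport.zero⟩
lemma Cc.sum {ι : Type} (s : Finset ι) {F : ι → Pt N → ℝ} (h : ∀ i, Cc (F i)) : Cc (fun x => ∑ i ∈ s, F i x) := by
  classical
  induction s using Finset.induction_on with
  | empty => simpa using Cc.zero
  | insert a s ha ih => simp_rw [Finset.sum_insert ha]; exact (h a).add ih
lemma Cc.mul (hf : Cc f) (hg : Cc g) : Cc (fun x => f x * g x) := ⟨hf.1.mul hg.1, hf.2.mul_right⟩
lemma Cc.integrable (hf : Cc f) : Integrable f := hf.1.integrable_of_hasCompactSupport hf.2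
lemma Cc.meas (hf : Cc f) : Measurable f := hf.1.measurable

lemma Cc.shift' (hf : Cc f) (w : Pt N) : Cc (fun x => f (x - w)) := by
  simpa [sub_eq_add_neg] using hf.shift (-w)

lemma Cc.Del (hf : Cc f) (w : Pt N) : Cc (Del w f) := (hf.shift w).sub (hf.shift' w)
lemma Cc.Mop {ι : Type} [Fintype ι] (hf : Cc f) (v : ι → Pt N) : Cc (Mop v f) :=
  (Cc.sum _ fun i => ((hf.shift (v i)).add (hf.shift' (v i))).const_mul _).const_mul _

lemma Cc.Mop_iter {ι : Type} [Fintype ι] (hf : Cc f) (v : ι → Pt N) (k : ℕ) : Cc ((_root_.Mop v)^[k] f) := by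
  induction k with
  | zero => exact hf
  | succ k ih => rw [Function.iterate_succ_apply']; exact ih.Mop v

lemma Cc.comp_zero (hf : Cc f) {φ : ℝ → ℝ} (hφ : Continuous φ) (h0 : φ 0 = 0) : Cc (fun x => φ (f x)) :=
  ⟨hφ.comp hf.1, hf.2.comp_left h0⟩

lemma Cc.rpow (hf : Cc f) {p : ℝ} (hp : 0 < p) : Cc (fun x => |f x| ^ p) :=
  hf.comp_zero (φ := fun t => |t| ^ p) (by
    exact continuous_abs.rpow_const (fun _ => Or.inr hp.le)) (by simp [hp.ne'])

lemma int_shift (_ : Cc f) (_ : Cc g) (w : Pt N) : ∫ x, f (x + w) * g x = ∫ x, f x * g (x - w) := by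
  rw [← integral_add_right_eq_self (fun x => f x * g (x - w)) w]; simp

lemma Del_adj (hf : Cc f) (hg : Cc g) (w : Pt N) : ∫ x, Del w f x * g x = - ∫ x, f x * Del w g x := by
  unfold Del
  have h1 := int_shift hf hg w
  have h2 := int_shift hf hg (-w)
  simp only [sub_neg_eq_add, ← sub_eq_add_neg] at h2
  simp only [sub_mul, mul_sub]
  rw [integral_sub ((hf.shift w).mul hg).integrable ((hf.shift' w).mul hg).integrable,
    integral_sub (hf.mul (hg.shift w)).integrable (hf.mul (hg.shift' w)).integrable, h1, h2]
  ring

lemma Mop_adj {ι : Type} [Fintype ι] (hf : Cc f) (hg : Cc g) (v : ι → Pt N) :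
    ∫ x, Mop v f x * g x = ∫ x, f x * Mop v g x := by
  unfold Mop
  have e1 : ∀ x, (Fintype.card ι : ℝ)⁻¹ * (∑ i, (1/2 : ℝ) * (f (x + v i) + f (x - v i))) * g x =
    (Fintype.card ι : ℝ)⁻¹ * ∑ i, ((1/2 : ℝ) * (f (x + v i) * g x) + (1/2 : ℝ) * (f (x - v i) * g x)) := by
    intro x; rw [mul_assoc, Finset.sum_mul]; congr 1; apply Finset.sum_congr rfl; intros; ring
  have e2 : ∀ x, f x * ((Fintype.card ι : ℝ)⁻¹ * ∑ i, (1/2 : ℝ) * (g (x + v i) + g (x - v i))) =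
    (Fintype.card ι : ℝ)⁻¹ * ∑ i, ((1/2 : ℝ) * (f x * g (x + v i)) + (1/2 : ℝ) * (f x * g (x - v i))) := by
    intro x; rw [mul_left_comm, Finset.mul_sum]; congr 1; apply Finset.sum_congr rfl; intros; ring
  simp_rw [e1, e2]
  rw [integral_const_mul, integral_const_mul, integral_finsetSum, integral_finsetSum]
  · congr 1
    apply Finset.sum_congr rfl
    intro i _
    have h1 := int_shift hf hg (v i)
    have h2 := int_shift hf hg (-(v i))
    simp only [sub_neg_eq_add, ← sub_eq_add_neg] at h2
    rw [integral_add, integral_add]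
    · simp only [integral_const_mul, h1, h2]; ring
    · exact ((hf.mul (hg.shift _)).const_mul _).integrable
    · exact ((hf.mul (hg.shift' _)).const_mul _).integrable
    · exact (((hf.shift _).mul hg).const_mul _).integrable
    · exact (((hf.shift' _).mul hg).const_mul _).integrable
  · intro i _
    exact (((hf.mul (hg.shift _)).const_mul _).add ((hf.mul (hg.shift' _)).const_mul _)).integrable
  · intro i _
    exact ((((hf.shift _).mul hg).const_mul _).add (((hf.shift' _).mul hg).const_mul _)).integrable

lemma Mop_Del {ι : Type} [Fintype ι] (v : ι → Pt N) (w : Pt N) (f : Pt N → ℝ) : Mop v (Del w f) = Del w (Mop v f) := by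
  funext x
  unfold Mop Del
  rw [← mul_sub, ← Finset.sum_sub_distrib]
  congr 1
  apply Finset.sum_congr rfl
  intro i _
  rw [show x + v i + w = x + w + v i by abel, show x + v i - w = x - w + v i by abel,
    show x - v i + w = x + w - v i by abel, show x - v i - w = x - w - v i by abel]
  ring

lemma Mop_sub {ι : Type} [Fintype ι] (v : ι → Pt N) (f g : Pt N → ℝ) : Mop v (fun x => f x - g x) = fun x => Mop v f x - Mop v g x := by
  funext x
  unfold Mop
  rw [← mul_sub, ← Finset.sum_sub_distrib]
  congr 1
  apply Finset.sum_congr rfl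
  intro i _
  ring

lemma Mop_iter_sub {ι : Type} [Fintype ι] (v : ι → Pt N) (f g : Pt N → ℝ) (k : ℕ) :
    (Mop v)^[k] (fun x => f x - g x) = fun x => (Mop v)^[k] f x - (Mop v)^[k] g x := by
  induction k with
  | zero => rfl
  | succ k ih => rw [Function.iterate_succ_apply', ih, Mop_sub, Function.iterate_succ_apply', Function.iterate_succ_apply']

lemma Mop_iter_Del {ι : Type} [Fintype ι] (v : ι → Pt N) (w : Pt N) (f : Pt N → ℝ) (k : ℕ) : (Mop v)^[k] (Del w f) = Del w ((Mop v)^[k] f) := by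
  induction k with
  | zero => rfl
  | succ k ih => rw [Function.iterate_succ_apply', ih, Mop_Del, Function.iterate_succ_apply']

lemma Mop_iter_adj {ι : Type} [Fintype ι] (hf : Cc f) (hg : Cc g) (v : ι → Pt N) (k : ℕ) :
    ∫ x, (Mop v)^[k] f x * g x = ∫ x, f x * (Mop v)^[k] g x := by
  induction k generalizing g with
  | zero => rfl
  | succ k ih => rw [Function.iterate_succ_apply', Mop_adj (hf.Mop_iter v k) hg, ih (hg.Mop v), Function.iterate_succ_apply]

lemma Bel_step {p q : ℝ} (hpq : p.HolderConjugate q) {ι : Type} [Fintype ι] (i0 : ι) (v : ι → Pt N) (hf : Cc f) (hg : Cc g) :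
    (2 * Fintype.card ι : ENNReal) * (∫⁻ x, Bel p q (RR p q) (Mop v f x, Mop v g x)) +
      ENNReal.ofReal ((8 * RR p q ^ 2)⁻¹) * ∫⁻ x, ENNReal.ofReal |Del (v i0) f x * Del (v i0) g x| ≤
    (2 * Fintype.card ι : ENNReal) * ∫⁻ x, Bel p q (RR p q) (f x, g x) := by
  have : Nonempty ι := ⟨i0⟩
  have hR : 0 < RR p q := by linarith [RR_ge hpq.lt hpq.symm.lt]
  set B := Bel p q (RR p q) with hB
  have hBm : Measurable B := Bel_meas _ _ _
  have mB : ∀ {f g : Pt N → ℝ}, Cc f → Cc g → Measurable fun x => B (f x, g x) := fun hf hg => hBm.comp (hf.meas.prodMk hg.meas)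
  have pt : ∀ x, (2 * Fintype.card ι : ENNReal) * B (Mop v f x, Mop v g x) + ENNReal.ofReal ((8 * RR p q ^ 2)⁻¹) * ENNReal.ofReal |Del (v i0) f x * Del (v i0) g x| ≤
      ∑ i, (B (f (x + v i), g (x + v i)) + B (f (x - v i), g (x - v i))) := by
    intro x
    let z : ι → ℝ × ℝ := fun i => ((1/2 : ℝ) * (f (x + v i) + f (x - v i)), (1/2 : ℝ) * (g (x + v i) + g (x - v i)))
    let d : ι → ℝ × ℝ := fun i => ((1/2 : ℝ) * (f (x + v i) - f (x - v i)), (1/2 : ℝ) * (g (x + v i) - g (x - v i)))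
    have e1 : (Mop v f x, Mop v g x) = (Fintype.card ι : ℝ)⁻¹ • ∑ i, z i := by
      ext <;> simp [Mop, z, Prod.fst_sum, Prod.snd_sum]
    have J := Bel_jensen (p := p) (q := q) hR z
    rw [← e1] at J
    have ep : ∀ i, z i + d i = (f (x + v i), g (x + v i)) := by
      intro i; ext <;> simp [z, d] <;> ring
    have em : ∀ i, z i - d i = (f (x - v i), g (x - v i)) := by
      intro i; ext <;> simp [z, d] <;> ring
    have G : ∀ i, 2 * B (z i) + ENNReal.ofReal ((2 * RR p q ^ 2)⁻¹ * |(d i).1 * (d i).2|) ≤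
        B (f (x + v i), g (x + v i)) + B (f (x - v i), g (x - v i)) := by
      intro i
      have := Bel_gap hpq (z i) (d i)
      rwa [ep, em] at this
    calc _ ≤ ∑ i, (2 * B (z i) + ENNReal.ofReal ((2 * RR p q ^ 2)⁻¹ * |(d i).1 * (d i).2|)) := by
          rw [Finset.sum_add_distrib, ← Finset.mul_sum, mul_assoc]
          gcongr
          refine le_trans (le_of_eq ?_) (Finset.single_le_sum (f := fun i => ENNReal.ofReal ((2 * RR p q ^ 2)⁻¹ * |(d i).1 * (d i).2|)) (fun _ _ => zero_le) (Finset.mem_univ i0))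
          rw [← ENNReal.ofReal_mul (by positivity)]
          congr 1
          simp only [d, Del, abs_mul]
          rw [abs_of_pos (show (0:ℝ) < 1/2 by norm_num)]
          field_simp
          ring
      _ ≤ _ := Finset.sum_le_sum fun i _ => G i
  have hsh : ∀ w : Pt N, ∫⁻ x, B (f (x + w), g (x + w)) = ∫⁻ x, B (f x, g x) := fun w =>
    lintegral_add_right_eq_self (fun x => B (f x, g x)) w
  have hsh' : ∀ w : Pt N, ∫⁻ x, B (f (x - w), g (x - w)) = ∫⁻ x, B (f x, g x) := fun w => by
    simpa only [sub_eq_add_neg] using hsh (-w)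
  have hDm : Measurable fun x => ENNReal.ofReal |Del (v i0) f x * Del (v i0) g x| := by
    have := ((hf.Del (v i0)).mul (hg.Del (v i0))).meas
    fun_prop
  have I := lintegral_mono (μ := volume) pt
  rw [lintegral_add_left ((mB (hf.Mop v) (hg.Mop v)).const_mul _), lintegral_const_mul _ (mB (hf.Mop v) (hg.Mop v)), lintegral_const_mul _ hDm] at I
  refine I.trans (le_of_eq ?_)
  rw [lintegral_finsetSum (f := fun i x => B (f (x + v i), g (x + v i)) + B (f (x - v i), g (x - v i))) _ (fun i _ => (mB (hf.shift (v i)) (hg.shift (v i))).add (mB (hf.shift' (v i)) (hg.shift' (v i))))]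
  have : ∀ i, ∫⁻ x, (B (f (x + v i), g (x + v i)) + B (f (x - v i), g (x - v i))) = 2 * ∫⁻ x, B (f x, g x) := by
    intro i
    rw [lintegral_add_left (mB (hf.shift _) (hg.shift _)), hsh, hsh', two_mul]
  simp_rw [this]
  rw [Finset.sum_const, Finset.card_univ, nsmul_eq_mul]
  ring

lemma Bel_sum {p q : ℝ} (hpq : p.HolderConjugate q) {ι : Type} [Fintype ι] (i0 : ι) (v : ι → Pt N) (hf : Cc f) (hg : Cc g) (n : ℕ) :
    (2 * Fintype.card ι : ENNReal) * (∫⁻ x, Bel p q (RR p q) ((Mop v)^[n] f x, (Mop v)^[n] g x)) +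
      ENNReal.ofReal ((8 * RR p q ^ 2)⁻¹) * ∑ k ∈ Finset.range n, ∫⁻ x, ENNReal.ofReal |Del (v i0) ((Mop v)^[k] f) x * Del (v i0) ((Mop v)^[k] g) x| ≤
    (2 * Fintype.card ι : ENNReal) * ∫⁻ x, Bel p q (RR p q) (f x, g x) := by
  induction n with
  | zero => simp
  | succ n ih =>
    refine le_trans ?_ ih
    have := Bel_step hpq i0 v (hf.Mop_iter v n) (hg.Mop_iter v n)
    rw [Finset.sum_range_succ, mul_add, Function.iterate_succ_apply', Function.iterate_succ_apply']
    rw [add_comm (ENNReal.ofReal _ * _), ← add_assoc]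
    gcongr

lemma Bel_sum' {p q : ℝ} (hpq : p.HolderConjugate q) (ι : Type) [Fintype ι] : ∃ C : ℝ, 0 < C ∧ ∀ (N : ℕ) (i0 : ι) (v : ι → Pt N) (f g : Pt N → ℝ), Cc f → Cc g → ∀ n,
      ∑ k ∈ Finset.range n, ∫ x, |Del (v i0) ((Mop v)^[k] f) x * Del (v i0) ((Mop v)^[k] g) x| ≤
    C * ((∫ x, |f x| ^ p) + ∫ x, |g x| ^ q) := by
  obtain ⟨C, hC, H⟩ := Bel_upper hpq
  have hR : 0 < RR p q := by linarith [RR_ge hpq.lt hpq.symm.lt]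
  refine ⟨(8 * RR p q ^ 2) * ((2 * Fintype.card ι + 1) * C), by positivity, fun N i0 v f g hf hg n => ?_⟩
  have h1 : ∑ k ∈ Finset.range n, ∫ x, |Del (v i0) ((Mop v)^[k] f) x * Del (v i0) ((Mop v)^[k] g) x| =
     (∑ k ∈ Finset.range n, ∫⁻ x, ENNReal.ofReal |Del (v i0) ((Mop v)^[k] f) x * Del (v i0) ((Mop v)^[k] g) x|).toReal := by
    have cc : ∀ k, Cc (fun x => |Del (v i0) ((Mop v)^[k] f) x * Del (v i0) ((Mop v)^[k] g) x|) := fun k =>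
      (((hf.Mop_iter v k).Del _).mul ((hg.Mop_iter v k).Del _)).comp_zero (φ := fun t => |t|) continuous_abs abs_zero
    simp_rw [← ofReal_integral_eq_lintegral_ofReal (cc _).integrable (Filter.Eventually.of_forall fun _ => abs_nonneg _)]
    rw [← ENNReal.ofReal_sum_of_nonneg (fun k _ => integral_nonneg fun _ => abs_nonneg _), ENNReal.toReal_ofReal]
    exact Finset.sum_nonneg (fun k _ => integral_nonneg fun _ => abs_nonneg _)
  have S := Bel_sum hpq i0 v hf hg n
  have U : ∫⁻ x, Bel p q (RR p q) (f x, g x) ≤ ENNReal.ofReal (C * ((∫ x, |f x| ^ p) + ∫ x, |g x| ^ q)) := by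
    have c := ((hf.rpow (p := p) (by linarith [hpq.lt])).add (hg.rpow (p := q) (by linarith [hpq.symm.lt]))).const_mul C
    rw [← integral_add (hf.rpow (by linarith [hpq.lt])).integrable (hg.rpow (by linarith [hpq.symm.lt])).integrable, ← integral_const_mul,
      ofReal_integral_eq_lintegral_ofReal c.integrable (Filter.Eventually.of_forall fun _ => by positivity)]
    exact lintegral_mono fun x => H _
  set X := ∑ k ∈ Finset.range n, ∫⁻ x, ENNReal.ofReal |Del (v i0) ((Mop v)^[k] f) x * Del (v i0) ((Mop v)^[k] g) x|
  set Y := C * ((∫ x, |f x| ^ p) + ∫ x, |g x| ^ q) with hY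
  have hY0 : 0 ≤ Y := mul_nonneg hC.le (add_nonneg (integral_nonneg fun _ => by positivity) (integral_nonneg fun _ => by positivity))
  have S' : ENNReal.ofReal ((8 * RR p q ^ 2)⁻¹) * X ≤ ENNReal.ofReal ((2 * Fintype.card ι + 1) * Y) := by
    refine (le_add_self.trans S).trans ?_
    rw [ENNReal.ofReal_mul (by positivity)]
    gcongr
    rw [ENNReal.ofReal_add (by positivity) (by norm_num), ENNReal.ofReal_mul (by norm_num)]
    simp
  rw [h1]
  have := ENNReal.toReal_mono ENNReal.ofReal_ne_top S'
  rw [ENNReal.toReal_mul, ENNReal.toReal_ofReal (by positivity), ENNReal.toReal_ofReal (by positivity), inv_mul_le_iff₀ (by positivity)] at this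
  refine this.trans (le_of_eq ?_)
  rw [hY]; ring

end

section
variable {N : ℕ}

lemma pair_bound {p q : ℝ} (hpq : p.HolderConjugate q) (ι : Type) [Fintype ι] : ∃ C : ℝ, 0 < C ∧ ∀ (N : ℕ) (i0 : ι) (v : ι → Pt N) (w g : Pt N → ℝ), Cc w → Cc g →
      |∫ x, Del (v i0) w x * Del (v i0) g x| ≤
    C * ((∫ x, |w x - Mop v (Mop v w) x| ^ p) + ∫ x, |g x| ^ q) := by
  obtain ⟨C, hC, H⟩ := Bel_sum' hpq ι
  refine ⟨C, hC, fun N i0 v w g hw hg => ?_⟩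
  set a : ℕ → ℝ := fun k => ∫ x, Del (v i0) ((Mop v)^[k] w) x * Del (v i0) ((Mop v)^[k] g) x with ha
  set W : Pt N → ℝ := fun x => w x - Mop v (Mop v w) x with hW
  have hWc : Cc W := hw.sub ((hw.Mop v).Mop v)
  have hbd : ∀ f g : Pt N → ℝ, |∫ x, f x * g x| ≤ ∫ x, |f x * g x| := fun f g => abs_integral_le_integral_abs
  have hdiff : ∀ k, a k - a (k+1) = ∫ x, Del (v i0) ((Mop v)^[k] W) x * Del (v i0) ((Mop v)^[k] g) x := by
    intro k
    have e1 : a (k+1) = ∫ x, Del (v i0) ((Mop v)^[k] (Mop v (Mop v w))) x * Del (v i0) ((Mop v)^[k] g) x := by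
      simp only [ha]
      rw [show Del (v i0) ((Mop v)^[k+1] g) = Mop v (Del (v i0) ((Mop v)^[k] g)) by
        rw [Mop_Del, Function.iterate_succ_apply'],
        ← Mop_adj ((hw.Mop_iter v _).Del _) ((hg.Mop_iter v _).Del _), Mop_Del]
      rw [← Function.iterate_succ_apply, ← Function.iterate_succ_apply, ← Function.iterate_succ_apply' (Mop v)]
    rw [e1]
    simp only [ha]
    rw [← integral_sub (((hw.Mop_iter v k).Del _).mul ((hg.Mop_iter v k).Del _)).integrable ((((((hw.Mop v).Mop v)).Mop_iter v k).Del _).mul ((hg.Mop_iter v k).Del _)).integrable]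
    congr 1
    funext x
    rw [hW, Mop_iter_sub]
    simp only [Del]; ring
  have hsum : Summable (fun k => |a k|) := by
    refine summable_of_sum_range_le (c := C * ((∫ x, |w x| ^ p) + ∫ x, |g x| ^ q)) (fun _ => abs_nonneg _) (fun n => ?_)
    exact (Finset.sum_le_sum fun k _ => hbd _ _).trans (H N i0 v w g hw hg n)
  have hlim : Filter.Tendsto (fun n => C * ((∫ x, |W x| ^ p) + ∫ x, |g x| ^ q) + |a n|) Filter.atTop (nhds (C * ((∫ x, |W x| ^ p) + ∫ x, |g x| ^ q) + 0)) :=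
    hsum.tendsto_atTop_zero.const_add _
  rw [add_zero] at hlim
  refine ge_of_tendsto' hlim fun n => ?_
  have h0 : a 0 = ∑ k ∈ Finset.range n, (a k - a (k+1)) + a n := by
    rw [Finset.sum_range_sub']; ring
  change |a 0| ≤ _
  rw [h0]
  refine (abs_add_le _ _).trans ?_
  gcongr
  refine (Finset.abs_sum_le_sum_abs _ _).trans ?_
  refine le_trans (Finset.sum_le_sum fun k _ => ?_) (H N i0 v W g hWc hg n)
  rw [hdiff]; exact hbd _ _

/-! ### Smooth functions -/

def Sm (u : Pt N → ℝ) : Prop := ContDiff ℝ (⊤ : ℕ∞) u ∧ HasCompactSupport u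

variable {u w : Pt N → ℝ}

lemma Sm.cc (hu : Sm u) : Cc u := ⟨hu.1.continuous, hu.2⟩
lemma Sm.diff (hu : Sm u) : Differentiable ℝ u := hu.1.differentiable (by simp)
lemma Sm.pd (hu : Sm u) (v : Pt N) : Sm (pd v u) := by
  constructor
  · exact (hu.1.fderiv_right (m := (⊤ : ℕ∞)) (by simp)).clm_apply contDiff_const
  · exact hu.2.fderiv_apply ℝ v
lemma Sm.add (hu : Sm u) (hw : Sm w) : Sm (fun z => u z + w z) := ⟨hu.1.add hw.1, hu.2.add hw.2⟩
lemma Sm.sub (hu : Sm u) (hw : Sm w) : Sm (fun z => u z - w z) := ⟨hu.1.sub hw.1, hu.2.sub hw.2⟩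
lemma Sm.const_mul (hu : Sm u) (c : ℝ) : Sm (fun z => c * u z) :=
  ⟨contDiff_const.mul hu.1, hu.2.mul_left (f := fun _ => c)⟩
lemma Sm.shift (hu : Sm u) (v : Pt N) : Sm (fun x => u (x + v)) :=
  ⟨hu.1.comp (by fun_prop), hu.2.comp_homeomorph (Homeomorph.addRight v)⟩
lemma Sm.shift' (hu : Sm u) (v : Pt N) : Sm (fun x => u (x - v)) := by
  simpa [sub_eq_add_neg] using hu.shift (-v)
lemma Sm.zero : Sm (fun _ : Pt N => (0:ℝ)) := ⟨contDiff_const, HasCompactSupport.zero⟩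
lemma Sm.sum {ι : Type} (s : Finset ι) {F : ι → Pt N → ℝ} (h : ∀ i, Sm (F i)) : Sm (fun x => ∑ i ∈ s, F i x) := by
  classical
  induction s using Finset.induction_on with
  | empty => simpa using Sm.zero
  | insert a s ha ih => simp_rw [Finset.sum_insert ha]; exact (h a).add ih

lemma pd_add (hu : Sm u) (hw : Sm w) (v : Pt N) : pd v (fun z => u z + w z) = fun z => pd v u z + pd v w z := by
  funext z; unfold pd; rw [fderiv_fun_add (hu.diff z) (hw.diff z)]; rfl
lemma pd_sub (hu : Sm u) (hw : Sm w) (v : Pt N) : pd v (fun z => u z - w z) = fun z => pd v u z - pd v w z := by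
  funext z; unfold pd; rw [fderiv_fun_sub (hu.diff z) (hw.diff z)]; rfl
lemma pd_const_mul (hu : Sm u) (c : ℝ) (v : Pt N) : pd v (fun z => c * u z) = fun z => c * pd v u z := by
  funext z; unfold pd; rw [fderiv_const_mul (hu.diff z)]; rfl
lemma pd_shift (v a : Pt N) : pd v (fun z => u (z + a)) = fun z => pd v u (z + a) := by
  funext z; unfold pd; rw [fderiv_comp_add_right]
lemma pd_shift' (v a : Pt N) : pd v (fun z => u (z - a)) = fun z => pd v u (z - a) := by
  simpa [sub_eq_add_neg] using pd_shift (u := u) v (-a)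
lemma pd_add_vec (v a : Pt N) (z : Pt N) : pd (v + a) u z = pd v u z + pd a u z := by simp [pd]
lemma pd_smul_vec (c : ℝ) (v : Pt N) (z : Pt N) : pd (c • v) u z = c * pd v u z := by simp [pd]
lemma pd_comm (hu : Sm u) (v a : Pt N) : pd v (pd a u) = pd a (pd v u) := by
  funext z
  have h2 : ContDiff ℝ 2 u := contDiff_infty.1 hu.1 2
  have hd : Differentiable ℝ (fderiv ℝ u) := (hu.1.fderiv_right (m := (⊤ : ℕ∞)) (by simp)).differentiable (by simp)
  have e : ∀ b c : Pt N, pd b (pd c u) z = fderiv ℝ (fderiv ℝ u) z b c := by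
    intro b c
    unfold pd
    rw [fderiv_clm_apply (hd z) (by fun_prop)]
    simp
  rw [e, e]
  have hs : IsSymmSndFDerivAt ℝ u z := h2.contDiffAt.isSymmSndFDerivAt (by simp)
  exact hs _ _

lemma Sm.bdd (hu : Sm u) : ∃ C, 0 ≤ C ∧ ∀ z, |u z| ≤ C := by
  obtain ⟨C, hC⟩ := hu.2.exists_bound_of_continuous hu.1.continuous
  exact ⟨C, (norm_nonneg _).trans (hC 0), hC⟩

lemma HasCompactSupport.rad (hu : HasCompactSupport u) : ∃ R, 0 < R ∧ ∀ z, R < ‖z‖ → u z = 0 := by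
  obtain ⟨R, hR⟩ := hu.isCompact.isBounded.subset_closedBall (0 : Pt N)
  refine ⟨max R 1, by positivity, fun z hz => ?_⟩
  by_contra h
  have := hR (subset_tsupport _ h)
  rw [mem_closedBall_zero_iff] at this
  exact absurd (lt_of_le_of_lt (le_max_left R 1) hz) (not_lt.2 this)

lemma hasDeriv_line (hu : Sm u) (z v : Pt N) (t : ℝ) : HasDerivAt (fun t : ℝ => u (z + t • v)) (pd v u (z + t • v)) t := by
  have h1 : HasDerivAt (fun t : ℝ => z + t • v) v t := by
    simpa using ((hasDerivAt_id t).smul_const v).const_add z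
  exact (hu.diff _).hasFDerivAt.comp_hasDerivAt t h1

/-- second difference quotient -/
def sd (ζ : Pt N) (τ : ℝ) (w : Pt N → ℝ) (x : Pt N) : ℝ := (w (x + τ • ζ) + w (x - τ • ζ) - 2 * w x) / τ ^ 2

/-- triangular averaging -/
def Tav (ζ : Pt N) (τ : ℝ) (g : Pt N → ℝ) (x : Pt N) : ℝ :=
  ∫ t in (0:ℝ)..1, (1 - t) * (g (x + (τ * t) • ζ) + g (x - (τ * t) • ζ))

lemma line_taylor (hw : Sm w) (ζ : Pt N) (τ : ℝ) (x : Pt N) :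
    w (x + τ • ζ) + w (x - τ • ζ) - 2 * w x = τ ^ 2 * Tav ζ τ (pd ζ (pd ζ w)) x := by
  have d1 : ∀ (s : ℝ) {u : Pt N → ℝ}, Sm u → ∀ t : ℝ, HasDerivAt (fun t : ℝ => u (x + (s * t) • ζ)) (s * pd ζ u (x + (s * t) • ζ)) t := by
    intro s u hu t
    have h := (hasDeriv_line hu x ζ (s * t))
    have h2 : HasDerivAt (fun t : ℝ => s * t) s t := by simpa using (hasDerivAt_id t).const_mul s
    have := HasDerivAt.comp t h h2
    rw [mul_comm] at this
    exact this
  have d2 : ∀ t : ℝ, HasDerivAt (fun t : ℝ => (1 - t) * (τ * (pd ζ w (x + (τ * t) • ζ) - pd ζ w (x + (-τ * t) • ζ))) + (w (x + (τ * t) • ζ) + w (x + (-τ * t) • ζ)))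
      (τ ^ 2 * ((1 - t) * (pd ζ (pd ζ w) (x + (τ * t) • ζ) + pd ζ (pd ζ w) (x - (τ * t) • ζ)))) t := by
    intro t
    have a1 := d1 τ (hw.pd ζ) t
    have a2 := d1 (-τ) (hw.pd ζ) t
    have a3 := d1 τ hw t
    have a4 := d1 (-τ) hw t
    have a5 : HasDerivAt (fun t : ℝ => 1 - t) (-1) t := by simpa using (hasDerivAt_id t).const_sub 1
    have := (a5.mul ((a1.sub a2).const_mul τ)).add (a3.add a4)
    refine this.congr_deriv ?_
    rw [show x - (τ * t) • ζ = x + (-τ * t) • ζ by rw [neg_mul, neg_smul, sub_eq_add_neg]]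
    simp only [Pi.sub_apply]
    ring
  have cont : Continuous fun t : ℝ => τ ^ 2 * ((1 - t) * (pd ζ (pd ζ w) (x + (τ * t) • ζ) + pd ζ (pd ζ w) (x - (τ * t) • ζ))) := by
    have := ((hw.pd ζ).pd ζ).1.continuous
    fun_prop
  have := intervalIntegral.integral_eq_sub_of_hasDerivAt (fun t _ => d2 t) (cont.intervalIntegrable 0 1)
  rw [intervalIntegral.integral_const_mul] at this
  unfold Tav
  rw [this]
  simp only [neg_smul, ← sub_eq_add_neg, mul_one, mul_zero, zero_smul, add_zero, sub_zero, sub_self, zero_mul, zero_add]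
  ring

lemma sd_eq (hw : Sm w) (ζ : Pt N) {τ : ℝ} (hτ : τ ≠ 0) (x : Pt N) : sd ζ τ w x = Tav ζ τ (pd ζ (pd ζ w)) x := by
  unfold sd; rw [line_taylor hw, mul_div_cancel_left₀ _ (pow_ne_zero 2 hτ)]

lemma int_tri : ∫ t in (0:ℝ)..1, (1 - t) * 2 = 1 := by
  rw [intervalIntegral.integral_mul_const, intervalIntegral.integral_sub (by simp) (by simp)]
  simp; norm_num

lemma Tav_le {g : Pt N → ℝ} (_ : Continuous g) {C : ℝ} (hC : ∀ z, |g z| ≤ C) (ζ : Pt N) (τ : ℝ) (x : Pt N) : |Tav ζ τ g x| ≤ C := by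
  unfold Tav
  have : ‖∫ t in (0:ℝ)..1, (1 - t) * (g (x + (τ * t) • ζ) + g (x - (τ * t) • ζ))‖ ≤ ∫ t in (0:ℝ)..1, (1 - t) * 2 * C := by
    apply intervalIntegral.norm_integral_le_of_norm_le zero_le_one
    · filter_upwards with t ht
      rw [norm_mul, Real.norm_eq_abs, Real.norm_eq_abs, abs_of_nonneg (by linarith [ht.2])]
      have := abs_add_le (g (x + (τ * t) • ζ)) (g (x - (τ * t) • ζ))
      have h1 := hC (x + (τ * t) • ζ)
      have h2 := hC (x - (τ * t) • ζ)
      rw [mul_assoc]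
      apply mul_le_mul_of_nonneg_left _ (by linarith [ht.2])
      linarith
    · apply Continuous.intervalIntegrable; fun_prop
  rwa [intervalIntegral.integral_mul_const, int_tri, one_mul] at this

lemma Tav_tendsto {g : Pt N → ℝ} (hg : Continuous g) {C : ℝ} (hC : ∀ z, |g z| ≤ C) (ζ : Pt N) {y : ℝ → Pt N} {s : ℝ → ℝ} {x : Pt N} {l : Filter ℝ} [l.IsCountablyGenerated]
    (hy : Filter.Tendsto y l (nhds x)) (hs : Filter.Tendsto s l (nhds 0)) : Filter.Tendsto (fun τ => Tav ζ (s τ) g (y τ)) l (nhds (g x)) := by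
  have e : g x = ∫ t in (0:ℝ)..1, (1 - t) * (g x + g x) := by
    rw [← two_mul]; simp_rw [← mul_assoc]; rw [intervalIntegral.integral_mul_const, int_tri, one_mul]
  rw [e]
  unfold Tav
  apply intervalIntegral.tendsto_integral_filter_of_dominated_convergence (fun _ => 2 * C)
  · filter_upwards with τ
    apply Continuous.aestronglyMeasurable; fun_prop
  · filter_upwards with τ
    filter_upwards with t ht
    rw [Set.uIoc_of_le zero_le_one] at ht
    rw [norm_mul, Real.norm_eq_abs, Real.norm_eq_abs, abs_of_nonneg (by linarith [ht.2])]
    have := abs_add_le (g (y τ + (s τ * t) • ζ)) (g (y τ - (s τ * t) • ζ))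
    have h1 := hC (y τ + (s τ * t) • ζ)
    have h2 := hC (y τ - (s τ * t) • ζ)
    have h3 := abs_nonneg (g (y τ + (s τ * t) • ζ) + g (y τ - (s τ * t) • ζ))
    nlinarith [ht.1]
  · simp
  · filter_upwards with t ht
    have a : Filter.Tendsto (fun τ => (s τ * t) • ζ) l (nhds 0) := by
      simpa using (hs.mul_const t).smul_const ζ
    have b1 := (hg.tendsto x).comp (by simpa using hy.add a)
    have b2 := (hg.tendsto x).comp (by simpa using hy.sub a)
    exact (b1.add b2).const_mul _

end

section
variable {N : ℕ}

lemma dct_Pt {F : ℝ → Pt N → ℝ} {F0 : Pt N → ℝ} (hm : ∀ τ, Continuous (F τ)) {C R : ℝ}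
    (bd : ∀ τ, 0 < τ → τ ≤ 1 → ∀ x, |F τ x| ≤ C) (sp : ∀ τ, 0 < τ → τ ≤ 1 → ∀ x, R < ‖x‖ → F τ x = 0)
    (lim : ∀ x, Filter.Tendsto (fun τ => F τ x) (nhdsWithin 0 (Set.Ioi 0)) (nhds (F0 x))) :
    Filter.Tendsto (fun τ => ∫ x, F τ x) (nhdsWithin 0 (Set.Ioi 0)) (nhds (∫ x, F0 x)) := by
  have ev : ∀ᶠ τ in nhdsWithin (0:ℝ) (Set.Ioi 0), 0 < τ ∧ τ ≤ 1 := by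
    have := Ioo_mem_nhdsGT (show (0:ℝ) < 1 by norm_num)
    filter_upwards [this] with τ hτ using ⟨hτ.1, hτ.2.le⟩
  apply tendsto_integral_filter_of_dominated_convergence (Set.indicator (Metric.closedBall 0 R) (fun _ => C))
  · exact Filter.Eventually.of_forall fun τ => (hm τ).aestronglyMeasurable
  · filter_upwards [ev] with τ hτ
    filter_upwards with x
    by_cases hx : x ∈ Metric.closedBall (0 : Pt N) R
    · rw [Set.indicator_of_mem hx]; exact bd τ hτ.1 hτ.2 x
    · rw [Set.indicator_of_notMem hx, sp τ hτ.1 hτ.2 x (by simpa using hx)]; simp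
  · rw [integrable_indicator_iff measurableSet_closedBall]
    exact integrableOn_const (isCompact_closedBall _ _).measure_lt_top.ne
  · filter_upwards with x using lim x

lemma Mop_support {ι : Type} [Fintype ι] {w : Pt N → ℝ} {R Z : ℝ} (hR : ∀ z, R < ‖z‖ → w z = 0) (v : ι → Pt N)
    (hZ : ∀ i, ‖v i‖ ≤ Z) : ∀ z, R + Z < ‖z‖ → Mop v w z = 0 := by
  intro z hz
  unfold Mop
  rw [Finset.sum_eq_zero, mul_zero]
  intro i _
  have a1 : ‖z‖ ≤ ‖z + v i‖ + ‖v i‖ := by simpa using norm_sub_le (z + v i) (v i)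
  have a2 : ‖z‖ ≤ ‖z - v i‖ + ‖v i‖ := by simpa using norm_add_le (z - v i) (v i)
  rw [hR _ (by linarith [hZ i]), hR _ (by linarith [hZ i])]; simp

lemma one_sub_Mop {ι : Type} [Fintype ι] [Nonempty ι] {w : Pt N → ℝ} (hw : Sm w) (ζ : ι → Pt N) {τ : ℝ} (hτ : τ ≠ 0) (x : Pt N) :
    (τ^2)⁻¹ * w x - Mop (fun i => τ • ζ i) (fun x => (τ^2)⁻¹ * w x) x = -((2 * (Fintype.card ι : ℝ))⁻¹ * ∑ i, Tav (ζ i) τ (pd (ζ i) (pd (ζ i) w)) x) := by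
  have hc : (Fintype.card ι : ℝ) ≠ 0 := by exact_mod_cast Fintype.card_ne_zero
  have e : ∀ i, Tav (ζ i) τ (pd (ζ i) (pd (ζ i) w)) x = (τ^2)⁻¹ * (w (x + τ • ζ i) + w (x - τ • ζ i)) - 2 * ((τ^2)⁻¹ * w x) := by
    intro i; rw [← sd_eq hw _ hτ]; unfold sd; rw [div_eq_inv_mul]; ring
  simp_rw [e]
  rw [Finset.sum_sub_distrib, Finset.sum_const, Finset.card_univ, nsmul_eq_mul]
  unfold Mop
  simp_rw [← mul_add]
  rw [← Finset.mul_sum]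
  field_simp
  ring

lemma CZ_weak {p q : ℝ} (hpq : p.HolderConjugate q) (ι : Type) [Fintype ι] : ∃ C : ℝ, 0 < C ∧ ∀ (N : ℕ) (i0 : ι) (ζ : ι → Pt N) (w g : Pt N → ℝ), Sm w → Cc g →
    |∫ x, pd (ζ i0) (pd (ζ i0) w) x * g x| ≤ C * ((∫ x, |∑ i, pd (ζ i) (pd (ζ i) w) x| ^ p) + ∫ x, |g x| ^ q) := by
  obtain ⟨C, hC, H⟩ := pair_bound hpq ι
  have hp0 : 0 < p := by linarith [hpq.lt]
  refine ⟨C, hC, fun N i0 ζ w g hw hg => ?_⟩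
  have : Nonempty ι := ⟨i0⟩
  have hc1 : (1:ℝ) ≤ Fintype.card ι := by exact_mod_cast Fintype.card_pos
  have hc0 : (0:ℝ) < Fintype.card ι := by linarith
  set n : ℝ := (Fintype.card ι : ℝ) with hn
  have hd : ∀ i, Sm (pd (ζ i) (pd (ζ i) w)) := fun i => (hw.pd _).pd _
  choose D hD0 hD using fun i => (hd i).bdd
  obtain ⟨Rg, hRg0, hRg⟩ := HasCompactSupport.rad hg.2
  obtain ⟨Rw, hRw0, hRw⟩ := HasCompactSupport.rad hw.2
  obtain ⟨Dg, hDg⟩ := hg.2.exists_bound_of_continuous hg.1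
  set Z := ∑ i, ‖ζ i‖ with hZ
  have hζZ : ∀ i, ‖ζ i‖ ≤ Z := fun i => Finset.single_le_sum (f := fun i => ‖ζ i‖) (fun _ _ => norm_nonneg _) (Finset.mem_univ i)
  -- scaled w
  let w' : ℝ → Pt N → ℝ := fun τ x => (τ^2)⁻¹ * w x
  have hw' : ∀ τ, Cc (w' τ) := fun τ => hw.cc.const_mul _
  let F : ℝ → Pt N → ℝ := fun τ x => Del (τ • ζ i0) (Del (τ • ζ i0) (w' τ)) x * g x
  let M : ℝ → (Pt N → ℝ) → (Pt N → ℝ) := fun τ => Mop (fun i => τ • ζ i)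
  let G : ℝ → Pt N → ℝ := fun τ x => w' τ x - M τ (M τ (w' τ)) x
  have hF : ∀ τ, τ ≠ 0 → ∀ x, F τ x = 4 * Tav (ζ i0) (2 * τ) (pd (ζ i0) (pd (ζ i0) w)) x * g x := by
    intro τ hτ x
    rw [← sd_eq hw _ (mul_ne_zero two_ne_zero hτ)]
    simp only [F, Del, w', sd]
    rw [show x + τ • ζ i0 + τ • ζ i0 = x + (2 * τ) • ζ i0 by rw [two_mul, add_smul]; abel,
      show x + τ • ζ i0 - τ • ζ i0 = x by abel,
      show x - τ • ζ i0 + τ • ζ i0 = x by abel,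
      show x - τ • ζ i0 - τ • ζ i0 = x - (2 * τ) • ζ i0 by rw [two_mul, add_smul]; abel]
    field_simp
    ring
  let Q : ℝ → Pt N → ℝ := fun τ x => w' τ x - M τ (w' τ) x
  have hQ : ∀ τ, τ ≠ 0 → ∀ x, Q τ x = -((2 * n)⁻¹ * ∑ i, Tav (ζ i) τ (pd (ζ i) (pd (ζ i) w)) x) := by
    intro τ hτ x
    exact one_sub_Mop hw ζ hτ x
  have hG : ∀ τ x, G τ x = Q τ x + M τ (Q τ) x := by
    intro τ x
    simp only [G, Q, M]
    rw [Mop_sub]; ring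
  have hQb : ∀ τ, τ ≠ 0 → ∀ x, |Q τ x| ≤ ∑ i, D i := by
    intro τ hτ x
    rw [hQ τ hτ, abs_neg, abs_mul, abs_of_pos (by positivity)]
    calc _ ≤ 1 * ∑ i, D i := by
          gcongr
          · exact inv_le_one_of_one_le₀ (by linarith)
          · refine (Finset.abs_sum_le_sum_abs _ _).trans (Finset.sum_le_sum fun i _ => ?_)
            exact Tav_le (hd i).1.continuous (hD i) _ _ _
      _ = _ := one_mul _
  have hMb : ∀ (τ : ℝ) (f : Pt N → ℝ) (B : ℝ), (∀ x, |f x| ≤ B) → ∀ x, |M τ f x| ≤ B := by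
    intro τ f B hB x
    simp only [M, Mop]
    rw [abs_mul, abs_of_pos (by positivity), inv_mul_le_iff₀ hc0]
    refine (Finset.abs_sum_le_sum_abs _ _).trans ?_
    calc _ ≤ ∑ i : ι, B := by
          refine Finset.sum_le_sum fun i _ => ?_
          rw [abs_mul, abs_of_pos (by norm_num)]
          have := abs_add_le (f (x + τ • ζ i)) (f (x - τ • ζ i))
          linarith [hB (x + τ • ζ i), hB (x - τ • ζ i)]
      _ = _ := by simp [hn]
  -- limits
  have ne : ∀ᶠ τ in nhdsWithin (0:ℝ) (Set.Ioi 0), τ ≠ 0 := by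
    filter_upwards [self_mem_nhdsWithin] with τ hτ using ne_of_gt hτ
  have id0 : Filter.Tendsto (fun τ : ℝ => τ) (nhdsWithin 0 (Set.Ioi 0)) (nhds 0) := tendsto_nhdsWithin_of_tendsto_nhds Filter.tendsto_id
  have limF : Filter.Tendsto (fun τ => ∫ x, F τ x) (nhdsWithin 0 (Set.Ioi 0)) (nhds (∫ x, 4 * pd (ζ i0) (pd (ζ i0) w) x * g x)) := by
    apply dct_Pt (C := 4 * D i0 * Dg) (R := Rg)
    · intro τ; exact ((((hw' τ).Del _).Del _).mul hg).1
    · intro τ hτ _ x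
      rw [hF τ hτ.ne', abs_mul, abs_mul, abs_of_pos (show (0:ℝ) < 4 by norm_num)]
      have h1 := Tav_le (hd i0).1.continuous (hD i0) (ζ i0) (2 * τ) x
      have h2 := hDg x
      have := hD0 i0
      rw [Real.norm_eq_abs] at h2
      gcongr
    · intro τ _ _ x hx
      simp only [F]; rw [hRg x hx, mul_zero]
    · intro x
      have := ((Tav_tendsto (hd i0).1.continuous (hD i0) (ζ i0) (tendsto_const_nhds (x := x)) (s := fun τ => 2 * τ) (by simpa using id0.const_mul 2)).const_mul 4).mul_const (g x)
      refine this.congr' ?_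
      filter_upwards [ne] with τ hτ
      rw [hF τ hτ]
  have limQ : ∀ x, ∀ y : ℝ → Pt N, Filter.Tendsto y (nhdsWithin 0 (Set.Ioi 0)) (nhds x) →
      Filter.Tendsto (fun τ => Q τ (y τ)) (nhdsWithin 0 (Set.Ioi 0)) (nhds (-((2 * n)⁻¹ * ∑ i, pd (ζ i) (pd (ζ i) w) x))) := by
    intro x y hy
    have := ((tendsto_finsetSum (Finset.univ : Finset ι) fun i _ => Tav_tendsto (hd i).1.continuous (hD i) (ζ i) hy id0).const_mul ((2 * n)⁻¹)).neg
    refine this.congr' ?_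
    filter_upwards [ne] with τ hτ
    rw [hQ τ hτ]
  have limGx : ∀ x, Filter.Tendsto (fun τ => G τ x) (nhdsWithin 0 (Set.Ioi 0)) (nhds (-(n⁻¹ * ∑ i, pd (ζ i) (pd (ζ i) w) x))) := by
    intro x
    simp_rw [hG]
    have h1 := limQ x (fun _ => x) tendsto_const_nhds
    have z0 : ∀ i, Filter.Tendsto (fun τ : ℝ => τ • ζ i) (nhdsWithin 0 (Set.Ioi 0)) (nhds 0) := fun i => by simpa using id0.smul_const (ζ i)
    have h2 : ∀ i, _ := fun i => limQ x (fun τ => x + τ • ζ i) (by simpa using (z0 i).const_add x)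
    have h3 : ∀ i, _ := fun i => limQ x (fun τ => x - τ • ζ i) (by simpa using (z0 i).const_sub x)
    have h4 := (tendsto_finsetSum (Finset.univ : Finset ι) fun i _ => ((h2 i).add (h3 i)).const_mul (1/2 : ℝ)).const_mul (n⁻¹)
    have := h1.add h4
    have ee : -(n⁻¹ * ∑ i, pd (ζ i) (pd (ζ i) w) x) = -((2 * n)⁻¹ * ∑ i, pd (ζ i) (pd (ζ i) w) x) +
        n⁻¹ * ∑ c : ι, 1 / 2 * (-((2 * n)⁻¹ * ∑ i, pd (ζ i) (pd (ζ i) w) x) + -((2 * n)⁻¹ * ∑ i, pd (ζ i) (pd (ζ i) w) x)) := by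
      rw [Finset.sum_const, Finset.card_univ, nsmul_eq_mul, ← hn]
      field_simp
      ring
    rw [ee]
    exact this
  have limG : Filter.Tendsto (fun τ => ∫ x, |G τ x| ^ p) (nhdsWithin 0 (Set.Ioi 0)) (nhds (∫ x, |-(n⁻¹ * ∑ i, pd (ζ i) (pd (ζ i) w) x)| ^ p)) := by
    have hGc : ∀ τ, Cc (G τ) := fun τ => (hw' τ).sub (((hw' τ).Mop _).Mop _)
    apply dct_Pt (C := (∑ i, D i + ∑ i, D i) ^ p) (R := Rw + Z + Z)
    · intro τ; exact ((hGc τ).rpow hp0).1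
    · intro τ hτ _ x
      rw [abs_of_nonneg (by positivity)]
      apply rpow_le_rpow (abs_nonneg _) _ hp0.le
      rw [hG]
      exact (abs_add_le _ _).trans (add_le_add (hQb τ hτ.ne' x) (hMb _ _ _ (hQb τ hτ.ne') x))
    · intro τ hτ hτ1 x hx
      have hZ0 : 0 ≤ Z := (norm_nonneg _).trans (hζZ i0)
      have hv : ∀ i, ‖τ • ζ i‖ ≤ Z := fun i => by
        rw [norm_smul, Real.norm_eq_abs, abs_of_pos hτ]
        nlinarith [hζZ i, norm_nonneg (ζ i)]
      have s0 : ∀ z, Rw < ‖z‖ → w' τ z = 0 := fun z hz => by simp only [w']; rw [hRw z hz, mul_zero]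
      have : G τ x = 0 := by
        simp only [G, M]
        rw [s0 x (by linarith), Mop_support (Mop_support s0 _ hv) _ hv x hx, sub_zero]
      rw [this]; simp [hp0.ne']
    · intro x
      exact ((limGx x).abs).rpow_const (Or.inr hp0.le)
  have key : ∀ τ, |∫ x, F τ x| ≤ C * ((∫ x, |G τ x| ^ p) + ∫ x, |g x| ^ q) := by
    intro τ
    have h := H N i0 (fun i => τ • ζ i) (w' τ) g (hw' τ) hg
    simp only [F]
    rw [Del_adj ((hw' τ).Del _) hg, abs_neg]
    exact h
  have fin := le_of_tendsto_of_tendsto' limF.abs ((limG.add_const (∫ x, |g x| ^ q)).const_mul C) key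
  have e1 : ∫ x, 4 * pd (ζ i0) (pd (ζ i0) w) x * g x = 4 * ∫ x, pd (ζ i0) (pd (ζ i0) w) x * g x := by
    rw [← integral_const_mul]; congr 1; funext x; ring
  rw [e1, abs_mul, abs_of_pos (show (0:ℝ) < 4 by norm_num)] at fin
  have hS : Cc (fun x => ∑ i, pd (ζ i) (pd (ζ i) w) x) := Cc.sum _ fun i => (hd i).cc
  have e2 : ∫ x, |-(n⁻¹ * ∑ i, pd (ζ i) (pd (ζ i) w) x)| ^ p ≤ ∫ x, |∑ i, pd (ζ i) (pd (ζ i) w) x| ^ p := by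
    refine integral_mono ?_ (hS.rpow hp0).integrable ?_
    · have := (hS.const_mul (n⁻¹)).rpow hp0
      simpa [abs_neg] using this.integrable
    · intro x
      dsimp only
      apply rpow_le_rpow (abs_nonneg _) _ hp0.le
      rw [abs_neg, abs_mul, abs_of_pos (by positivity)]
      exact mul_le_of_le_one_left (abs_nonneg _) (inv_le_one_of_one_le₀ hc1)
  calc _ ≤ 4 * |∫ x, pd (ζ i0) (pd (ζ i0) w) x * g x| := by
        linarith [abs_nonneg (∫ x, pd (ζ i0) (pd (ζ i0) w) x * g x)]
    _ ≤ _ := fin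
    _ ≤ _ := by gcongr

/-- Calderon-Zygmund type inequality. -/
lemma CZ {p : ℝ} (hp : 1 < p) (ι : Type) [Fintype ι] : ∃ C : ℝ, 0 < C ∧ ∀ (N : ℕ) (i0 : ι) (ζ : ι → Pt N) (w : Pt N → ℝ), Sm w →
    ∫ x, |pd (ζ i0) (pd (ζ i0) w) x| ^ p ≤ C * ∫ x, |∑ i, pd (ζ i) (pd (ζ i) w) x| ^ p := by
  set q := p.conjExponent with hq
  have hpq : p.HolderConjugate q := Real.HolderConjugate.conjExponent hp
  have hp0 : 0 < p := by linarith
  have hq1 := hpq.symm.lt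
  obtain ⟨C, hC, H⟩ := CZ_weak hpq ι
  -- choose s with C s^q = s / 2
  obtain ⟨s, hs0, hs⟩ : ∃ s : ℝ, 0 < s ∧ C * s ^ q ≤ s / 2 := by
    refine ⟨(2 * C)⁻¹ ^ (1 / (q - 1)), by positivity, ?_⟩
    set t := (2 * C)⁻¹ ^ (1 / (q - 1)) with ht
    have ht0 : 0 < t := by positivity
    have : t ^ (q - 1) = (2 * C)⁻¹ := by
      rw [ht, ← rpow_mul (by positivity), one_div_mul_cancel (by linarith), rpow_one]
    have e : t ^ q = t * t ^ (q - 1) := by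
      rw [← rpow_one_add' ht0.le (by linarith)]; ring_nf
    rw [e, this]; apply le_of_eq; field_simp
  refine ⟨2 * C / s, by positivity, fun N i0 ζ w hw => ?_⟩
  set f := pd (ζ i0) (pd (ζ i0) w) with hf
  have hfc : Cc f := ((hw.pd _).pd _).cc
  let φ : ℝ → ℝ := fun t => s * (|t| ^ (p - 1) * SignType.sign t)
  have hφ : ∀ t, φ t = s * (|t| ^ (p - 1) * SignType.sign t) := fun t => rfl
  have hφ0 : φ 0 = 0 := by simp [φ]
  have hφc : Continuous φ := by
    have : φ = fun t => s * ((max t 0) ^ (p-1) - (max (-t) 0) ^ (p-1)) := by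
      funext t
      rcases lt_trichotomy t 0 with h | h | h
      · simp [φ, h, abs_of_neg h, max_eq_right h.le, max_eq_left (neg_nonneg.2 h.le), zero_rpow (show p - 1 ≠ 0 by linarith)]
      · simp [φ, h]
      · simp [φ, h, abs_of_pos h, max_eq_left h.le, max_eq_right (neg_nonpos.2 h.le), zero_rpow (show p - 1 ≠ 0 by linarith)]
    rw [this]
    have a1 : Continuous fun t : ℝ => (max t 0) ^ (p-1) := (by fun_prop : Continuous fun t : ℝ => max t 0).rpow_const fun _ => Or.inr (by linarith)
    have a2 : Continuous fun t : ℝ => (max (-t) 0) ^ (p-1) := (by fun_prop : Continuous fun t : ℝ => max (-t) 0).rpow_const fun _ => Or.inr (by linarith)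
    exact (a1.sub a2).const_mul s
  have hg : Cc (fun x => φ (f x)) := hfc.comp_zero hφc hφ0
  have h := H N i0 ζ w _ hw hg
  have e1 : ∀ t : ℝ, t * φ t = s * |t| ^ p := by
    intro t
    by_cases ht : t = 0
    · simp [ht, φ, hp0.ne']
    · have : |t| ^ p = |t| * |t| ^ (p-1) := by
        rw [← rpow_one_add' (abs_nonneg t) (by linarith)]; ring_nf
      rw [this, hφ]
      have : t * SignType.sign t = |t| := by rw [mul_comm]; exact sign_mul_self t
      calc _ = s * (|t| ^ (p-1) * (t * SignType.sign t)) := by ring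
        _ = _ := by rw [this]; ring
  have e2 : ∀ t : ℝ, |φ t| ^ q = s ^ q * |t| ^ p := by
    intro t
    by_cases ht : t = 0
    · simp [ht, φ, hp0.ne', (show q ≠ 0 by linarith)]
    · have h1 : |((SignType.sign t : SignType) : ℝ)| = 1 := by
        rcases lt_or_gt_of_ne ht with h | h <;> simp [h]
      rw [hφ, abs_mul, abs_mul, h1, mul_one, abs_of_pos hs0, abs_of_nonneg (by positivity), mul_rpow hs0.le (by positivity), ← rpow_mul (abs_nonneg _)]
      have : (p - 1) * q = p := hpq.sub_one_mul_conj
      rw [this]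
  simp_rw [← hf, e1, e2] at h
  rw [integral_const_mul, integral_const_mul] at h
  have hP : 0 ≤ ∫ x, |f x| ^ p := integral_nonneg fun x => by positivity
  set P := ∫ x, |f x| ^ p
  set S := ∫ x, |∑ i, pd (ζ i) (pd (ζ i) w) x| ^ p
  rw [abs_of_nonneg (by positivity)] at h
  rw [div_mul_eq_mul_div, le_div_iff₀ hs0]
  nlinarith [mul_le_mul_of_nonneg_right hs hP]

end

section
variable {N : ℕ}

/-! ### Averages of smooth functions -/

lemma avg_hasFDeriv {Ω : Type} [MeasurableSpace Ω] {ν : Measure Ω} {F : Type} [NormedAddCommGroup F] [NormedSpace ℝ F]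
    {c : Ω → ℝ} (hc : Integrable c ν) {σ : Ω → Pt N} (hσ : Measurable σ) {u : Pt N → F} (hu : ContDiff ℝ (⊤ : ℕ∞) u) (hs : HasCompactSupport u) (z : Pt N) :
    HasFDerivAt (fun z => ∫ ω, c ω • u (z + σ ω) ∂ν) (∫ ω, c ω • fderiv ℝ u (z + σ ω) ∂ν) z := by
  have hd := hu.differentiable (by simp)
  have hfc : Continuous (fderiv ℝ u) := hu.continuous_fderiv (by simp)
  obtain ⟨C, hC⟩ := (hs.fderiv ℝ).exists_bound_of_continuous hfc
  obtain ⟨C0, hC0⟩ := hs.exists_bound_of_continuous hu.continuous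
  have meas : ∀ {G : Type} [NormedAddCommGroup G] [NormedSpace ℝ G] (g : Pt N → G), Continuous g → ∀ z, AEStronglyMeasurable (fun ω => c ω • g (z + σ ω)) ν := by
    intro G _ _ g hg z
    apply hc.1.smul
    have h1 : StronglyMeasurable σ := hσ.stronglyMeasurable
    exact (hg.comp_stronglyMeasurable (h1.const_add z)).aestronglyMeasurable
  refine hasFDerivAt_integral_of_dominated_of_fderiv_le (F := fun z ω => c ω • u (z + σ ω)) (F' := fun z ω => c ω • fderiv ℝ u (z + σ ω)) (bound := fun ω => ‖c ω‖ * C) (s := Set.univ) Filter.univ_mem ?_ ?_ ?_ ?_ ?_ ?_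
  · exact Filter.Eventually.of_forall fun z => meas u hu.continuous z
  · refine (hc.norm.mul_const C0).mono' (meas u hu.continuous z) ?_
    filter_upwards with ω
    rw [norm_smul]
    gcongr
    exact hC0 _
  · exact meas _ hfc z
  · filter_upwards with ω z' _
    rw [norm_smul]
    gcongr
    exact hC _
  · exact hc.norm.mul_const C
  · filter_upwards with ω z' _
    have h1 := (hd (z' + σ ω)).hasFDerivAt
    have h2 := (hasFDerivAt_comp_add_right (𝕜 := ℝ) (f := u) (x := z') (σ ω)).2 h1
    exact h2.const_smul (c ω)

lemma avg_contDiff_nat {Ω : Type} [MeasurableSpace Ω] {ν : Measure Ω}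
    {c : Ω → ℝ} (hc : Integrable c ν) {σ : Ω → Pt N} (hσ : Measurable σ) (n : ℕ) : ∀ {F : Type} [NormedAddCommGroup F] [NormedSpace ℝ F] {u : Pt N → F}, ContDiff ℝ (⊤ : ℕ∞) u → HasCompactSupport u →
    ContDiff ℝ n (fun z => ∫ ω, c ω • u (z + σ ω) ∂ν) := by
  induction n with
  | zero =>
    intro F _ _ u hu hs
    have : Differentiable ℝ (fun z => ∫ ω, c ω • u (z + σ ω) ∂ν) := fun z => (avg_hasFDeriv hc hσ hu hs z).differentiableAt
    exact contDiff_zero.2 this.continuous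
  | succ n ih =>
    intro F _ _ u hu hs
    have h := avg_hasFDeriv hc hσ hu hs
    push_cast
    rw [contDiff_succ_iff_fderiv]
    refine ⟨fun z => (h z).differentiableAt, by simp, ?_⟩
    have e : fderiv ℝ (fun z => ∫ ω, c ω • u (z + σ ω) ∂ν) = fun z => ∫ ω, c ω • fderiv ℝ u (z + σ ω) ∂ν := by
      funext z; exact (h z).fderiv
    rw [e]
    exact ih (hu.fderiv_right (m := (⊤ : ℕ∞)) (by simp)) (hs.fderiv ℝ)

lemma avg_contDiff {Ω : Type} [MeasurableSpace Ω] {ν : Measure Ω}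
    {c : Ω → ℝ} (hc : Integrable c ν) {σ : Ω → Pt N} (hσ : Measurable σ) {u : Pt N → ℝ} (hu : Sm u) :
    ContDiff ℝ (⊤ : ℕ∞) (fun z => ∫ ω, c ω * u (z + σ ω) ∂ν) := 
  contDiff_infty.2 fun n => avg_contDiff_nat hc hσ n hu.1 hu.2

lemma avg_int {Ω : Type} [MeasurableSpace Ω] {ν : Measure Ω} {F : Type} [NormedAddCommGroup F] [NormedSpace ℝ F]
    {c : Ω → ℝ} (hc : Integrable c ν) {σ : Ω → Pt N} (hσ : Measurable σ) {u : Pt N → F} (hu : Continuous u) (hs : HasCompactSupport u) (z : Pt N) :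
    Integrable (fun ω => c ω • u (z + σ ω)) ν := by
  obtain ⟨C0, hC0⟩ := hs.exists_bound_of_continuous hu
  refine (hc.norm.mul_const C0).mono' ?_ ?_
  · apply hc.1.smul
    have h1 : StronglyMeasurable σ := hσ.stronglyMeasurable
    exact (hu.comp_stronglyMeasurable (h1.const_add z)).aestronglyMeasurable
  · filter_upwards with ω
    rw [norm_smul]
    gcongr
    exact hC0 _

lemma avg_pd {Ω : Type} [MeasurableSpace Ω] {ν : Measure Ω}
    {c : Ω → ℝ} (hc : Integrable c ν) {σ : Ω → Pt N} (hσ : Measurable σ) {u : Pt N → ℝ} (hu : Sm u) (v : Pt N) :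
    pd v (fun z => ∫ ω, c ω * u (z + σ ω) ∂ν) = fun z => ∫ ω, c ω * pd v u (z + σ ω) ∂ν := by
  funext z
  unfold pd
  have h := (avg_hasFDeriv hc hσ hu.1 hu.2 z).fderiv
  simp only [smul_eq_mul] at h
  rw [h, ContinuousLinearMap.integral_apply]
  · rfl
  · exact avg_int hc hσ (hu.1.continuous_fderiv (by simp)) (hu.2.fderiv ℝ) z

/-- Tav as a sum of averages -/
lemma Tav_eq {g : Pt N → ℝ} (hg : Cc g) (ζ : Pt N) (τ : ℝ) : Tav ζ τ g = fun z =>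
    (∫ t in Set.Ioc (0:ℝ) 1, (1 - t) * g (z + (τ * t) • ζ)) + ∫ t in Set.Ioc (0:ℝ) 1, (1 - t) * g (z + (-(τ * t)) • ζ) := by
  funext z
  unfold Tav
  rw [intervalIntegral.integral_of_le zero_le_one, ← integral_add]
  · congr 1; funext t; rw [neg_smul, ← sub_eq_add_neg]; ring
  · have := hg.1
    exact (Continuous.integrableOn_Icc (by fun_prop)).mono_set Set.Ioc_subset_Icc_self
  · have := hg.1
    exact (Continuous.integrableOn_Icc (by fun_prop)).mono_set Set.Ioc_subset_Icc_self

lemma tri_int : Integrable (fun t : ℝ => 1 - t) (volume.restrict (Set.Ioc (0:ℝ) 1)) :=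
  (Continuous.integrableOn_Icc (by fun_prop)).mono_set Set.Ioc_subset_Icc_self

lemma Sm.Tav {u : Pt N → ℝ} (hu : Sm u) (ζ : Pt N) (τ : ℝ) : Sm (Tav ζ τ u) := by
  constructor
  · rw [Tav_eq hu.cc]
    exact (avg_contDiff tri_int (by fun_prop) hu).add (avg_contDiff tri_int (by fun_prop) hu)
  · obtain ⟨R, hR0, hR⟩ := HasCompactSupport.rad hu.2
    refine HasCompactSupport.intro (isCompact_closedBall (0 : Pt N) (R + ‖τ • ζ‖)) fun z hz => ?_
    have hz : R + ‖τ • ζ‖ < ‖z‖ := by simpa using hz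
    unfold _root_.Tav
    rw [intervalIntegral.integral_congr (g := fun _ => 0), intervalIntegral.integral_zero]
    intro t ht
    rw [Set.uIcc_of_le zero_le_one] at ht
    have hb : ‖(τ * t) • ζ‖ ≤ ‖τ • ζ‖ := by
      rw [norm_smul, norm_smul, norm_mul]
      gcongr
      rw [Real.norm_eq_abs t, abs_of_nonneg ht.1]
      exact mul_le_of_le_one_right (norm_nonneg _) ht.2
    set a := (τ * t) • ζ
    have a1 : ‖z‖ ≤ ‖z + a‖ + ‖a‖ := by simpa using norm_sub_le (z + a) a
    have a2 : ‖z‖ ≤ ‖z - a‖ + ‖a‖ := by simpa using norm_add_le (z - a) a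
    dsimp only
    rw [hR _ (by linarith), hR _ (by linarith)]; simp

lemma Tav_pd {u : Pt N → ℝ} (hu : Sm u) (ζ : Pt N) (τ : ℝ) (v : Pt N) : pd v (Tav ζ τ u) = Tav ζ τ (pd v u) := by
  have h1 := avg_contDiff tri_int (σ := fun t => (τ * t) • ζ) (by fun_prop) hu
  have h2 := avg_contDiff tri_int (σ := fun t => (-(τ * t)) • ζ) (by fun_prop) hu
  have p1 := avg_pd tri_int (σ := fun t => (τ * t) • ζ) (by fun_prop) hu v
  have p2 := avg_pd tri_int (σ := fun t => (-(τ * t)) • ζ) (by fun_prop) hu v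
  rw [Tav_eq (hu.pd v).cc, Tav_eq hu.cc]
  funext z
  unfold pd at *
  rw [fderiv_fun_add (h1.differentiable (by simp) z) (h2.differentiable (by simp) z), ContinuousLinearMap.add_apply, congrFun p1 z, congrFun p2 z]

lemma Tav_linear {f g : Pt N → ℝ} (hf : Cc f) (hg : Cc g) (c : ℝ) (ζ : Pt N) (τ : ℝ) (z : Pt N) :
    Tav ζ τ (fun z => f z + c * g z) z = Tav ζ τ f z + c * Tav ζ τ g z := by
  unfold Tav
  have := hf.1
  have := hg.1
  rw [← intervalIntegral.integral_const_mul, ← intervalIntegral.integral_add (Continuous.intervalIntegrable (by fun_prop) _ _) (Continuous.intervalIntegrable (by fun_prop) _ _)]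
  congr 1; funext t; ring

/-! ### Slices -/

def sl (p : ℝ) (g : Pt N → ℝ) (y : ℝ) : ENNReal := ∫⁻ x : Fin N → ℝ, ‖g (x, y)‖ₑ ^ p

/-- global energy -/
def En (p : ℝ) (g : Pt N → ℝ) : ENNReal := ∫⁻ z, ‖g z‖ₑ ^ p

lemma sl_meas {p : ℝ} {g : Pt N → ℝ} (hg : Measurable g) : Measurable (sl p g) := by
  unfold sl
  apply Measurable.lintegral_prod_left' (f := fun z : Pt N => ‖g z‖ₑ ^ p)
  fun_prop

lemma En_eq {p : ℝ} {g : Pt N → ℝ} (hg : Measurable g) : En p g = ∫⁻ y, sl p g y := by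
  unfold En sl
  exact lintegral_prod_symm' (f := fun z : Pt N => ‖g z‖ₑ ^ p) (by fun_prop)

lemma En_real {p : ℝ} (hp : 0 < p) {g : Pt N → ℝ} (hg : Cc g) : En p g = ENNReal.ofReal (∫ z, |g z| ^ p) := by
  unfold En
  rw [ofReal_integral_eq_lintegral_ofReal (hg.rpow hp).integrable (Filter.Eventually.of_forall fun _ => by positivity)]
  congr 1; funext z
  rw [Real.enorm_eq_ofReal_abs, ENNReal.ofReal_rpow_of_nonneg (abs_nonneg _) hp.le]

lemma CZE {p : ℝ} (hp : 1 < p) (ι : Type) [Fintype ι] : ∃ C : ENNReal, C ≠ ⊤ ∧ ∀ (N : ℕ) (i0 : ι) (ζ : ι → Pt N) (w : Pt N → ℝ), Sm w →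
    En p (pd (ζ i0) (pd (ζ i0) w)) ≤ C * En p (fun z => ∑ i, pd (ζ i) (pd (ζ i) w) z) := by
  obtain ⟨C, hC, H⟩ := CZ hp ι
  refine ⟨ENNReal.ofReal C, ENNReal.ofReal_ne_top, fun N i0 ζ w hw => ?_⟩
  rw [En_real (by linarith) ((hw.pd _).pd _).cc, En_real (by linarith) (Cc.sum _ fun i => ((hw.pd _).pd _).cc), ← ENNReal.ofReal_mul hC.le]
  exact ENNReal.ofReal_le_ofReal (H N i0 ζ w hw)

lemma pow_add_le {p : ℝ} (hp : 1 ≤ p) (a b : ENNReal) : (a + b) ^ p ≤ 2 ^ (p-1) * (a ^ p + b ^ p) :=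
  ENNReal.rpow_add_le_mul_rpow_add_rpow a b hp

lemma epow_add_le {p : ℝ} (hp : 1 ≤ p) (a b : ℝ) : ‖a + b‖ₑ ^ p ≤ 2 ^ (p-1) * (‖a‖ₑ ^ p + ‖b‖ₑ ^ p) := 
  (ENNReal.rpow_le_rpow (enorm_add_le _ _) (by linarith)).trans (pow_add_le hp _ _)

lemma two_pow_ne_top (p : ℝ) : (2 : ENNReal) ^ p ≠ ⊤ := by
  apply ENNReal.rpow_ne_top_of_ne_zero <;> simp

lemma epow_sum_le {p : ℝ} (hp : 1 ≤ p) {ι : Type} (s : Finset ι) (a : ι → ℝ) : ‖∑ i ∈ s, a i‖ₑ ^ p ≤ (s.card : ENNReal) ^ (p-1) * ∑ i ∈ s, ‖a i‖ₑ ^ p := by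
  refine (ENNReal.rpow_le_rpow (enorm_sum_le _ _) (by linarith)).trans ?_
  exact ENNReal.rpow_sum_le_const_mul_sum_rpow s _ hp

lemma sl_add_le {p : ℝ} (hp : 1 ≤ p) {f g : Pt N → ℝ} (hf : Measurable f) (y : ℝ) :
    sl p (fun z => f z + g z) y ≤ 2 ^ (p-1) * (sl p f y + sl p g y) := by
  unfold sl
  rw [← lintegral_add_left (by fun_prop), ← lintegral_const_mul' _ _ (two_pow_ne_top _)]
  exact lintegral_mono fun x => epow_add_le hp _ _

lemma sl_sum_le {p : ℝ} (hp : 1 ≤ p) {ι : Type} (s : Finset ι) {f : ι → Pt N → ℝ} (hf : ∀ i, Measurable (f i)) (y : ℝ) :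
    sl p (fun z => ∑ i ∈ s, f i z) y ≤ (s.card : ENNReal) ^ (p-1) * ∑ i ∈ s, sl p (f i) y := by
  unfold sl
  rw [← lintegral_finsetSum s (fun i _ => by have := hf i; fun_prop), ← lintegral_const_mul' _ _ (ENNReal.rpow_ne_top_of_nonneg (by linarith) (by simp))]
  exact lintegral_mono fun x => epow_sum_le hp _ _

lemma sl_le_const {p : ℝ} (hp : 0 ≤ p) {f g : Pt N → ℝ} {c y : ℝ} (h : ∀ x, |f (x, y)| ≤ c * |g (x, y)|) : 
    sl p f y ≤ (ENNReal.ofReal c) ^ p * sl p g y := by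
  unfold sl
  rw [← lintegral_const_mul' _ _ (ENNReal.rpow_ne_top_of_nonneg hp (by simp))]
  refine lintegral_mono fun x => ?_
  rw [← ENNReal.mul_rpow_of_nonneg _ _ hp]
  apply ENNReal.rpow_le_rpow _ hp
  rw [Real.enorm_eq_ofReal_abs, Real.enorm_eq_ofReal_abs, ← ENNReal.ofReal_mul' (abs_nonneg _)]
  exact ENNReal.ofReal_le_ofReal (h x)

lemma sl_congr {p : ℝ} {f g : Pt N → ℝ} {y : ℝ} (h : ∀ x, f (x, y) = g (x, y)) : sl p f y = sl p g y := by
  unfold sl; simp_rw [h]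

lemma lintegral_rpow_jensen {Ω : Type} [MeasurableSpace Ω] {ν : Measure Ω} [IsProbabilityMeasure ν] {p : ℝ} (hp : 1 < p) {f : Ω → ENNReal} (hf : AEMeasurable f ν) :
    (∫⁻ ω, f ω ∂ν) ^ p ≤ ∫⁻ ω, f ω ^ p ∂ν := by
  have hpq := Real.HolderConjugate.conjExponent hp
  have := ENNReal.lintegral_mul_le_Lp_mul_Lq ν hpq hf (aemeasurable_const (b := (1 : ENNReal)))
  simp only [Pi.mul_apply, mul_one, ENNReal.one_rpow, lintegral_const, measure_univ] at this
  calc _ ≤ ((∫⁻ ω, f ω ^ p ∂ν) ^ (1/p)) ^ p := ENNReal.rpow_le_rpow this (by linarith)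
    _ = _ := by rw [← ENNReal.rpow_mul, one_div_mul_cancel (by linarith), ENNReal.rpow_one]

/-- averaging along horizontal translations -/
lemma sl_avg {Ω : Type} [MeasurableSpace Ω] {ν : Measure Ω} [IsProbabilityMeasure ν] {p : ℝ} (hp : 1 < p) {g : Pt N → ℝ} (hg : Continuous g) {a : Ω → ℝ} (ha : Measurable a)
    {ζ : Pt N} (hζ : ζ.2 = 0) (y : ℝ) : ∫⁻ x, (∫⁻ ω, ‖g ((x, y) + a ω • ζ)‖ₑ ∂ν) ^ p ≤ sl p g y := by
  have hm : Measurable (fun w : (Fin N → ℝ) × Ω => ‖g ((w.1, y) + a w.2 • ζ)‖ₑ) := by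
    have : Measurable (fun w : (Fin N → ℝ) × Ω => ((w.1, y) : Pt N) + a w.2 • ζ) := by fun_prop
    exact (hg.measurable.comp this).enorm
  calc _ ≤ ∫⁻ x : Fin N → ℝ, (∫⁻ ω, ‖g ((x, y) + a ω • ζ)‖ₑ ^ p ∂ν) := by
        refine lintegral_mono fun x => lintegral_rpow_jensen hp ?_
        exact (hm.comp (measurable_prodMk_left (x := x))).aemeasurable
    _ = ∫⁻ ω, (∫⁻ x : Fin N → ℝ, ‖g ((x, y) + a ω • ζ)‖ₑ ^ p) ∂ν := by
        apply lintegral_lintegral_swap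
        exact (hm.pow_const p).aemeasurable
    _ = ∫⁻ ω, sl p g y ∂ν := by
        congr 1; funext ω
        unfold sl
        have : ∀ x : Fin N → ℝ, ((x, y) : Pt N) + a ω • ζ = (x + a ω • ζ.1, y) := by
          intro x; ext <;> simp [hζ]
        simp_rw [this]
        exact lintegral_add_right_eq_self (fun x => ‖g (x, y)‖ₑ ^ p) (a ω • ζ.1)
    _ = _ := by simp

/-- unit interval probability -/
abbrev nu01 : Measure ℝ := volume.restrict (Set.Ioc (0:ℝ) 1)
instance : IsProbabilityMeasure nu01 := ⟨by simp⟩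

/-- A function dominated by two averages. -/
lemma sl_two_avg {Ω : Type} [MeasurableSpace Ω] {ν : Measure Ω} [IsProbabilityMeasure ν] {p : ℝ} (hp : 1 < p) {f g : Pt N → ℝ} (hg : Continuous g) {a : Ω → ℝ} (ha : Measurable a)
    {ζ : Pt N} (hζ : ζ.2 = 0) (c : ENNReal) (y : ℝ)
    (h : ∀ z, ‖f z‖ₑ ≤ c * ((∫⁻ ω, ‖g (z + a ω • ζ)‖ₑ ∂ν) + ∫⁻ ω, ‖g (z + (-a ω) • ζ)‖ₑ ∂ν)) :
    sl p f y ≤ c ^ p * 2 ^ p * sl p g y := by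
  have hp0 : 0 ≤ p := by linarith
  have m1 : ∀ {a : Ω → ℝ}, Measurable a → Measurable (fun x : Fin N → ℝ => (∫⁻ ω, ‖g ((x, y) + a ω • ζ)‖ₑ ∂ν) ^ p) := by
    intro a ha
    have hm : Measurable (fun w : (Fin N → ℝ) × Ω => ‖g ((w.1, y) + a w.2 • ζ)‖ₑ) := by
      have : Measurable (fun w : (Fin N → ℝ) × Ω => ((w.1, y) : Pt N) + a w.2 • ζ) := by fun_prop
      exact (hg.measurable.comp this).enorm
    exact (hm.lintegral_prod_right').pow_const p
  calc sl p f y ≤ ∫⁻ x, c ^ p * (2 ^ (p-1) * ((∫⁻ ω, ‖g ((x,y) + a ω • ζ)‖ₑ ∂ν) ^ p + (∫⁻ ω, ‖g ((x,y) + (-a ω) • ζ)‖ₑ ∂ν) ^ p)) := by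
        refine lintegral_mono fun x => ?_
        refine (ENNReal.rpow_le_rpow (h _) hp0).trans ?_
        rw [ENNReal.mul_rpow_of_nonneg _ _ hp0]
        gcongr
        exact pow_add_le hp.le _ _
    _ = c ^ p * (2 ^ (p-1) * ((∫⁻ x, (∫⁻ ω, ‖g ((x,y) + a ω • ζ)‖ₑ ∂ν) ^ p) + ∫⁻ x, (∫⁻ ω, ‖g ((x,y) + (-a ω) • ζ)‖ₑ ∂ν) ^ p)) := by
        have m2 := m1 ha
        have m3 := m1 ha.neg
        simp only [Pi.neg_apply] at m3
        rw [lintegral_const_mul _ (by fun_prop), lintegral_const_mul _ (by fun_prop), lintegral_add_left m2]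
    _ ≤ c ^ p * (2 ^ (p-1) * (sl p g y + sl p g y)) := by
        gcongr
        · exact sl_avg hp hg ha hζ y
        · exact sl_avg hp hg ha.neg hζ y
    _ = _ := by
        rw [← two_mul, ← mul_assoc (2 ^ (p-1)), mul_assoc (c ^ p)]
        congr 2
        nth_rewrite 2 [← ENNReal.rpow_one 2]
        rw [← ENNReal.rpow_add _ _ two_ne_zero (by simp)]; ring_nf

end

section
variable {N : ℕ}

/-! ### Averaging bounds on slices -/

lemma sl_ker {p : ℝ} (hp : 1 < p) {f g : Pt N → ℝ} (hg : Cc g) {k : ℝ → ℝ} {c : ℝ} (hk : ∀ t ∈ Set.Ioc (0:ℝ) 1, |k t| ≤ c)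
    {s : ℝ} (hs : |s| ≤ 1) {ζ : Pt N} (hζ : ζ.2 = 0) (τ : ℝ) 
    (h : ∀ z, f z = ∫ t in (0:ℝ)..1, k t * (g (z + (τ * t) • ζ) + s * g (z - (τ * t) • ζ))) (y : ℝ) :
    sl p f y ≤ (ENNReal.ofReal c) ^ p * 2 ^ p * sl p g y := by
  refine sl_two_avg (ν := nu01) hp hg.1 (a := fun t => τ * t) (by fun_prop) hζ _ y fun z => ?_
  have hgc := hg.1
  have hm : Measurable fun ω : ℝ => ‖g (z + (τ * ω) • ζ)‖ₑ := by
    have : Continuous fun ω : ℝ => g (z + (τ * ω) • ζ) := by fun_prop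
    exact this.measurable.enorm
  have hm2 : Measurable fun ω : ℝ => ‖g (z + (-(τ * ω)) • ζ)‖ₑ := by
    have : Continuous fun ω : ℝ => g (z + (-(τ * ω)) • ζ) := by fun_prop
    exact this.measurable.enorm
  rw [h z, intervalIntegral.integral_of_le zero_le_one, ← lintegral_add_left hm, ← lintegral_const_mul' _ _ ENNReal.ofReal_ne_top]
  refine (enorm_integral_le_lintegral_enorm _).trans ?_
  refine setLIntegral_mono (by fun_prop) fun t ht => ?_
  rw [enorm_mul]
  gcongr
  · rw [Real.enorm_eq_ofReal_abs]; exact ENNReal.ofReal_le_ofReal (hk t ht)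
  · refine (enorm_add_le _ _).trans ?_
    rw [neg_smul, ← sub_eq_add_neg]
    gcongr
    rw [enorm_mul]
    refine mul_le_of_le_one_left' ?_
    rw [Real.enorm_eq_ofReal_abs]
    exact ENNReal.ofReal_le_one.2 hs

lemma ibp01 {φ φ' K k : ℝ → ℝ} (hφ : ∀ t, HasDerivAt φ (φ' t) t) (hφ' : Continuous φ') (h0 : φ 0 = 0)
    (hK : ∀ t, HasDerivAt K (-k t) t) (hk : Continuous k) (hK1 : K 1 = 0) :
    ∫ t in (0:ℝ)..1, k t * φ t = ∫ t in (0:ℝ)..1, K t * φ' t := by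
  have := intervalIntegral.integral_mul_deriv_eq_deriv_mul (a := 0) (b := 1) (u := K) (v := φ) (u' := fun t => - k t) (v' := φ')
    (fun t _ => hK t) (fun t _ => hφ t) (by apply Continuous.intervalIntegrable; fun_prop) (by apply Continuous.intervalIntegrable; fun_prop)
  rw [this, hK1, h0]
  simp

lemma line_deriv {g : Pt N → ℝ} (hg : Sm g) (z ζ : Pt N) (τ t : ℝ) :
    HasDerivAt (fun t => g (z + (τ * t) • ζ)) (τ * pd ζ g (z + (τ * t) • ζ)) t := by
  have h1 := hasDeriv_line hg z ζ (τ * t)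
  have h2 : HasDerivAt (fun t : ℝ => τ * t) τ t := by simpa using (hasDerivAt_id t).const_mul τ
  have := h1.comp t h2
  rw [mul_comm] at this
  exact this

lemma line_deriv' {g : Pt N → ℝ} (hg : Sm g) (z ζ : Pt N) (τ t : ℝ) :
    HasDerivAt (fun t => g (z - (τ * t) • ζ)) (-(τ * pd ζ g (z - (τ * t) • ζ))) t := by
  have := line_deriv hg z ζ (-τ) t
  simpa [neg_mul, neg_smul, ← sub_eq_add_neg] using this

lemma sl_Tav {p : ℝ} (hp : 1 < p) {g : Pt N → ℝ} (hg : Cc g) {ζ : Pt N} (hζ : ζ.2 = 0) (τ y : ℝ) :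
    sl p (Tav ζ τ g) y ≤ 2 ^ p * sl p g y := by
  have := sl_ker (f := Tav ζ τ g) hp hg (k := fun t => 1 - t) (c := 1) (s := 1) (fun t ht => by rw [abs_le]; constructor <;> linarith [ht.1, ht.2]) (by simp) hζ τ
    (fun z => by simp [Tav]) y
  simpa using this

lemma Tav_sub_eq {g : Pt N → ℝ} (hg : Cc g) (ζ : Pt N) (τ : ℝ) (z : Pt N) :
    Tav ζ τ g z - g z = ∫ t in (0:ℝ)..1, (1 - t) * (g (z + (τ * t) • ζ) + g (z - (τ * t) • ζ) - 2 * g z) := by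
  have hgc := hg.1
  unfold Tav
  have : g z = ∫ t in (0:ℝ)..1, (1 - t) * (2 * g z) := by
    have e : (fun t : ℝ => (1 - t) * (2 * g z)) = fun t => ((1 - t) * 2) * g z := by funext t; ring
    rw [e, intervalIntegral.integral_mul_const, int_tri]; ring
  conv_lhs => rw [this]
  rw [← intervalIntegral.integral_sub (by apply Continuous.intervalIntegrable; fun_prop) (by apply Continuous.intervalIntegrable; fun_prop)]
  congr 1; funext t; ring

lemma Tav_sub_eq1 {g : Pt N → ℝ} (hg : Sm g) (ζ : Pt N) (τ : ℝ) (z : Pt N) :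
    Tav ζ τ g z - g z = ∫ t in (0:ℝ)..1, ((1 - t)^2/2) * (τ * pd ζ g (z + (τ * t) • ζ) - τ * pd ζ g (z - (τ * t) • ζ)) := by
  rw [Tav_sub_eq hg.cc]
  have hc := (hg.pd ζ).cc.1
  refine ibp01 (φ := fun t => g (z + (τ * t) • ζ) + g (z - (τ * t) • ζ) - 2 * g z) (k := fun t => 1 - t) (K := fun t => (1-t)^2/2) ?_ (by fun_prop) (by simp; ring) ?_ (by fun_prop) (by simp)
  · intro t
    have := ((line_deriv hg z ζ τ t).add (line_deriv' hg z ζ τ t)).sub_const (2 * g z)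
    exact this
  · intro t
    have : HasDerivAt (fun t : ℝ => (1 - t)^2/2) (((2:ℕ) * (1-t)^(2-1) * (-1))/2) t :=
      (((hasDerivAt_id t).const_sub 1).pow 2).div_const 2
    convert this using 1; push_cast; ring

lemma Tav_sub_eq2 {g : Pt N → ℝ} (hg : Sm g) (ζ : Pt N) (τ : ℝ) (z : Pt N) :
    Tav ζ τ g z - g z = ∫ t in (0:ℝ)..1, ((1 - t)^3/6) * (τ * (τ * pd ζ (pd ζ g) (z + (τ * t) • ζ)) + τ * (τ * pd ζ (pd ζ g) (z - (τ * t) • ζ))) := by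
  rw [Tav_sub_eq1 hg]
  have hc := ((hg.pd ζ).pd ζ).cc.1
  refine ibp01 (φ := fun t => τ * pd ζ g (z + (τ * t) • ζ) - τ * pd ζ g (z - (τ * t) • ζ)) (k := fun t => (1-t)^2/2) (K := fun t => (1-t)^3/6) ?_ (by fun_prop) (by simp) ?_ (by fun_prop) (by simp)
  · intro t
    have := ((line_deriv (hg.pd ζ) z ζ τ t).const_mul τ).sub ((line_deriv' (hg.pd ζ) z ζ τ t).const_mul τ)
    exact this.congr_deriv (by ring)
  · intro t
    have : HasDerivAt (fun t : ℝ => (1 - t)^3/6) (((3:ℕ) * (1-t)^(3-1) * (-1))/6) t :=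
      (((hasDerivAt_id t).const_sub 1).pow 3).div_const 6
    convert this using 1; push_cast; ring

lemma pd_Tav_eq {g : Pt N → ℝ} (hg : Sm g) (ζ : Pt N) {τ : ℝ} (hτ : 0 < τ) (z : Pt N) :
    pd ζ (Tav ζ τ g) z = ∫ t in (0:ℝ)..1, τ⁻¹ * (g (z + (τ * t) • ζ) + (-1) * g (z - (τ * t) • ζ)) := by
  rw [Tav_pd hg]
  unfold Tav
  have hc := (hg.pd ζ).cc.1
  have := ibp01 (φ := fun t => τ⁻¹ * (g (z + (τ * t) • ζ) + (-1) * g (z - (τ * t) • ζ))) (φ' := fun t => pd ζ g (z + (τ * t) • ζ) + pd ζ g (z - (τ * t) • ζ)) (k := fun t => 1) (K := fun t => 1 - t) ?_ (by fun_prop) (by simp) ?_ (by fun_prop) (by simp)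
  · rw [← this]; congr 1; funext t; ring
  · intro t
    have := (((line_deriv hg z ζ τ t)).add ((line_deriv' hg z ζ τ t).const_mul (-1))).const_mul τ⁻¹
    refine this.congr_deriv ?_
    field_simp
  · intro t
    exact (hasDerivAt_id t).const_sub 1

lemma sl_neg {p : ℝ} (f : Pt N → ℝ) (y : ℝ) : sl p (fun z => - f z) y = sl p f y := by simp [sl]

lemma sl_one_sub_Tav1 {p : ℝ} (hp : 1 < p) {g : Pt N → ℝ} (hg : Sm g) {ζ : Pt N} (hζ : ζ.2 = 0) {τ : ℝ} (hτ : 0 < τ) (y : ℝ) :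
    sl p (fun z => g z - Tav ζ τ g z) y ≤ (ENNReal.ofReal τ) ^ p * 2 ^ p * sl p (pd ζ g) y := by
  rw [← sl_neg]
  refine sl_ker hp (hg.pd ζ).cc (k := fun t => τ * ((1-t)^2/2)) (s := -1) ?_ (by simp) hζ τ (fun z => ?_) y
  · intro t ht
    rw [abs_mul, abs_of_pos hτ, abs_of_nonneg (by positivity)]
    apply mul_le_of_le_one_right hτ.le
    nlinarith [ht.1, ht.2]
  · rw [neg_sub, Tav_sub_eq1 hg]
    congr 1; funext t; ring

lemma sl_one_sub_Tav2 {p : ℝ} (hp : 1 < p) {g : Pt N → ℝ} (hg : Sm g) {ζ : Pt N} (hζ : ζ.2 = 0) {τ : ℝ} (y : ℝ) :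
    sl p (fun z => g z - Tav ζ τ g z) y ≤ (ENNReal.ofReal (τ^2)) ^ p * 2 ^ p * sl p (pd ζ (pd ζ g)) y := by
  rw [← sl_neg]
  refine sl_ker hp ((hg.pd ζ).pd ζ).cc (k := fun t => τ^2 * ((1-t)^3/6)) (s := 1) ?_ (by simp) hζ τ (fun z => ?_) y
  · intro t ht
    have h1 : 0 ≤ 1 - t := by linarith [ht.2]
    rw [abs_mul, abs_of_nonneg (by positivity), abs_of_nonneg (by positivity)]
    apply mul_le_of_le_one_right (by positivity)
    have : (1-t)^3 ≤ 1 := pow_le_one₀ h1 (by linarith [ht.1])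
    linarith
  · rw [neg_sub, Tav_sub_eq2 hg]
    congr 1; funext t; ring

lemma sl_one_sub_Tav0 {p : ℝ} (hp : 1 < p) {g : Pt N → ℝ} (hg : Cc g) {ζ : Pt N} (hζ : ζ.2 = 0) {τ : ℝ} (y : ℝ) :
    sl p (fun z => g z - Tav ζ τ g z) y ≤ (2 ^ (p-1) * (1 + 2 ^ p)) * sl p g y := by
  have := sl_add_le hp.le (f := g) (g := fun z => - Tav ζ τ g z) hg.1.measurable y
  rw [sl_neg] at this
  refine this.trans ?_
  rw [mul_assoc]
  gcongr
  rw [add_mul, one_mul]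
  gcongr
  exact sl_Tav hp hg hζ τ y

lemma sl_pd_Tav {p : ℝ} (hp : 1 < p) {g : Pt N → ℝ} (hg : Sm g) {ζ : Pt N} (hζ : ζ.2 = 0) {τ : ℝ} (hτ : 0 < τ) (y : ℝ) :
    sl p (pd ζ (Tav ζ τ g)) y ≤ (ENNReal.ofReal τ⁻¹) ^ p * 2 ^ p * sl p g y := by
  refine sl_ker hp hg.cc (k := fun t => τ⁻¹) (s := -1) ?_ (by simp) hζ τ (fun z => pd_Tav_eq hg ζ hτ z) y
  intro t ht
  rw [abs_of_pos (by positivity)]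

/-! ### Mixed derivatives -/

lemma En_add_le {p : ℝ} (hp : 1 ≤ p) {f g : Pt N → ℝ} (hf : Measurable f) :
    En p (fun z => f z + g z) ≤ 2 ^ (p-1) * (En p f + En p g) := by
  unfold En
  rw [← lintegral_add_left (by fun_prop), ← lintegral_const_mul' _ _ (two_pow_ne_top _)]
  exact lintegral_mono fun x => epow_add_le hp _ _

lemma En_const_mul {p : ℝ} (hp : 0 ≤ p) (c : ℝ) (f : Pt N → ℝ) : En p (fun z => c * f z) = ‖c‖ₑ ^ p * En p f := by
  unfold En
  rw [← lintegral_const_mul' _ _ (ENNReal.rpow_ne_top_of_nonneg hp (by simp))]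
  simp_rw [enorm_mul, ENNReal.mul_rpow_of_nonneg _ _ hp]

lemma CZ2 {p : ℝ} (hp : 1 < p) : ∃ C : ENNReal, C ≠ ⊤ ∧ ∀ (N : ℕ) (a b : Pt N) (w : Pt N → ℝ), Sm w →
    En p (pd a (pd b w)) ≤ C * (En p (pd a (pd a w)) + En p (pd b (pd b w))) := by
  obtain ⟨C, hC, H⟩ := CZE hp (Fin 2)
  refine ⟨2 ^ (p-1) * (‖(1/4:ℝ)‖ₑ ^ p * C * (‖(2:ℝ)‖ₑ ^ p * 2 ^ (p-1)) + ‖(1/4:ℝ)‖ₑ ^ p * C * (‖(2:ℝ)‖ₑ ^ p * 2 ^ (p-1))), ?_, fun N a b w hw => ?_⟩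
  · have := two_pow_ne_top (p-1)
    have h4 : ‖(1/4:ℝ)‖ₑ ^ p ≠ ⊤ := ENNReal.rpow_ne_top_of_nonneg (by linarith) (by simp)
    have h2 : ‖(2:ℝ)‖ₑ ^ p ≠ ⊤ := ENNReal.rpow_ne_top_of_nonneg (by linarith) (by simp)
    finiteness
  have p0 : 0 ≤ p := by linarith
  have expand : ∀ s t : ℝ, ∀ z, pd (a + s • b) (pd (a + s • b) w) z = pd a (pd a w) z + 2 * s * pd a (pd b w) z + s^2 * pd b (pd b w) z := by
    intro s t z
    have e : pd (a + s • b) w = fun z => pd a w z + s * pd b w z := by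
      funext z; rw [pd_add_vec, pd_smul_vec]
    rw [e, pd_add (hw.pd a) ((hw.pd b).const_mul s), pd_const_mul (hw.pd b)]
    dsimp only
    rw [pd_add_vec, pd_add_vec, pd_smul_vec, pd_smul_vec, pd_comm hw b a]
    ring
  set e1 := a + (1:ℝ) • b
  set e2 := a + (-1:ℝ) • b
  have key : ∀ i, En p (pd (![e1, e2] i) (pd (![e1, e2] i) w)) ≤ C * (‖(2:ℝ)‖ₑ ^ p * 2 ^ (p-1) * (En p (pd a (pd a w)) + En p (pd b (pd b w)))) := by
    intro i
    refine (H N i ![e1, e2] w hw).trans ?_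
    gcongr
    rw [mul_assoc]
    refine le_trans (le_of_eq ?_) (mul_le_mul_right (En_add_le hp.le ((hw.pd a).pd a).cc.meas) _)
    rw [← En_const_mul p0]
    congr 1; funext z
    rw [Fin.sum_univ_two]
    simp only [Matrix.cons_val_zero, Matrix.cons_val_one]
    rw [expand 1 0, expand (-1) 0]; ring
  have e : pd a (pd b w) = fun z => (1/4) * pd e1 (pd e1 w) z + (1/4) * (-pd e2 (pd e2 w) z) := by
    funext z
    rw [expand 1 0, expand (-1) 0]; ring
  rw [e]
  refine (En_add_le hp.le (((hw.pd e1).pd e1).const_mul _).cc.meas).trans ?_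
  rw [En_const_mul p0, En_const_mul p0]
  have en : En p (fun z => - pd e2 (pd e2 w) z) = En p (pd e2 (pd e2 w)) := by simp [En]
  rw [en, mul_assoc (2 ^ (p-1)), add_mul, mul_assoc (_ * C), mul_assoc _ C]
  gcongr
  · exact key 0
  · exact key 1

lemma CZ2' {p : ℝ} (hp : 1 < p) : ∃ C : ENNReal, C ≠ ⊤ ∧ ∀ (N : ℕ) (a b : Pt N) (w : Pt N → ℝ) (δ : ℝ), 0 < δ → Sm w →
    En p (pd a (pd b w)) ≤ C * ((ENNReal.ofReal δ⁻¹) ^ p * En p (pd a (pd a w)) + (ENNReal.ofReal δ) ^ p * En p (pd b (pd b w))) := by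
  obtain ⟨C, hC, H⟩ := CZ2 hp
  refine ⟨C, hC, fun N a b w δ hδ hw => ?_⟩
  have p0 : 0 ≤ p := by linarith
  have h := H N a (δ • b) w hw
  have e : pd (δ • b) w = fun z => δ * pd b w z := by funext z; rw [pd_smul_vec]
  have e1 : pd a (pd (δ • b) w) = fun z => δ * pd a (pd b w) z := by
    rw [e]; funext z; rw [pd_const_mul (hw.pd b)]
  have e2 : pd (δ • b) (pd (δ • b) w) = fun z => δ * (δ * pd b (pd b w) z) := by
    rw [e]; funext z; rw [pd_const_mul (hw.pd b)]; dsimp only; rw [pd_smul_vec]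
  rw [e1, e2, En_const_mul p0, En_const_mul p0, En_const_mul p0, Real.enorm_eq_ofReal hδ.le] at h
  have hd : (ENNReal.ofReal δ⁻¹) ^ p * (ENNReal.ofReal δ) ^ p = 1 := by
    rw [← ENNReal.mul_rpow_of_nonneg _ _ p0, ← ENNReal.ofReal_mul (by positivity), inv_mul_cancel₀ hδ.ne']; simp
  calc _ = (ENNReal.ofReal δ⁻¹) ^ p * ((ENNReal.ofReal δ) ^ p * En p (pd a (pd b w))) := by rw [← mul_assoc, hd, one_mul]
    _ ≤ (ENNReal.ofReal δ⁻¹) ^ p * (C * (En p (pd a (pd a w)) + ENNReal.ofReal δ ^ p * (ENNReal.ofReal δ ^ p * En p (pd b (pd b w))))) := by gcongr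
    _ = C * ((ENNReal.ofReal δ⁻¹) ^ p * En p (pd a (pd a w)) + ((ENNReal.ofReal δ⁻¹) ^ p * ENNReal.ofReal δ ^ p) * (ENNReal.ofReal δ ^ p * En p (pd b (pd b w)))) := by ring
    _ = _ := by rw [hd, one_mul]

end

section
variable {N : ℕ}

/-! ### Cut-off in the vertical variable -/

lemma Sm.cut {θ : ℝ → ℝ} (hθ : ContDiff ℝ (⊤ : ℕ∞) θ) {r : Pt N → ℝ} (hr : Sm r) : Sm (fun z => θ z.2 * r z) :=
  ⟨(hθ.comp contDiff_snd).mul hr.1, hr.2.mul_left⟩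

lemma pd_cut {θ : ℝ → ℝ} (hθ : ContDiff ℝ (⊤ : ℕ∞) θ) {r : Pt N → ℝ} (hr : Sm r) (v : Pt N) :
    pd v (fun z => θ z.2 * r z) = fun z => v.2 * (deriv θ z.2 * r z) + θ z.2 * pd v r z := by
  funext z
  unfold pd
  have h1 : HasFDerivAt (fun z : Pt N => θ z.2) (deriv θ z.2 • ContinuousLinearMap.snd ℝ (Fin N → ℝ) ℝ) z :=
    ((hθ.differentiable (by simp) z.2).hasDerivAt).comp_hasFDerivAt z hasFDerivAt_snd
  have h2 := (hr.diff z).hasFDerivAt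
  have e := (h1.mul h2).fderiv
  simp only [Pi.mul_def] at e
  rw [e]
  simp
  ring

lemma Sm_deriv {θ : ℝ → ℝ} (hθ : ContDiff ℝ (⊤ : ℕ∞) θ) : ContDiff ℝ (⊤ : ℕ∞) (deriv θ) := by
  have := hθ.iterate_deriv 1
  simpa using this

lemma pd_pd_cut {θ : ℝ → ℝ} (hθ : ContDiff ℝ (⊤ : ℕ∞) θ) {r : Pt N → ℝ} (hr : Sm r) (v : Pt N) :
    pd v (pd v (fun z => θ z.2 * r z)) = fun z => v.2^2 * (deriv (deriv θ) z.2 * r z) + 2 * v.2 * (deriv θ z.2 * pd v r z) + θ z.2 * pd v (pd v r) z := by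
  have h' := Sm_deriv hθ
  rw [pd_cut hθ hr, pd_add ((hr.cut h').const_mul _) ((hr.pd v).cut hθ), pd_cut hθ (hr.pd v), pd_const_mul (hr.cut h'), pd_cut h' hr]
  funext z
  ring

/-- the bump -/
def chi : ContDiffBump (3/2 : ℝ) := ⟨3/4, 1, by norm_num, by norm_num⟩
def th : ℝ → ℝ := chi

lemma th_smooth : ContDiff ℝ (⊤ : ℕ∞) th := chi.contDiff
lemma th_one {y : ℝ} (h : y ∈ Set.Ioo (3/4) (9/4)) : th y = 1 := by
  apply chi.one_of_mem_closedBall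
  simp only [chi, Metric.mem_closedBall, Real.dist_eq, abs_le]
  constructor <;> linarith [h.1, h.2]
lemma th_zero {y : ℝ} (h : y ∉ Set.Icc (1/2) (5/2)) : th y = 0 := by
  apply chi.zero_of_le_dist
  simp only [chi, Real.dist_eq]
  by_contra hc
  push Not at hc
  rw [abs_lt] at hc
  exact h ⟨by linarith, by linarith⟩
lemma th_zero_nhds {y : ℝ} (h : y ∉ Set.Icc (1/2) (5/2)) : th =ᶠ[nhds y] fun _ => 0 := by
  have := isClosed_Icc.isOpen_compl.mem_nhds h
  filter_upwards [this] with y hy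
  exact th_zero hy
lemma th_one_nhds {y : ℝ} (h : y ∈ Set.Icc (1:ℝ) 2) : th =ᶠ[nhds y] fun _ => 1 := by
  have := (isOpen_Ioo (a := (3/4:ℝ)) (b := 9/4)).mem_nhds (x := y) ⟨by linarith [h.1], by linarith [h.2]⟩
  filter_upwards [this] with y hy
  exact th_one hy
lemma th_cs : HasCompactSupport th := chi.hasCompactSupport

lemma th_d1_zero {y : ℝ} (h : y ∉ Set.Icc (1/2) (5/2)) : deriv th y = 0 := by
  rw [(th_zero_nhds h).deriv_eq]; simp
lemma th_d2_zero {y : ℝ} (h : y ∉ Set.Icc (1/2) (5/2)) : deriv (deriv th) y = 0 := by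
  rw [(th_zero_nhds h).deriv.deriv_eq]; simp
lemma th_d1_one {y : ℝ} (h : y ∈ Set.Icc (1:ℝ) 2) : deriv th y = 0 := by
  rw [(th_one_nhds h).deriv_eq]; simp
lemma th_d2_one {y : ℝ} (h : y ∈ Set.Icc (1:ℝ) 2) : deriv (deriv th) y = 0 := by
  rw [(th_one_nhds h).deriv.deriv_eq]; simp

lemma th_bdd : ∃ B : ℝ, 1 ≤ B ∧ ∀ y, |th y| ≤ B ∧ |deriv th y| ≤ B ∧ |deriv (deriv th) y| ≤ B := by
  obtain ⟨B0, h0⟩ := th_cs.exists_bound_of_continuous th_smooth.continuous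
  obtain ⟨B1, h1⟩ := th_cs.deriv.exists_bound_of_continuous (Sm_deriv th_smooth).continuous
  obtain ⟨B2, h2⟩ := th_cs.deriv.deriv.exists_bound_of_continuous (Sm_deriv (Sm_deriv th_smooth)).continuous
  refine ⟨max 1 (max B0 (max B1 B2)), le_max_left _ _, fun y => ⟨(h0 y).trans ?_, (h1 y).trans ?_, (h2 y).trans ?_⟩⟩ <;> simp

abbrev cut (r : Pt N → ℝ) : Pt N → ℝ := fun z => th z.2 * r z

abbrev thin : Set ℝ := Set.Icc (1:ℝ) 2
abbrev fat : Set ℝ := Set.Icc (1/2:ℝ) (5/2)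

lemma En_fat {p : ℝ} (hp : 0 < p) {g : Pt N → ℝ} (hg : Measurable g) {A : ℝ → ENNReal} (h0 : ∀ z : Pt N, z.2 ∉ fat → g z = 0)
    (h : ∀ y ∈ fat, sl p g y ≤ A y) : En p g ≤ ∫⁻ y in fat, A y := by
  rw [En_eq hg, ← lintegral_indicator measurableSet_Icc]
  refine lintegral_mono fun y => ?_
  by_cases hy : y ∈ fat
  · rw [Set.indicator_of_mem hy]; exact h y hy
  · rw [Set.indicator_of_notMem hy]
    unfold sl
    simp [fun x => h0 (x, y) hy, hp]

lemma En_thin {p : ℝ} {g g' : Pt N → ℝ} (hg : Measurable g') (h : ∀ z : Pt N, z.2 ∈ thin → g z = g' z) :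
     (∫⁻ y in thin, sl p g y) ≤ En p g' := by
  rw [En_eq hg]
  calc _ = ∫⁻ y in thin, sl p g' y := by
        refine setLIntegral_congr_fun measurableSet_Icc fun y hy => sl_congr fun x => h (x, y) hy
    _ ≤ _ := setLIntegral_le_lintegral _ _

/-! ### Dilations and layers -/

def dil (R : ℝ) (u : Pt N → ℝ) : Pt N → ℝ := fun z => u (R • z)

lemma Sm.dil {u : Pt N → ℝ} (hu : Sm u) {R : ℝ} (hR : 0 < R) : Sm (dil R u) := by
  refine ⟨hu.1.comp (contDiff_const_smul R), ?_⟩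
  exact hu.2.comp_isClosedEmbedding (Homeomorph.smulOfNeZero R hR.ne').isClosedEmbedding

lemma pd_dil {u : Pt N → ℝ} (hu : Sm u) (R : ℝ) (v : Pt N) : pd v (dil R u) = fun z => R * dil R (pd v u) z := by
  funext z
  unfold pd dil
  have h1 : HasFDerivAt (fun z : Pt N => R • z) (R • ContinuousLinearMap.id ℝ (Pt N)) z := (hasFDerivAt_id z).const_smul R
  have := ((hu.diff (R • z)).hasFDerivAt).comp z h1
  have e := this.fderiv
  unfold Function.comp at e
  rw [e]; simp

lemma pd_pd_dil {u : Pt N → ℝ} (hu : Sm u) {R : ℝ} (hR : 0 < R) (v w : Pt N) : pd v (pd w (dil R u)) = fun z => R^2 * pd v (pd w u) (R • z) := by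
  rw [pd_dil hu, pd_const_mul ((hu.pd w).dil hR), pd_dil (hu.pd w)]
  funext z; simp [dil]; ring

/-- common scaling factor -/
def scf (N : ℕ) (p R : ℝ) : ENNReal := ENNReal.ofReal (R^2) ^ p * ENNReal.ofReal ((R^N)⁻¹)

lemma scf_ne {N : ℕ} {p R : ℝ} (hp : 0 < p) (hR : 0 < R) : scf N p R ≠ 0 ∧ scf N p R ≠ ⊤ := by
  unfold scf
  constructor
  · have : ENNReal.ofReal (R^2) ^ p ≠ 0 := by
      rw [Ne, ENNReal.rpow_eq_zero_iff]
      have : ENNReal.ofReal (R^2) ≠ 0 := by simp; positivity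
      simp [this]
    have h2 : ENNReal.ofReal ((R^N)⁻¹) ≠ 0 := by simp; positivity
    exact mul_ne_zero this h2
  · exact ENNReal.mul_ne_top (ENNReal.rpow_ne_top_of_nonneg hp.le (by simp)) (by simp)

lemma lint_comp_smul {E : Type} [NormedAddCommGroup E] [NormedSpace ℝ E] [MeasureSpace E] [BorelSpace E] [FiniteDimensional ℝ E] [(volume : Measure E).IsAddHaarMeasure]
    {R : ℝ} (hR : R ≠ 0) (f : E → ENNReal) :
    ∫⁻ x, f (R • x) = ENNReal.ofReal |(R ^ Module.finrank ℝ E)⁻¹| * ∫⁻ x, f x := by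
  have h1 := Measure.map_addHaar_smul (volume : Measure E) hR
  have h2 := (Homeomorph.smulOfNeZero (α := E) R hR).measurableEmbedding.lintegral_map (μ := volume) f
  have h3 : (⇑(Homeomorph.smulOfNeZero (α := E) R hR)) = fun x => R • x := rfl
  rw [h3, h1, lintegral_smul_measure] at h2
  exact h2.symm

/-- slices of dilated functions -/
lemma sl_dil {p : ℝ} (hp : 0 < p) {R : ℝ} (hR : 0 < R) {g g' : Pt N → ℝ} {s : ℝ} (h : ∀ x, g' (x, s) = R^2 * g (R • (x, s))) :
    sl p g' s = scf N p R * sl p g (R * s) := by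
  unfold sl scf
  simp_rw [h, enorm_mul, ENNReal.mul_rpow_of_nonneg _ _ hp.le]
  rw [lintegral_const_mul' _ _ (ENNReal.rpow_ne_top_of_nonneg hp.le (by simp)), Real.enorm_eq_ofReal (by positivity), mul_assoc]
  congr 1
  have := lint_comp_smul (E := Fin N → ℝ) hR.ne' (fun x => ‖g (x, R * s)‖ₑ ^ p)
  simp only [Prod.smul_mk, smul_eq_mul]
  rw [this]
  simp [abs_of_pos hR]

/-- weighted integral -/
def J (m : ℝ) (A : ℝ → ENNReal) : ENNReal := ∫⁻ y in Set.Ioi (0:ℝ), ENNReal.ofReal (y ^ m) * A y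

def lc (m a b : ℝ) : ENNReal := ∫⁻ s in Set.Icc a b, ENNReal.ofReal (s ^ (-m-1))

lemma layer {m : ℝ} {A : ℝ → ENNReal} (hA : Measurable A) {a b : ℝ} (ha : 0 < a) :
    (∫⁻ R in Set.Ioi (0:ℝ), ENNReal.ofReal (R ^ m) * ∫⁻ s in Set.Icc a b, A (R * s)) = lc m a b * J m A := by
  have e1 : ∀ R, ENNReal.ofReal (R ^ m) * ∫⁻ s in Set.Icc a b, A (R * s) = ∫⁻ s in Set.Icc a b, ENNReal.ofReal (R ^ m) * A (R * s) := by
    intro R; rw [lintegral_const_mul' _ _ (by simp)]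
  simp_rw [e1]
  rw [lintegral_lintegral_swap (by fun_prop)]
  unfold lc
  rw [← lintegral_mul_const _ (by fun_prop)]
  refine setLIntegral_congr_fun measurableSet_Icc fun s hs => ?_
  have hs0 : 0 < s := ha.trans_le hs.1
  unfold J
  have h1 : (∫⁻ y in Set.Ioi (0:ℝ), ENNReal.ofReal (y ^ m) * A y) = ENNReal.ofReal s * ∫⁻ R in Set.Ioi (0:ℝ), ENNReal.ofReal ((R * s) ^ m) * A (R * s) := by
    rw [← lintegral_indicator measurableSet_Ioi, ← lintegral_indicator measurableSet_Ioi]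
    have := lint_comp_smul (E := ℝ) hs0.ne' ((Set.Ioi (0:ℝ)).indicator fun y => ENNReal.ofReal (y ^ m) * A y)
    simp only [Module.finrank_self, pow_one, abs_of_pos (inv_pos.2 hs0), smul_eq_mul] at this
    have e2 : ((Set.Ioi (0:ℝ)).indicator fun R => ENNReal.ofReal ((R * s) ^ m) * A (R * s)) = fun R => ((Set.Ioi (0:ℝ)).indicator fun y => ENNReal.ofReal (y ^ m) * A y) (s * R) := by
      funext R
      simp only [Set.indicator_apply, Set.mem_Ioi, mul_comm s R]
      congr 1
      rw [eq_iff_iff]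
      exact (mul_pos_iff_of_pos_right hs0).symm
    rw [e2, this, ← mul_assoc, ← ENNReal.ofReal_mul hs0.le, mul_inv_cancel₀ hs0.ne']; simp
  rw [h1, ← mul_assoc, ← ENNReal.ofReal_mul (by positivity), ← lintegral_const_mul' _ _ (by simp)]
  refine setLIntegral_congr_fun measurableSet_Ioi fun R hR => ?_
  rw [← mul_assoc, ← ENNReal.ofReal_mul (by positivity), Real.mul_rpow (le_of_lt hR) hs0.le]
  congr 2
  have : s ^ (-m-1) * s * s ^ m = 1 := by
    nth_rewrite 2 [← Real.rpow_one s]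
    rw [← Real.rpow_add hs0, ← Real.rpow_add hs0]; simp
  calc _ = R ^ m * (s ^ (-m-1) * s * s ^ m) := by rw [this, mul_one]
    _ = _ := by ring

lemma lc_ne {m a b : ℝ} (ha : 0 < a) (hab : a < b) : lc m a b ≠ 0 ∧ lc m a b ≠ ⊤ := by
  unfold lc
  have hc : ContinuousOn (fun s : ℝ => s ^ (-m-1)) (Set.Icc a b) := by
    apply ContinuousOn.rpow_const continuousOn_id
    intro x hx; left; exact (ha.trans_le hx.1).ne'
  constructor
  · rw [Ne, setLIntegral_eq_zero_iff measurableSet_Icc (by fun_prop)]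
    intro h
    have : ∀ᵐ x : ℝ, x ∉ Set.Icc a b := by
      filter_upwards [h] with x hx hm
      have h0 := hx hm
      have : 0 < x := ha.trans_le hm.1
      have := Real.rpow_pos_of_pos this (-m-1)
      rw [ENNReal.ofReal_eq_zero] at h0
      linarith
    have h2 : volume (Set.Icc a b) = 0 := by
      rw [← nonpos_iff_eq_zero, ← (ae_iff.1 this)]
      exact measure_mono fun x hx => by simpa using hx
    simp at h2; linarith
  · exact (hc.integrableOn_Icc).lintegral_lt_top.ne

/-- The layer principle: an inequality on the unit layers, valid for all dilates. -/
lemma layer_principle {m a b a' b' : ℝ} (ha : 0 < a) (ha' : 0 < a') {A0 A1 A2 : ℝ → ENNReal} (h0 : Measurable A0) (h1 : Measurable A1) (h2 : Measurable A2)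
    (h : ∀ R > 0, (∫⁻ s in thin, A0 (R * s)) ≤ (∫⁻ s in Set.Icc a b, A1 (R * s)) + ∫⁻ s in Set.Icc a' b', A2 (R * s)) :
    lc m 1 2 * J m A0 ≤ lc m a b * J m A1 + lc m a' b' * J m A2 := by
  rw [← layer h0 one_pos, ← layer h1 ha, ← layer h2 ha']
  rw [← lintegral_add_left]
  · refine setLIntegral_mono' measurableSet_Ioi fun R hR => ?_
    rw [← mul_add]
    gcongr
    exact h R hR
  · apply Measurable.mul (by fun_prop)
    exact Measurable.lintegral_prod_right' (f := fun w : ℝ × ℝ => A1 (w.1 * w.2)) (by fun_prop)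

end

section
variable {N : ℕ}

/-! ### The normalized operator and the maximum principle -/

def Dv (a : Fin N → ℝ) : Pt N := (a, 1)
def Gop (a : Fin N → ℝ) (u : Pt N → ℝ) (z : Pt N) : ℝ := (∑ k, pd (ex k) (pd (ex k) u) z) + pd (Dv a) (pd (Dv a) u) z
def Lop (a : Fin N → ℝ) (κ : ℝ) (u : Pt N → ℝ) (z : Pt N) : ℝ := Gop a u z + κ / z.2 * pd ey u z
def Bc (u : Pt N → ℝ) : Prop := Sm u ∧ ∃ δ > 0, ∀ z : Pt N, 0 ≤ z.2 → z.2 ≤ δ → pd ey u z = 0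

lemma max_second {φ φ' : ℝ → ℝ} {c : ℝ} (hφ : ∀ᶠ t in nhds 0, HasDerivAt φ (φ' t) t) (hc : HasDerivAt φ' c 0)
    (hmax : IsLocalMax φ 0) : φ' 0 = 0 ∧ c ≤ 0 := by
  have h0 : φ' 0 = 0 := hmax.hasDerivAt_eq_zero hφ.self_of_nhds
  refine ⟨h0, ?_⟩
  by_contra hpos
  push Not at hpos
  have e : deriv φ =ᶠ[nhds 0] φ' := hφ.mono fun t ht => ht.deriv
  have hdd : deriv (deriv φ) 0 = c := by rw [e.deriv_eq, hc.deriv]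
  have hmin := isLocalMin_of_deriv_deriv_pos (f := φ) (x₀ := 0) (by rw [hdd]; exact hpos) (by rw [e.self_of_nhds, h0]) hφ.self_of_nhds.continuousAt
  have hcon : φ =ᶠ[nhds 0] fun _ => φ 0 := by
    filter_upwards [hmin, hmax] with t h1 h2
    exact le_antisymm h2 h1
  have e2 : deriv φ =ᶠ[nhds 0] fun _ => 0 := by
    refine hcon.deriv.trans ?_
    simp [Filter.EventuallyEq]
  have : deriv (deriv φ) 0 = 0 := by rw [e2.deriv_eq]; simp
  linarith

lemma MP0 {a : Fin N → ℝ} {κ : ℝ} {Z : Pt N → ℝ} (hZ : Sm Z) {δ y0 : ℝ} (hδ : 0 < δ) (hδy : δ < y0)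
    (hb : ∀ x, pd ey Z (x, δ) = 0) {S S1 S2 : ℝ → ℝ} (hS : ∀ y > 0, HasDerivAt S (S1 y) y) (hS1 : ∀ y > 0, HasDerivAt S1 (S2 y) y)
    (hpos : ∀ y, δ ≤ y → y ≤ y0 → 0 ≤ S y) (htop : ∀ x, Z (x, y0) ≤ S y0) (hneg : S1 δ < 0)
    (hL : ∀ x y, δ < y → y < y0 → S2 y + κ / y * S1 y < Lop a κ Z (x, y)) :
    ∀ x y, δ ≤ y → y ≤ y0 → Z (x, y) ≤ S y := by
  by_contra hcon
  push Not at hcon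
  obtain ⟨x1, y1, h1, h2, h3⟩ := hcon
  obtain ⟨R, hR0, hR⟩ := HasCompactSupport.rad hZ.2
  set W : Pt N → ℝ := fun z => Z z - S z.2 with hW
  set K : Set (Pt N) := Metric.closedBall 0 R ∩ {z | δ ≤ z.2 ∧ z.2 ≤ y0} with hK
  have hKc : IsCompact K := by
    apply (isCompact_closedBall (0 : Pt N) R).inter_right
    exact (isClosed_le continuous_const continuous_snd).inter (isClosed_le continuous_snd continuous_const)
  have hWc : ContinuousOn W K := by
    intro z hz
    have hz2 : 0 < z.2 := hδ.trans_le hz.2.1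
    exact (hZ.cc.1.continuousAt.sub ((hS z.2 hz2).continuousAt.comp continuous_snd.continuousAt)).continuousWithinAt
  have hin : ∀ z : Pt N, δ ≤ z.2 → z.2 ≤ y0 → 0 < W z → z ∈ K := by
    intro z ha hb hw
    refine ⟨?_, ha, hb⟩
    by_contra hn
    have : R < ‖z‖ := by simpa using hn
    have h0 := hR z this
    have := hpos z.2 ha hb
    simp only [hW, h0] at hw; linarith
  have hz1 : (x1, y1) ∈ K := hin _ h1 h2 (by simp only [hW]; linarith)
  obtain ⟨zs, hzs, hmax⟩ := hKc.exists_isMaxOn ⟨_, hz1⟩ hWc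
  have hWpos : 0 < W zs := lt_of_lt_of_le (by simp only [hW]; linarith) (hmax hz1)
  have hM : ∀ z : Pt N, δ ≤ z.2 → z.2 ≤ y0 → W z ≤ W zs := by
    intro z ha hb
    by_cases hw : 0 < W z
    · exact hmax (hin z ha hb hw)
    · linarith
  have hzs2 : 0 < zs.2 := hδ.trans_le hzs.2.1
  have hlt : zs.2 < y0 := by
    refine lt_of_le_of_ne hzs.2.2 fun he => ?_
    have := htop zs.1
    have e : W zs = Z (zs.1, y0) - S y0 := by rw [← he]
    linarith
  -- one-dimensional derivatives
  have hline : ∀ e : Pt N, ∀ t, 0 < zs.2 + t * e.2 → HasDerivAt (fun t : ℝ => W (zs + t • e)) (pd e Z (zs + t • e) - S1 (zs.2 + t * e.2) * e.2) t := by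
    intro e t ht
    have d1 := hasDeriv_line hZ zs e t
    have d2 : HasDerivAt (fun t : ℝ => zs.2 + t * e.2) e.2 t := by
      simpa using ((hasDerivAt_id t).mul_const e.2).const_add zs.2
    exact d1.sub ((hS _ ht).comp t d2)
  have hgt : δ < zs.2 := by
    refine lt_of_le_of_ne hzs.2.1 fun he => ?_
    have hd := hline ey 0 (by simpa using hzs2)
    have hval : pd ey Z (zs + (0:ℝ) • ey) - S1 (zs.2 + 0 * (ey : Pt N).2) * (ey : Pt N).2 = - S1 δ := by
      have := hb zs.1
      rw [he] at this ⊢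
      simp [ey] at this ⊢
      exact this
    rw [hval] at hd
    have hev := (hasDerivAt_iff_tendsto_slope.1 hd).eventually (lt_mem_nhds (show 0 < - S1 δ by linarith))
    have hev2 : ∀ᶠ t in nhdsWithin (0:ℝ) (Set.Ioi 0), 0 < slope (fun t : ℝ => W (zs + t • ey)) 0 t :=
      hev.filter_mono (nhdsWithin_mono _ fun t (ht : 0 < t) => ht.ne')
    have hev3 : ∀ᶠ t in nhdsWithin (0:ℝ) (Set.Ioi 0), t ∈ Set.Ioo 0 (y0 - δ) := Ioo_mem_nhdsGT (by linarith)
    obtain ⟨t, ht1, ht2⟩ := (hev2.and hev3).exists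
    have hle := hM (zs + t • ey) (by simp [ey]; linarith [ht2.1]) (by simp [ey]; linarith [ht2.2])
    rw [slope_def_field] at ht1
    have : (W (zs + t • ey) - W (zs + (0:ℝ) • ey)) / (t - 0) ≤ 0 := by
      apply div_nonpos_of_nonpos_of_nonneg
      · simp only [zero_smul, add_zero]; linarith
      · linarith [ht2.1]
    linarith
  have hnhds : ∀ e : Pt N, ∀ᶠ t in nhds (0:ℝ), δ < zs.2 + t * e.2 ∧ zs.2 + t * e.2 < y0 := by
    intro e
    have hc : ContinuousAt (fun t : ℝ => zs.2 + t * e.2) 0 := by fun_prop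
    have : Set.Ioo δ y0 ∈ nhds (zs.2 + 0 * e.2) := by
      apply isOpen_Ioo.mem_nhds; simpa using ⟨hgt, hlt⟩
    exact hc this
  have key : ∀ e : Pt N, pd e Z zs - S1 zs.2 * e.2 = 0 ∧ pd e (pd e Z) zs - S2 zs.2 * e.2 * e.2 ≤ 0 := by
    intro e
    have := max_second (φ := fun t : ℝ => W (zs + t • e)) (φ' := fun t => pd e Z (zs + t • e) - S1 (zs.2 + t * e.2) * e.2) (c := pd e (pd e Z) zs - S2 zs.2 * e.2 * e.2) ?_ ?_ ?_
    · simpa using this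
    · filter_upwards [hnhds e] with t ht
      exact hline e t (hδ.trans ht.1)
    · have d1 := hasDeriv_line (hZ.pd e) zs e 0
      have d2 : HasDerivAt (fun t : ℝ => zs.2 + t * e.2) e.2 0 := by
        simpa using ((hasDerivAt_id (0:ℝ)).mul_const e.2).const_add zs.2
      have d3 := d1.sub (((hS1 _ (by simpa using hzs2)).comp 0 d2).mul_const e.2)
      have e0 : zs + (0:ℝ) • e = zs := by simp
      have e1 : zs.2 + 0 * e.2 = zs.2 := by ring
      rw [e0, e1] at d3
      exact d3
    · filter_upwards [hnhds e] with t ht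
      have := hM (zs + t • e) (by simpa using ht.1.le) (by simpa using ht.2.le)
      simpa using this
  have hLz := hL zs.1 zs.2 hgt hlt
  have k1 : ∀ k, pd (ex k) (pd (ex k) Z) zs ≤ 0 := by
    intro k; have := (key (ex k)).2; simpa [ex] using this
  have k2 : pd (Dv a) (pd (Dv a) Z) zs ≤ S2 zs.2 := by
    have := (key (Dv a)).2; simp only [Dv] at this ⊢; linarith
  have k3 : pd ey Z zs = S1 zs.2 := by
    have := (key ey).1; simp only [ey] at this ⊢; linarith
  unfold Lop Gop at hLz
  simp only [Prod.mk.eta] at hLz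
  have := Finset.sum_nonpos (s := Finset.univ) fun k _ => k1 k
  rw [k3] at hLz
  linarith

end

section
variable {N : ℕ}

lemma rpow_intOn {κ : ℝ} (hκ : -1 < κ) (t : ℝ) : (∫⁻ ρ in Set.Ioc (0:ℝ) t, ENNReal.ofReal (ρ ^ κ)) ≠ ⊤ := by
  rcases le_or_gt t 0 with h | h
  · simp [Set.Ioc_eq_empty_of_le h]
  have := (intervalIntegral.intervalIntegrable_rpow' (a := 0) (b := t) hκ)
  rw [intervalIntegrable_iff_integrableOn_Ioc_of_le h.le] at this
  exact this.lintegral_lt_top.ne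

lemma rpow_intOn' {κ y y0 : ℝ} (hy : 0 < y) : (∫⁻ ρ in Set.Ioc y y0, ENNReal.ofReal (ρ ^ κ)) ≠ ⊤ := by
  have hc : ContinuousOn (fun s : ℝ => s ^ κ) (Set.Icc y y0) := by
    apply ContinuousOn.rpow_const continuousOn_id
    intro x hx; left; exact (hy.trans_le hx.1).ne'
  exact (hc.integrableOn_Icc.mono_set Set.Ioc_subset_Icc_self).lintegral_lt_top.ne

lemma ofReal_le_enorm' (a : ℝ) : ENNReal.ofReal a ≤ ‖a‖ₑ := by
  rw [Real.enorm_eq_ofReal_abs]; exact ENNReal.ofReal_le_ofReal (le_abs_self a)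

lemma prim_deriv {g : ℝ → ℝ} (hg : ContinuousOn g (Set.Ioi 0)) {a : ℝ} (ha : 0 < a) {t : ℝ} (ht : 0 < t) :
    HasDerivAt (fun t => ∫ ρ in a..t, g ρ) (g t) t := by
  have hsub : Set.uIcc a t ⊆ Set.Ioi 0 := by
    intro x hx
    rcases Set.mem_uIcc.1 hx with h | h
    · exact ha.trans_le h.1
    · exact ht.trans_le h.1
  refine intervalIntegral.integral_hasDerivAt_right ?_ ?_ (hg.continuousAt (Ioi_mem_nhds ht))
  · exact (hg.mono hsub).intervalIntegrable
  · exact ContinuousOn.stronglyMeasurableAtFilter isOpen_Ioi hg t ht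

lemma MP1 {a : Fin N → ℝ} {κ : ℝ} {Z : Pt N → ℝ} (hZ : Bc Z) {G : ℝ → ℝ} (hG : ContinuousOn G (Set.Ioi 0)) (hG0 : ∀ y > 0, 0 ≤ G y)
    (hL : ∀ z : Pt N, 0 < z.2 → - G z.2 ≤ Lop a κ Z z) {A y0 : ℝ} (hA : 0 ≤ A) (hZ0 : ∀ x, Z (x, y0) ≤ A) {η : ℝ} (hη : 0 < η)
    (x : Fin N → ℝ) {y : ℝ} (hy : 0 < y) (hyy : y < y0) : 
    ∃ δ > 0, δ < y ∧ Z (x, y) ≤ A + ∫ t in y..y0, t ^ (-κ) * ∫ ρ in δ..t, ρ ^ κ * (G ρ + η) := by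
  obtain ⟨hZs, δ0, hδ0, hb⟩ := hZ
  set d := min δ0 y with hd
  have hd0 : 0 < d := lt_min hδ0 hy
  have hdy : d ≤ y := min_le_right _ _
  have hdy0 : d < y0 := by linarith
  refine ⟨d / 2, by positivity, by linarith, ?_⟩
  set g : ℝ → ℝ := fun ρ => ρ ^ κ * (G ρ + η) with hg
  have hrc : ∀ κ : ℝ, ContinuousOn (fun s : ℝ => s ^ κ) (Set.Ioi 0) := by
    intro κ
    apply ContinuousOn.rpow_const continuousOn_id
    intro x hx; left; exact (ne_of_gt hx)
  have hgc : ContinuousOn g (Set.Ioi 0) := (hrc κ).mul (hG.add continuousOn_const)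
  have hgpos : ∀ ρ > 0, 0 < g ρ := fun ρ hρ => mul_pos (Real.rpow_pos_of_pos hρ _) (by linarith [hG0 ρ hρ])
  set P : ℝ → ℝ := fun t => ∫ ρ in (d/2)..t, g ρ with hP
  have hPd : ∀ t > 0, HasDerivAt P (g t) t := fun t ht => prim_deriv hgc (by positivity) ht
  have hPpos : ∀ t, d ≤ t → 0 < P t := by
    intro t ht
    apply intervalIntegral.intervalIntegral_pos_of_pos_on
    · apply (hgc.mono _).intervalIntegrable
      rw [Set.uIcc_of_le (by linarith)]
      intro ρ hρ; simp only [Set.mem_Ioi]; linarith [hρ.1]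
    · intro ρ hρ; exact hgpos ρ (by linarith [hρ.1])
    · linarith
  set s1 : ℝ → ℝ := fun t => t ^ (-κ) * P t with hs1
  have hPc : ContinuousOn P (Set.Ioi 0) := fun t ht => (hPd t ht).continuousAt.continuousWithinAt
  have hs1c : ContinuousOn s1 (Set.Ioi 0) := (hrc (-κ)).mul hPc
  have hy00 : 0 < y0 := by linarith
  have key := MP0 (a := a) (κ := κ) hZs hd0 hdy0 (fun x => hb _ hd0.le (min_le_left _ _)) (S := fun y => A - ∫ t in y0..y, s1 t) (S1 := fun y => - s1 y)
    (S2 := fun t => -((-κ * t ^ (-κ - 1)) * P t + t ^ (-κ) * g t)) ?_ ?_ ?_ ?_ ?_ ?_ x y hdy hyy.le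
  · rw [intervalIntegral.integral_symm, sub_neg_eq_add] at key
    exact key
  · intro t ht
    exact (prim_deriv hs1c hy00 ht).const_sub A
  · intro t ht
    exact ((Real.hasDerivAt_rpow_const (Or.inl ht.ne')).mul (hPd t ht)).neg
  · intro t h1 h2
    rw [intervalIntegral.integral_symm, sub_neg_eq_add]
    apply add_nonneg hA
    apply intervalIntegral.integral_nonneg h2
    intro s hs
    exact mul_nonneg (Real.rpow_nonneg (by linarith [hs.1]) _) (hPpos s (by linarith [hs.1])).le
  · intro x; simpa using hZ0 x
  · have := mul_pos (Real.rpow_pos_of_pos hd0 (-κ)) (hPpos d le_rfl)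
    simp only [hs1]; linarith
  · intro x t h1 h2
    have ht : 0 < t := by linarith
    have h3 := hL (x, t) ht
    refine lt_of_lt_of_le ?_ h3
    have e1 : t ^ (-κ - 1) = t ^ (-κ) / t := by rw [Real.rpow_sub ht, Real.rpow_one]
    have e2 : t ^ (-κ) * g t = G t + η := by
      simp only [hg]; rw [← mul_assoc, ← Real.rpow_add ht]; simp
    rw [e2, e1]
    simp only [hs1]
    have : -(-κ * (t ^ (-κ) / t) * P t + (G t + η)) + κ / t * -(t ^ (-κ) * P t) = - (G t + η) := by field_simp; ring
    rw [this]
    linarith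

lemma MP2 {a : Fin N → ℝ} {κ : ℝ} (hκ : -1 < κ) {Z : Pt N → ℝ} (hZ : Bc Z) {G : ℝ → ℝ} (hG : ContinuousOn G (Set.Ioi 0)) (hG0 : ∀ y > 0, 0 ≤ G y)
    (hL : ∀ z : Pt N, 0 < z.2 → - G z.2 ≤ Lop a κ Z z) {A y0 : ℝ} (hA : 0 ≤ A) (hZ0 : ∀ x, Z (x, y0) ≤ A) 
    (x : Fin N → ℝ) {y : ℝ} (hy : 0 < y) (hyy : y < y0) : 
    ENNReal.ofReal (Z (x, y)) ≤ ENNReal.ofReal A + ∫⁻ t in Set.Ioc y y0, ENNReal.ofReal (t ^ (-κ)) * ∫⁻ ρ in Set.Ioc 0 t, ENNReal.ofReal (ρ ^ κ) * ENNReal.ofReal (G ρ) := by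
  set M := ∫⁻ ρ in Set.Ioc (0:ℝ) y0, ENNReal.ofReal (ρ ^ κ) with hM
  have hMt : M ≠ ⊤ := rpow_intOn hκ y0
  set E := (∫⁻ t in Set.Ioc y y0, ENNReal.ofReal (t ^ (-κ))) * M with hE
  have hEt : E ≠ ⊤ := ENNReal.mul_ne_top (rpow_intOn' hy) hMt
  set X := ∫⁻ t in Set.Ioc y y0, ENNReal.ofReal (t ^ (-κ)) * ∫⁻ ρ in Set.Ioc 0 t, ENNReal.ofReal (ρ ^ κ) * ENNReal.ofReal (G ρ) with hX
  have main : ∀ η > 0, ENNReal.ofReal (Z (x, y)) ≤ ENNReal.ofReal A + X + ENNReal.ofReal η * E := by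
    intro η hη
    obtain ⟨δ, hδ, hδy, h⟩ := MP1 hZ hG hG0 hL hA hZ0 hη x hy hyy
    refine (ENNReal.ofReal_le_ofReal h).trans (ENNReal.ofReal_add_le.trans ?_)
    rw [add_assoc]
    gcongr
    refine (ofReal_le_enorm' _).trans ?_
    rw [intervalIntegral.integral_of_le hyy.le]
    refine (enorm_integral_le_lintegral_enorm _).trans ?_
    calc _ ≤ ∫⁻ t in Set.Ioc y y0, (ENNReal.ofReal (t ^ (-κ)) * (∫⁻ ρ in Set.Ioc 0 t, ENNReal.ofReal (ρ ^ κ) * ENNReal.ofReal (G ρ)) + ENNReal.ofReal (t ^ (-κ)) * (M * ENNReal.ofReal η)) := by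
          refine setLIntegral_mono' measurableSet_Ioc fun t ht => ?_
          have ht0 : 0 < t := by linarith [ht.1]
          rw [← mul_add, enorm_mul, Real.enorm_eq_ofReal (by positivity)]
          gcongr
          rw [intervalIntegral.integral_of_le (by linarith [ht.1])]
          refine (enorm_integral_le_lintegral_enorm _).trans ?_
          have e : (∫⁻ ρ in Set.Ioc 0 t, (ENNReal.ofReal (ρ ^ κ) * ENNReal.ofReal (G ρ) + ENNReal.ofReal (ρ ^ κ) * ENNReal.ofReal η)) ≤ (∫⁻ ρ in Set.Ioc 0 t, ENNReal.ofReal (ρ ^ κ) * ENNReal.ofReal (G ρ)) + M * ENNReal.ofReal η := by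
            rw [lintegral_add_right _ (by fun_prop), lintegral_mul_const _ (by fun_prop)]
            gcongr
            exact lintegral_mono_set (Set.Ioc_subset_Ioc_right ht.2)
          refine le_trans ?_ e
          refine (lintegral_mono_set (Set.Ioc_subset_Ioc_left hδ.le)).trans ?_
          refine setLIntegral_mono' measurableSet_Ioc fun ρ hρ => ?_
          have hρ0 : 0 < ρ := hρ.1
          have := hG0 ρ hρ0
          rw [enorm_mul, Real.enorm_eq_ofReal (by positivity), Real.enorm_eq_ofReal (by positivity), ENNReal.ofReal_add this hη.le, mul_add]
      _ = X + (∫⁻ t in Set.Ioc y y0, ENNReal.ofReal (t ^ (-κ)) * (M * ENNReal.ofReal η)) := by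
          rw [lintegral_add_right _ (by fun_prop)]
      _ = _ := by
          rw [lintegral_mul_const _ (by fun_prop), hE]; ring
  refine ENNReal.le_of_forall_pos_le_add fun ε hε _ => ?_
  have hη : 0 < (ε : ℝ) / (E.toReal + 1) := by positivity
  refine (main _ hη).trans ?_
  gcongr
  nth_rewrite 2 [← ENNReal.ofReal_toReal hEt]
  rw [← ENNReal.ofReal_mul hη.le, ← ENNReal.ofReal_coe_nnreal]
  apply ENNReal.ofReal_le_ofReal
  rw [div_mul_eq_mul_div, div_le_iff₀ (by positivity)]
  nlinarith [ENNReal.toReal_nonneg (a := E), hε.le, (show (0:ℝ) < ε from hε)]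

end

section
variable {N : ℕ}

/-! ### Slice estimate from the maximum principle -/

def spow (p s : ℝ) : ℝ := (max s 0) ^ (p-1) - (max (-s) 0) ^ (p-1)

lemma spow_cont {p : ℝ} (hp : 1 < p) : Continuous (spow p) := by
  unfold spow
  have h : 0 ≤ p - 1 := by linarith
  apply Continuous.sub <;> apply Continuous.rpow_const (by fun_prop) (fun _ => Or.inr h)

lemma spow_zero {p : ℝ} : spow p 0 = 0 := by simp [spow]

lemma spow_abs {p : ℝ} (hp : 1 < p) (s : ℝ) : |spow p s| = |s| ^ (p-1) := by
  unfold spow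
  have h : p - 1 ≠ 0 := by linarith
  rcases le_total 0 s with hs | hs
  · rw [max_eq_left hs, max_eq_right (by linarith), Real.zero_rpow h, sub_zero, abs_of_nonneg hs, abs_of_nonneg (by positivity)]
  · have hs' : 0 ≤ -s := by linarith
    rw [max_eq_right hs, max_eq_left hs', Real.zero_rpow h, zero_sub, abs_of_nonpos hs, abs_neg, abs_of_nonneg (by positivity)]

lemma spow_mul {p : ℝ} (hp : 1 < p) (s : ℝ) : spow p s * s = |s| ^ p := by
  unfold spow
  have h : p - 1 ≠ 0 := by linarith
  have key : ∀ t : ℝ, 0 ≤ t → t ^ (p-1) * t = t ^ p := by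
    intro t ht
    rcases ht.eq_or_lt with rfl | ht
    · rw [Real.zero_rpow (show p - 1 ≠ 0 by linarith), Real.zero_rpow (show p ≠ 0 by linarith)]; simp
    · nth_rewrite 2 [← Real.rpow_one t]
      rw [← Real.rpow_add ht]; simp
  rcases le_total 0 s with hs | hs
  · rw [max_eq_left hs, max_eq_right (by linarith), Real.zero_rpow h, sub_zero, abs_of_nonneg hs, key s hs]
  · have hs' : 0 ≤ -s := by linarith
    rw [max_eq_right hs, max_eq_left hs', Real.zero_rpow h, zero_sub, abs_of_nonpos hs, ← key _ hs']; ring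

/-- vanishing for large x -/
def XR (R : ℝ) (g : Pt N → ℝ) : Prop := ∀ x y, R < ‖x‖ → g (x, y) = 0

lemma XR_of {g : Pt N → ℝ} {R : ℝ} (h : ∀ z, R < ‖z‖ → g z = 0) : XR R g := fun x y hx =>
  h _ (hx.trans_le (norm_fst_le (x, y)))

lemma XR_cs {g : Pt N → ℝ} {R : ℝ} (h : XR R g) (y : ℝ) : HasCompactSupport fun x => g (x, y) :=
  HasCompactSupport.intro (isCompact_closedBall (0 : Fin N → ℝ) R) fun x hx => h x y (by simpa using hx)

lemma sl_real {p : ℝ} (hp : 0 < p) {g : Pt N → ℝ} {R : ℝ} (h : XR R g) {y : ℝ} (hc : Continuous fun x => g (x, y)) :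
    sl p g y = ENNReal.ofReal (∫ x, |g (x, y)| ^ p) := by
  have hc2 : Continuous fun x => |g (x, y)| ^ p := hc.abs.rpow_const fun _ => Or.inr hp.le
  have hi : Integrable fun x => |g (x, y)| ^ p := by
    apply hc2.integrable_of_hasCompactSupport
    exact (XR_cs h y).comp_left (g := fun s => |s| ^ p) (by simp [hp.ne'])
  rw [ofReal_integral_eq_lintegral_ofReal hi (Filter.Eventually.of_forall fun _ => by positivity)]
  unfold sl
  congr 1; funext x
  rw [Real.enorm_eq_ofReal_abs, ENNReal.ofReal_rpow_of_nonneg (abs_nonneg _) hp.le]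

lemma sl_cont {p : ℝ} (hp : 0 < p) {g : Pt N → ℝ} {R : ℝ} (h : XR R g) (hc : ContinuousOn g {z | 0 < z.2}) :
    ContinuousOn (fun y => ∫ x, |g (x, y)| ^ p) (Set.Ioi 0) := by
  refine continuousOn_integral_of_compact_support (k := Metric.closedBall (0 : Fin N → ℝ) R) (f := fun y x => |g (x, y)| ^ p) (isCompact_closedBall 0 R) ?_ ?_
  · have : ContinuousOn (fun w : ℝ × (Fin N → ℝ) => g (w.2, w.1)) (Set.Ioi 0 ×ˢ Set.univ) := 
      hc.comp (by fun_prop) (fun w hw => hw.1)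
    exact this.abs.rpow_const fun _ _ => Or.inr hp.le
  · intro y x _ hx
    rw [h x y (by simpa using hx)]
    simp [hp.ne']

lemma slice_holder {p q : ℝ} (hpq : p.HolderConjugate q) {h : (Fin N → ℝ) → ℝ} (hh : Measurable h) {g : Pt N → ℝ} {y : ℝ} (hg : Measurable fun x => g (x, y)) (x : Fin N → ℝ) :
    ‖∫ x', h x' * g ((x, y) + (x', 0))‖ₑ ≤ (∫⁻ x', ‖h x'‖ₑ ^ q) ^ (1/q) * (sl p g y) ^ (1/p) := by
  refine (enorm_integral_le_lintegral_enorm _).trans ?_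
  simp_rw [enorm_mul]
  have e : ∀ x', ((x, y) : Pt N) + (x', 0) = (x + x', y) := by intro x'; simp
  simp_rw [e]
  have hm : Measurable fun x' => g (x + x', y) := hg.comp (measurable_const_add x)
  have := ENNReal.lintegral_mul_le_Lp_mul_Lq volume hpq.symm (f := fun x' => ‖h x'‖ₑ) (g := fun x' => ‖g (x + x', y)‖ₑ) (by fun_prop) hm.enorm.aemeasurable
  refine this.trans (le_of_eq ?_)
  congr 2
  unfold sl
  exact lintegral_add_left_eq_self (fun x' => ‖g (x', y)‖ₑ ^ p) x

lemma Lop_contOn {a : Fin N → ℝ} {κ : ℝ} {u : Pt N → ℝ} (hu : Sm u) : ContinuousOn (Lop a κ u) {z | 0 < z.2} := by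
  unfold Lop Gop
  have h1 : ∀ v w, Continuous (pd v (pd w u)) := fun v w => ((hu.pd w).pd v).cc.1
  have h2 : Continuous (pd ey u) := (hu.pd _).cc.1
  apply ContinuousOn.add
  · exact ((continuous_finsetSum _ fun k _ => h1 _ _).add (h1 _ _)).continuousOn
  · refine ContinuousOn.mul (ContinuousOn.div continuousOn_const continuousOn_snd fun z hz => ne_of_gt hz) h2.continuousOn

lemma pd_zero_of {u : Pt N → ℝ} (hu : Sm u) {R : ℝ} (hR : ∀ z, R < ‖z‖ → u z = 0) (v z : Pt N) (hz : R < ‖z‖) : pd v u z = 0 := by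
  have : u =ᶠ[nhds z] fun _ => 0 := by
    filter_upwards [(isOpen_lt continuous_const continuous_norm).mem_nhds hz] with w hw using hR w hw
  unfold pd
  rw [this.fderiv_eq]; simp

lemma Lop_XR {a : Fin N → ℝ} {κ : ℝ} {u : Pt N → ℝ} (hu : Sm u) : ∃ R, XR R (Lop a κ u) := by
  obtain ⟨R, hR0, hR⟩ := HasCompactSupport.rad hu.2
  refine ⟨R, XR_of fun z hz => ?_⟩
  have h1 : ∀ v w, pd v (pd w u) z = 0 := fun v w => pd_zero_of (hu.pd w) (fun z hz => pd_zero_of hu hR w z hz) v z hz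
  unfold Lop Gop
  simp [h1, pd_zero_of hu hR ey z hz]

lemma MPsl {p : ℝ} (hp : 1 < p) {a : Fin N → ℝ} {κ : ℝ} (hκ : -1 < κ) {u : Pt N → ℝ} (hu : Bc u) {y y0 : ℝ} (hy : 0 < y) (hyy : y < y0) : 
    (sl p u y) ^ (1/p) ≤ (sl p u y0) ^ (1/p) + ∫⁻ t in Set.Ioc y y0, ENNReal.ofReal (t ^ (-κ)) * ∫⁻ ρ in Set.Ioc 0 t, ENNReal.ofReal (ρ ^ κ) * (sl p (Lop a κ u) ρ) ^ (1/p) := by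
  have hpq := Real.HolderConjugate.conjExponent hp
  set q := p.conjExponent with hq
  have p0 : 0 < p := by linarith
  have hus := hu.1
  have huc := hus.cc.1
  obtain ⟨R, hR0, hR⟩ := HasCompactSupport.rad hus.2
  obtain ⟨RL, hRL⟩ := Lop_XR (a := a) (κ := κ) hus
  have hXu := XR_of hR
  set n := sl p u y with hn
  have hnr := sl_real p0 hXu (y := y) (by fun_prop)
  set h : (Fin N → ℝ) → ℝ := fun x' => spow p (u (x', y)) with hh
  have hhc : Continuous h := (spow_cont hp).comp (by fun_prop)
  have hh0 : ∀ x', R < ‖x'‖ → h x' = 0 := fun x' hx => by simp only [hh]; rw [hXu x' y hx, spow_zero]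
  have hhs : HasCompactSupport h := HasCompactSupport.intro (isCompact_closedBall (0 : Fin N → ℝ) R) fun x hx => hh0 x (by simpa using hx)
  have hhi : Integrable h := hhc.integrable_of_hasCompactSupport hhs
  have hhm := hhc.measurable
  have hσ : Measurable (fun x' : Fin N → ℝ => ((x', 0) : Pt N)) := by fun_prop
  set Z : Pt N → ℝ := fun z => ∫ x', h x' * u (z + (x', 0)) with hZ
  have hZpd : ∀ {w : Pt N → ℝ} (v : Pt N), Sm w → pd v (fun z => ∫ x', h x' * w (z + (x', 0))) = fun z => ∫ x', h x' * pd v w (z + (x', 0)) := fun v hw => avg_pd hhi hσ hw v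
  have hintg : ∀ {w : Pt N → ℝ} (z : Pt N), Sm w → Integrable fun x' => h x' * w (z + (x', 0)) := fun z hw => avg_int hhi hσ hw.cc.1 hw.2 z
  have hZs : Sm Z := by
    refine ⟨avg_contDiff hhi hσ hus, ?_⟩
    refine HasCompactSupport.intro (isCompact_closedBall (0 : Pt N) (R + R)) fun z hz => ?_
    have hz : R + R < ‖z‖ := by simpa using hz
    simp only [hZ]
    refine integral_eq_zero_of_ae (Filter.Eventually.of_forall fun x' => ?_)
    show h x' * u (z + (x', 0)) = 0
    by_cases hx : R < ‖x'‖
    · simp [hh0 x' hx]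
    · push Not at hx
      have e : ‖((x', 0) : Pt N)‖ = ‖x'‖ := by simp [Prod.norm_def]
      have : ‖z‖ ≤ ‖z + (x', 0)‖ + ‖((x', 0) : Pt N)‖ := by
        have h9 := norm_sub_le (z + ((x', 0) : Pt N)) ((x', 0) : Pt N)
        rwa [add_sub_cancel_right] at h9
      rw [hR _ (by linarith)]; simp
  have hZb : Bc Z := by
    obtain ⟨δ, hδ, hb⟩ := hu.2
    refine ⟨hZs, δ, hδ, fun z h1 h2 => ?_⟩
    rw [hZpd ey hus]
    have : ∀ x' : Fin N → ℝ, pd ey u (z + (x', 0)) = 0 := fun x' => hb _ (by simpa using h1) (by simpa using h2)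
    simp [this]
  have hZL : ∀ z, Lop a κ Z z = ∫ x', h x' * Lop a κ u (z + (x', 0)) := by
    intro z
    unfold Lop Gop
    have e2 : ∀ v w, pd v (pd w Z) z = ∫ x', h x' * pd v (pd w u) (z + (x', 0)) := by
      intro v w
      rw [hZpd w hus, hZpd v (hus.pd w)]
    have e1 : pd ey Z z = ∫ x', h x' * pd ey u (z + (x', 0)) := by rw [hZpd ey hus]
    simp_rw [e2, e1]
    rw [← integral_const_mul, ← integral_finsetSum _ (fun k _ => hintg z ((hus.pd _).pd _)), ← integral_add (integrable_finsetSum _ fun k _ => hintg z ((hus.pd _).pd _)) (hintg z ((hus.pd _).pd _))]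
    refine (integral_add ((integrable_finsetSum _ fun k _ => hintg z ((hus.pd _).pd _)).add (hintg z ((hus.pd _).pd _))) ((hintg z (hus.pd _)).const_mul _)).symm.trans ?_
    congr 1; funext x'
    simp only [Pi.add_apply]
    rw [← Finset.mul_sum]
    simp only [Prod.snd_add, add_zero]
    ring
  set H := (∫⁻ x', ‖h x'‖ₑ ^ q) ^ (1/q) with hH
  have hHn : H = n ^ (1/q) := by
    rw [hH]; congr 1
    rw [hn]; unfold sl
    congr 1; funext x'
    simp only [hh]
    rw [Real.enorm_eq_ofReal_abs, spow_abs hp, Real.enorm_eq_ofReal_abs, ENNReal.ofReal_rpow_of_nonneg (by positivity) hpq.symm.nonneg, ← Real.rpow_mul (abs_nonneg _), ENNReal.ofReal_rpow_of_nonneg (abs_nonneg _) p0.le, hpq.sub_one_mul_conj]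
  have hnt : n ≠ ⊤ := by rw [hn, hnr]; simp
  have hHt : H ≠ ⊤ := by rw [hHn]; exact ENNReal.rpow_ne_top_of_nonneg (by have := hpq.symm.pos; positivity) hnt
  have hLc : ∀ ρ > 0, Continuous fun x => Lop a κ u (x, ρ) := by
    intro ρ hρ
    rw [← continuousOn_univ]
    exact (Lop_contOn hus).comp (by fun_prop) (fun x _ => hρ)
  have hLr : ∀ ρ > 0, sl p (Lop a κ u) ρ = ENNReal.ofReal (∫ x, |Lop a κ u (x, ρ)| ^ p) := fun ρ hρ => sl_real p0 hRL (hLc ρ hρ)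
  set G : ℝ → ℝ := fun ρ => H.toReal * (∫ x, |Lop a κ u (x, ρ)| ^ p) ^ (1/p) with hG
  have hGof : ∀ ρ > 0, ENNReal.ofReal (G ρ) = H * (sl p (Lop a κ u) ρ) ^ (1/p) := by
    intro ρ hρ
    simp only [hG]
    rw [ENNReal.ofReal_mul ENNReal.toReal_nonneg, ENNReal.ofReal_toReal hHt, hLr ρ hρ, ENNReal.ofReal_rpow_of_nonneg (integral_nonneg fun x => by positivity) (by positivity)]
  have hsu0 : sl p u y0 ≠ ⊤ := by rw [sl_real p0 hXu (y := y0) (by fun_prop)]; simp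
  have key := MP2 (a := a) hκ hZb (G := G) (A := (H * (sl p u y0) ^ (1/p)).toReal) (y0 := y0) ?_ ?_ ?_ ENNReal.toReal_nonneg ?_ 0 hy hyy
  · have hZ0 : ENNReal.ofReal (Z (0, y)) = n := by
      rw [hn, hnr]
      congr 1
      simp only [hZ]
      congr 1; funext x'
      simp only [Prod.mk_add_mk, zero_add, add_zero, hh]
      exact spow_mul hp _
    rw [hZ0, ENNReal.ofReal_toReal (ENNReal.mul_ne_top hHt (ENNReal.rpow_ne_top_of_nonneg (by positivity) hsu0))] at key
    set B := (sl p u y0) ^ (1/p) + ∫⁻ t in Set.Ioc y y0, ENNReal.ofReal (t ^ (-κ)) * ∫⁻ ρ in Set.Ioc 0 t, ENNReal.ofReal (ρ ^ κ) * (sl p (Lop a κ u) ρ) ^ (1/p) with hB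
    have hle : n ≤ H * B := by
      refine key.trans (le_of_eq ?_)
      rw [hB, mul_add]
      congr 1
      rw [← lintegral_const_mul' _ _ hHt]
      refine setLIntegral_congr_fun measurableSet_Ioc fun t ht => ?_
      rw [mul_left_comm]
      congr 1
      rw [← lintegral_const_mul' _ _ hHt]
      refine setLIntegral_congr_fun measurableSet_Ioc fun ρ hρ => ?_
      rw [hGof ρ hρ.1]; ring
    rw [hHn] at hle
    by_cases h0 : n = 0
    · rw [h0, ENNReal.zero_rpow_of_pos (by positivity)]; exact zero_le
    have hnq0 : n ^ (1/q) ≠ 0 := by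
      rw [Ne, ENNReal.rpow_eq_zero_iff]
      simp [h0, hnt]
    have hnqt : n ^ (1/q) ≠ ⊤ := by rw [← hHn]; exact hHt
    have hsplit : n = n ^ (1/q) * n ^ (1/p) := by
      rw [← ENNReal.rpow_add _ _ h0 hnt]
      have : 1/q + 1/p = 1 := by
        have := hpq.inv_add_inv_eq_one
        simp only [one_div]; linarith
      rw [this, ENNReal.rpow_one]
    have hle2 : n ^ (1/q) * n ^ (1/p) ≤ n ^ (1/q) * B := hsplit.symm.le.trans hle
    exact (ENNReal.mul_le_mul_iff_right hnq0 hnqt).1 hle2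
  · exact continuousOn_const.mul ((sl_cont p0 hRL (Lop_contOn hus)).rpow_const fun _ _ => Or.inr (by positivity))
  · intro ρ hρ
    have := ENNReal.toReal_nonneg (a := H)
    have h2 : 0 ≤ ∫ x, |Lop a κ u (x, ρ)| ^ p := integral_nonneg fun x => by positivity
    positivity
  · intro z hz
    rw [hZL z]
    have := slice_holder hpq hhm (g := Lop a κ u) (y := z.2) (hLc z.2 hz).measurable z.1
    rw [← hH, ← hGof z.2 hz] at this
    have h2 : ‖∫ x', h x' * Lop a κ u (z + (x', 0))‖ₑ ≤ ENNReal.ofReal (G z.2) := this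
    have hG0 : 0 ≤ G z.2 := by
      have := ENNReal.toReal_nonneg (a := H)
      have h2 : 0 ≤ ∫ x, |Lop a κ u (x, z.2)| ^ p := integral_nonneg fun x => by positivity
      simp only [hG]; positivity
    rw [Real.enorm_eq_ofReal_abs, ENNReal.ofReal_le_ofReal_iff hG0] at h2
    exact neg_le_of_abs_le h2
  · intro x
    have := slice_holder hpq hhm (g := u) (y := y0) (Continuous.measurable (by fun_prop)) x
    rw [← hH] at this
    have h3 := (ofReal_le_enorm' _).trans this
    exact (ENNReal.ofReal_le_iff_le_toReal (ENNReal.mul_ne_top hHt (ENNReal.rpow_ne_top_of_nonneg (by positivity) hsu0))).1 h3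

end

section
variable {N : ℕ}

/-! ### Hardy inequality -/

def Hd (κ : ℝ) (F : ℝ → ENNReal) (t : ℝ) : ENNReal := ∫⁻ s in Set.Ioc (0:ℝ) 1, ENNReal.ofReal (s ^ κ) * F (t * s)

lemma Hd_scale (κ : ℝ) (F : ℝ → ENNReal) (R t : ℝ) : Hd κ (fun y => F (R * y)) t = Hd κ F (R * t) := by
  unfold Hd; simp_rw [mul_assoc]

lemma Hd_const_mul (κ : ℝ) (F : ℝ → ENNReal) {c : ENNReal} (hc : c ≠ ⊤) (t : ℝ) : Hd κ (fun y => c * F y) t = c * Hd κ F t := by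
  unfold Hd
  rw [← lintegral_const_mul' _ _ hc]
  congr 1; funext s; ring

lemma Hd_meas (κ : ℝ) {F : ℝ → ENNReal} (hF : Measurable F) : Measurable (Hd κ F) := by
  unfold Hd
  exact Measurable.lintegral_prod_right' (f := fun w : ℝ × ℝ => ENNReal.ofReal (w.2 ^ κ) * F (w.1 * w.2)) (by fun_prop)

lemma Hd_mono (κ : ℝ) {F G : ℝ → ENNReal} {t : ℝ} (ht : 0 < t) (h : ∀ y > 0, F y ≤ G y) : Hd κ F t ≤ Hd κ G t := by
  unfold Hd
  refine setLIntegral_mono' measurableSet_Ioc fun s hs => ?_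
  gcongr
  exact h _ (mul_pos ht hs.1)

lemma Hd_conv (κ : ℝ) (F : ℝ → ENNReal) {t : ℝ} (ht : 0 < t) :
    (∫⁻ ρ in Set.Ioc 0 t, ENNReal.ofReal (ρ ^ κ) * F ρ) = ENNReal.ofReal (t ^ (κ + 1)) * Hd κ F t := by
  unfold Hd
  rw [← lintegral_const_mul' _ _ (by simp), ← lintegral_indicator measurableSet_Ioc, ← lintegral_indicator measurableSet_Ioc]
  have := lint_comp_smul (E := ℝ) ht.ne' ((Set.Ioc (0:ℝ) t).indicator fun ρ => ENNReal.ofReal (ρ ^ κ) * F ρ)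
  simp only [Module.finrank_self, pow_one, abs_of_pos (inv_pos.2 ht), smul_eq_mul] at this
  have h2 := congrArg (fun x => ENNReal.ofReal t * x) this
  simp only [← mul_assoc] at h2
  rw [← ENNReal.ofReal_mul ht.le, mul_inv_cancel₀ ht.ne', ENNReal.ofReal_one, one_mul] at h2
  rw [← h2, ← lintegral_const_mul' _ _ (by simp)]
  congr 1; funext s
  by_cases hs : s ∈ Set.Ioc (0:ℝ) 1
  · have : t * s ∈ Set.Ioc 0 t := ⟨mul_pos ht hs.1, by nlinarith [hs.2]⟩
    rw [Set.indicator_of_mem hs, Set.indicator_of_mem this, ← mul_assoc, ← mul_assoc, ← ENNReal.ofReal_mul ht.le, ← ENNReal.ofReal_mul (by positivity), Real.mul_rpow ht.le hs.1.le, Real.rpow_add ht, Real.rpow_one]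
    congr 2; ring
  · have : t * s ∉ Set.Ioc 0 t := by
      rintro ⟨h1, h2⟩
      exact hs ⟨(pos_iff_pos_of_mul_pos h1).1 ht, by nlinarith⟩
    rw [Set.indicator_of_notMem hs, Set.indicator_of_notMem this, mul_zero]

lemma J_scale (m : ℝ) (A : ℝ → ENNReal) {s : ℝ} (hs : 0 < s) : J m (fun y => A (y * s)) = ENNReal.ofReal (s ^ (-m-1)) * J m A := by
  unfold J
  rw [← lintegral_indicator measurableSet_Ioi, ← lintegral_indicator measurableSet_Ioi]
  have := lint_comp_smul (E := ℝ) hs.ne' ((Set.Ioi (0:ℝ)).indicator fun y => ENNReal.ofReal (y ^ m) * A y)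
  simp only [Module.finrank_self, pow_one, abs_of_pos (inv_pos.2 hs), smul_eq_mul] at this
  have e : s ^ (-m-1) = s ^ (-m) * s⁻¹ := by rw [sub_eq_add_neg, Real.rpow_add hs, Real.rpow_neg_one]
  rw [e, ENNReal.ofReal_mul (by positivity), mul_assoc, ← this, ← lintegral_const_mul' _ _ (by simp)]
  congr 1; funext y
  by_cases hy : y ∈ Set.Ioi (0:ℝ)
  · have h1 : s * y ∈ Set.Ioi (0:ℝ) := mul_pos hs hy
    have hy' : 0 < y := hy
    rw [Set.indicator_of_mem hy, Set.indicator_of_mem h1, ← mul_assoc, ← ENNReal.ofReal_mul (by positivity), Real.mul_rpow hs.le hy'.le, ← mul_assoc, ← Real.rpow_add hs, mul_comm s y]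
    simp
  · have h1 : s * y ∉ Set.Ioi (0:ℝ) := fun h => hy ((pos_iff_pos_of_mul_pos h).1 hs)
    rw [Set.indicator_of_notMem hy, Set.indicator_of_notMem h1, mul_zero]

lemma int01_ne {c : ℝ} (hc : -1 < c) : (∫⁻ s in Set.Ioc (0:ℝ) 1, ENNReal.ofReal (s ^ c)) ≠ ⊤ := by
  have h1 : IntegrableOn (fun s : ℝ => s ^ c) (Set.Ioc 0 1) := 
    (intervalIntegrable_iff_integrableOn_Ioc_of_le zero_le_one).1 (intervalIntegral.intervalIntegrable_rpow' hc)
  rw [← ofReal_integral_eq_lintegral_ofReal h1]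
  · simp
  · filter_upwards [ae_restrict_mem measurableSet_Ioc] with s hs
    exact Real.rpow_nonneg hs.1.le _

lemma Hardy {p m κ : ℝ} (hp : 1 < p) (h : (m+1)/p < κ + 1) : ∃ C : ENNReal, C ≠ ⊤ ∧ ∀ F : ℝ → ENNReal, Measurable F →
    J m (fun y => (Hd κ F y) ^ p) ≤ C * J m (fun y => F y ^ p) := by
  have hpq := Real.HolderConjugate.conjExponent hp
  set q := p.conjExponent with hq
  have p0 : 0 < p := by linarith
  have q0 : 0 < q := hpq.symm.pos
  have hinv := hpq.inv_add_inv_eq_one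
  obtain ⟨b, hb1, hb2⟩ : ∃ b, -1/q < b ∧ b < κ - m/p := by
    apply exists_between
    rw [add_div] at h
    have : -1/q = -1 + p⁻¹ := by rw [neg_div, one_div]; linarith
    rw [this]; rw [one_div] at h; linarith
  have hbq : -1 < b * q := by rwa [div_lt_iff₀ q0] at hb1
  have hbp : -1 < (κ - b) * p - m - 1 := by
    have : m / p < κ - b := by linarith
    rw [div_lt_iff₀ p0] at this; linarith
  refine ⟨(∫⁻ s in Set.Ioc (0:ℝ) 1, ENNReal.ofReal (s ^ (b*q))) ^ (p/q) * ∫⁻ s in Set.Ioc (0:ℝ) 1, ENNReal.ofReal (s ^ ((κ-b)*p-m-1)), ENNReal.mul_ne_top (ENNReal.rpow_ne_top_of_nonneg (by positivity) (int01_ne hbq)) (int01_ne hbp), fun F hF => ?_⟩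
  set c1 := (∫⁻ s in Set.Ioc (0:ℝ) 1, ENNReal.ofReal (s ^ (b*q))) ^ (p/q) with hc1
  have hc1t : c1 ≠ ⊤ := ENNReal.rpow_ne_top_of_nonneg (by positivity) (int01_ne hbq)
  have step : ∀ y, Hd κ F y ^ p ≤ c1 * ∫⁻ s in Set.Ioc (0:ℝ) 1, ENNReal.ofReal (s ^ ((κ-b)*p)) * F (y * s) ^ p := by
    intro y
    have e : Hd κ F y = ∫⁻ s in Set.Ioc (0:ℝ) 1, ENNReal.ofReal (s ^ b) * (ENNReal.ofReal (s ^ (κ-b)) * F (y*s)) := by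
      unfold Hd
      refine setLIntegral_congr_fun measurableSet_Ioc fun s hs => ?_
      rw [← mul_assoc, ← ENNReal.ofReal_mul (Real.rpow_nonneg hs.1.le _), ← Real.rpow_add hs.1]
      congr 3; ring
    have hh := ENNReal.lintegral_mul_le_Lp_mul_Lq (volume.restrict (Set.Ioc (0:ℝ) 1)) hpq.symm (f := fun s => ENNReal.ofReal (s ^ b)) (g := fun s => ENNReal.ofReal (s ^ (κ-b)) * F (y*s)) (by fun_prop) (by fun_prop)
    simp only [Pi.mul_apply] at hh
    rw [e]
    refine (ENNReal.rpow_le_rpow hh p0.le).trans (le_of_eq ?_)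
    rw [ENNReal.mul_rpow_of_nonneg _ _ p0.le, ← ENNReal.rpow_mul, ← ENNReal.rpow_mul, one_div_mul_cancel p0.ne', ENNReal.rpow_one, hc1]
    congr 1
    · rw [one_div_mul_eq_div]
      congr 1
      refine setLIntegral_congr_fun measurableSet_Ioc fun s hs => ?_
      rw [ENNReal.ofReal_rpow_of_nonneg (Real.rpow_nonneg hs.1.le _) q0.le, ← Real.rpow_mul hs.1.le]
    · refine setLIntegral_congr_fun measurableSet_Ioc fun s hs => ?_
      rw [ENNReal.mul_rpow_of_nonneg _ _ p0.le, ENNReal.ofReal_rpow_of_nonneg (Real.rpow_nonneg hs.1.le _) p0.le, ← Real.rpow_mul hs.1.le]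
  calc J m (fun y => (Hd κ F y) ^ p) ≤ ∫⁻ y in Set.Ioi (0:ℝ), c1 * ∫⁻ s in Set.Ioc (0:ℝ) 1, ENNReal.ofReal (s ^ ((κ-b)*p)) * (ENNReal.ofReal (y ^ m) * F (y * s) ^ p) := by
        unfold J
        refine lintegral_mono fun y => ?_
        calc _ ≤ ENNReal.ofReal (y ^ m) * (c1 * ∫⁻ s in Set.Ioc (0:ℝ) 1, ENNReal.ofReal (s ^ ((κ-b)*p)) * F (y * s) ^ p) := by gcongr; exact step y
          _ = _ := by
            rw [mul_left_comm, ← lintegral_const_mul' _ _ (by simp)]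
            congr 2; funext s; ring
    _ = c1 * ∫⁻ s in Set.Ioc (0:ℝ) 1, ∫⁻ y in Set.Ioi (0:ℝ), ENNReal.ofReal (s ^ ((κ-b)*p)) * (ENNReal.ofReal (y ^ m) * F (y * s) ^ p) := by
        rw [lintegral_const_mul' _ _ hc1t, lintegral_lintegral_swap (by fun_prop)]
    _ = c1 * ∫⁻ s in Set.Ioc (0:ℝ) 1, ENNReal.ofReal (s ^ ((κ-b)*p-m-1)) * J m (fun y => F y ^ p) := by
        congr 1
        refine setLIntegral_congr_fun measurableSet_Ioc fun s hs => ?_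
        rw [lintegral_const_mul' _ _ (by simp)]
        have := J_scale m (fun y => F y ^ p) hs.1
        rw [show (∫⁻ y in Set.Ioi (0:ℝ), ENNReal.ofReal (y ^ m) * F (y * s) ^ p) = ENNReal.ofReal (s ^ (-m-1)) * J m (fun y => F y ^ p) from this, ← mul_assoc, ← ENNReal.ofReal_mul (Real.rpow_nonneg hs.1.le _), ← Real.rpow_add hs.1]
        congr 3; ring
    _ = _ := by rw [lintegral_mul_const _ (by fun_prop), mul_assoc]

end

section
variable {N : ℕ}

/-! ### Interior estimate for the residual -/

lemma sl_dom {p : ℝ} (hp : 1 ≤ p) {ι : Type} [Fintype ι] {F : Pt N → ℝ} {f : ι → Pt N → ℝ} (hf : ∀ i, Measurable (f i)) {c y : ℝ} (hc : 0 ≤ c)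
    (h : ∀ x, |F (x, y)| ≤ c * ∑ i, |f i (x, y)|) :
    sl p F y ≤ ENNReal.ofReal c ^ p * (Fintype.card ι : ENNReal) ^ (p-1) * ∑ i, sl p (f i) y := by
  have h1 : sl p F y ≤ ENNReal.ofReal c ^ p * sl p (fun z => ∑ i, |f i z|) y := by
    apply sl_le_const (by linarith)
    intro x
    rw [abs_of_nonneg (a := ∑ i, |f i (x, y)|) (Finset.sum_nonneg fun _ _ => abs_nonneg _)]
    exact h x
  refine h1.trans ?_
  rw [mul_assoc]
  gcongr
  have h2 := sl_sum_le hp Finset.univ (f := fun i z => |f i z|) (fun i => (hf i).abs) y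
  refine h2.trans (le_of_eq ?_)
  simp only [Finset.card_univ]
  congr 2; funext i
  unfold sl; simp

lemma dom_ne {p : ℝ} (hp : 1 ≤ p) (c : ℝ) (n : ℕ) : ENNReal.ofReal c ^ p * (n : ENNReal) ^ (p-1) ≠ ⊤ :=
  ENNReal.mul_ne_top (ENNReal.rpow_ne_top_of_nonneg (by linarith) (by simp)) (ENNReal.rpow_ne_top_of_nonneg (by linarith) (by simp))

def rs (ζ : Pt N) (τ : ℝ) (g : Pt N → ℝ) (z : Pt N) : ℝ := g z - Tav ζ τ g z

lemma Sm.rs {u : Pt N → ℝ} (hu : Sm u) (ζ : Pt N) (τ : ℝ) : Sm (rs ζ τ u) := hu.sub (hu.Tav ζ τ)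

lemma rs_pd {u : Pt N → ℝ} (hu : Sm u) (ζ : Pt N) (τ : ℝ) (v : Pt N) : pd v (rs ζ τ u) = rs ζ τ (pd v u) := by
  have := pd_sub hu (hu.Tav ζ τ) v
  rw [Tav_pd hu] at this
  exact this

lemma rs_linear {f g : Pt N → ℝ} (hf : Cc f) (hg : Cc g) (c : ℝ) (ζ : Pt N) (τ : ℝ) (z : Pt N) :
    rs ζ τ (fun z => f z + c * g z) z = rs ζ τ f z + c * rs ζ τ g z := by
  unfold rs
  rw [Tav_linear hf hg]; ring

lemma rs_sum {ι : Type} (s : Finset ι) {f : ι → Pt N → ℝ} (hf : ∀ i, Cc (f i)) (ζ : Pt N) (τ : ℝ) (z : Pt N) :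
    rs ζ τ (fun z => ∑ i ∈ s, f i z) z = ∑ i ∈ s, rs ζ τ (f i) z := by
  classical
  induction s using Finset.induction_on with
  | empty => simp [rs, Tav]
  | insert a s ha ih =>
    simp_rw [Finset.sum_insert ha]
    rw [← ih]
    have := rs_linear (hf a) (Cc.sum s hf) 1 ζ τ z
    simpa using this

lemma Sm.Gop {u : Pt N → ℝ} (hu : Sm u) (a : Fin N → ℝ) : Sm (Gop a u) :=
  (Sm.sum _ fun k => (hu.pd (ex k)).pd (ex k)).add ((hu.pd _).pd _)

lemma rs_Gop {u : Pt N → ℝ} (hu : Sm u) (a : Fin N → ℝ) (ζ : Pt N) (τ : ℝ) (z : Pt N) : Gop a (rs ζ τ u) z = rs ζ τ (Gop a u) z := by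
  have h1 := rs_linear (Cc.sum Finset.univ fun k : Fin N => ((hu.pd (ex k)).pd (ex k)).cc) ((hu.pd (Dv a)).pd (Dv a)).cc 1 ζ τ z
  simp only [one_mul] at h1
  rw [rs_sum _ (fun k => ((hu.pd (ex k)).pd (ex k)).cc)] at h1
  rw [show rs ζ τ (Gop a u) z = _ from h1]
  unfold Gop
  simp_rw [rs_pd hu, rs_pd (hu.pd _)]

lemma rs_Gop' {u : Pt N → ℝ} (hu : Sm u) (a : Fin N → ℝ) (ζ : Pt N) (τ c : ℝ) (z : Pt N) :
    Gop a (rs ζ τ u) z = rs ζ τ (fun z => Gop a u z + c * pd ey u z) z - c * rs ζ τ (pd ey u) z := by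
  rw [rs_linear (hu.Gop a).cc (hu.pd _).cc, rs_Gop hu]; ring

lemma Gop_cut {r : Pt N → ℝ} (hr : Sm r) (a : Fin N → ℝ) (z : Pt N) :
    Gop a (cut r) z = th z.2 * Gop a r z + 2 * deriv th z.2 * pd (Dv a) r z + deriv (deriv th) z.2 * r z := by
  unfold Gop
  have e : ∀ v : Pt N, pd v (pd v (cut r)) z = v.2^2*(deriv (deriv th) z.2*r z)+2*v.2*(deriv th z.2*pd v r z)+th z.2*pd v (pd v r) z := by
    intro v; rw [pd_pd_cut th_smooth hr v]
  simp_rw [e]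
  simp only [ex, Dv]
  simp [← Finset.mul_sum]
  ring

lemma pd_pd_cut_ex {r : Pt N → ℝ} (hr : Sm r) (k : Fin N) (z : Pt N) :
    pd (ex k) (pd (ex k) (cut r)) z = th z.2 * pd (ex k) (pd (ex k) r) z := by
  rw [pd_pd_cut th_smooth hr]; simp [ex]

lemma Lop_meas {u : Pt N → ℝ} (hu : Sm u) (a : Fin N → ℝ) (κ : ℝ) : Measurable (Lop a κ u) := by
  unfold Lop
  have h1 := (hu.Gop a).cc.meas
  have h2 := (hu.pd ey).cc.meas
  have h3 : Measurable fun z : Pt N => κ / z.2 := by fun_prop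
  exact h1.add (h3.mul h2)

lemma E1 {p : ℝ} (hp : 1 < p) (a : Fin N → ℝ) (κ : ℝ) : ∃ C : ENNReal, C ≠ ⊤ ∧ ∀ (u : Pt N → ℝ) (k : Fin N) (ε : ℝ), Sm u → 0 < ε → ε ≤ 1 →
    (∫⁻ y in thin, sl p (pd (ex k) (pd (ex k) (rs (ex k) ε u))) y) ≤ 
      ∫⁻ y in fat, C * (sl p (Lop a κ u) y + ENNReal.ofReal ε ^ p * (sl p (pd (ex k) (pd ey u)) y + sl p (pd (ex k) (pd (Dv a) u)) y + sl p (pd (ex k) (pd (ex k) u)) y)) := by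
  obtain ⟨C, hC, H⟩ := CZE hp (Option (Fin N))
  obtain ⟨B, hB1, hB⟩ := th_bdd
  have p0 : 0 < p := by linarith
  set c := B * (2 + 2 * |κ|) with hc
  have hc0 : 0 ≤ c := by positivity
  set C1 : ENNReal := ENNReal.ofReal c ^ p * ((Fintype.card (Fin 4) : ℕ) : ENNReal) ^ (p-1) with hC1
  have hC1t : C1 ≠ ⊤ := dom_ne hp.le c _
  set C2 : ENNReal := 2 ^ (p-1) * (1 + 2 ^ p) + 2 ^ p with hC2
  have hC2t : C2 ≠ ⊤ := by
    have := two_pow_ne_top p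
    have := two_pow_ne_top (p-1)
    exact ENNReal.add_ne_top.2 ⟨ENNReal.mul_ne_top (by assumption) (ENNReal.add_ne_top.2 ⟨by simp, by assumption⟩), by assumption⟩
  refine ⟨C * (C1 * C2), ENNReal.mul_ne_top hC (ENNReal.mul_ne_top hC1t hC2t), fun u k ε hu hε hε1 => ?_⟩
  set r := rs (ex k) ε u with hr
  have hrs : Sm r := hu.rs _ _
  have hk0 : (ex k : Pt N).2 = 0 := rfl
  have hws : Sm (cut r) := hrs.cut th_smooth
  set ζ : Option (Fin N) → Pt N := fun o => o.elim (Dv a) ex with hζ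
  have hG : (fun z => ∑ i, pd (ζ i) (pd (ζ i) (cut r)) z) = Gop a (cut r) := by
    funext z
    rw [Fintype.sum_option, add_comm]; rfl
  have h1 := H N (some k) ζ (cut r) hws
  rw [hG] at h1
  have h2 : (∫⁻ y in thin, sl p (pd (ex k) (pd (ex k) r)) y) ≤ En p (pd (ex k) (pd (ex k) (cut r))) := by
    refine En_thin ((hws.pd _).pd _).cc.meas fun z hz => ?_
    rw [pd_pd_cut_ex hrs, (th_one_nhds hz).self_of_nhds, one_mul]
  refine h2.trans (h1.trans ?_)
  have h3 : En p (Gop a (cut r)) ≤ ∫⁻ y in fat, C1 * C2 * (sl p (Lop a κ u) y + ENNReal.ofReal ε ^ p * (sl p (pd (ex k) (pd ey u)) y + sl p (pd (ex k) (pd (Dv a) u)) y + sl p (pd (ex k) (pd (ex k) u)) y)) := by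
    apply En_fat p0 (hws.Gop a).cc.meas
    · intro z hz
      rw [Gop_cut hrs, th_zero hz, th_d1_zero hz, th_d2_zero hz]; ring
    · intro y hy
      have hy0 : 0 < y := by have := hy.1; linarith
      set fy : Pt N → ℝ := fun z => Gop a u z + κ / y * pd ey u z with hfy
      have hfys : Sm fy := (hu.Gop a).add ((hu.pd _).const_mul _)
      have hs := sl_dom (N := N) hp.le (F := Gop a (cut r)) (f := ![rs (ex k) ε fy, rs (ex k) ε (pd ey u), rs (ex k) ε (pd (Dv a) u), r]) (c := c) (y := y) ?_ hc0 ?_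
      · refine hs.trans ?_
        change C1 * _ ≤ _
        rw [mul_assoc C1 C2]
        refine mul_le_mul_right ?_ C1
        rw [Fin.sum_univ_four]
        simp only [Matrix.cons_val]
        have i1 : sl p (rs (ex k) ε fy) y ≤ C2 * sl p (Lop a κ u) y := by
          refine (sl_one_sub_Tav0 hp hfys.cc hk0 y).trans ?_
          rw [sl_congr (f := fy) (g := Lop a κ u) (y := y) (fun x => rfl)]
          gcongr
          rw [hC2]; exact le_self_add
        have hC2' : (2:ENNReal) ^ p ≤ C2 := le_add_self
        have i2 : ∀ g : Pt N → ℝ, Sm g → sl p (rs (ex k) ε g) y ≤ C2 * (ENNReal.ofReal ε ^ p * sl p (pd (ex k) g) y) := by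
          intro g hg
          refine (sl_one_sub_Tav1 hp hg hk0 hε y).trans ?_
          rw [mul_comm (ENNReal.ofReal ε ^ p), mul_assoc]
          gcongr
        have i3 : sl p r y ≤ C2 * (ENNReal.ofReal ε ^ p * sl p (pd (ex k) (pd (ex k) u)) y) := by
          refine (sl_one_sub_Tav2 hp hu hk0 (τ := ε) y).trans ?_
          rw [mul_comm (ENNReal.ofReal (ε^2) ^ p), mul_assoc]
          gcongr
          nlinarith
        calc _ ≤ C2 * sl p (Lop a κ u) y + C2 * (ENNReal.ofReal ε ^ p * sl p (pd (ex k) (pd ey u)) y) + C2 * (ENNReal.ofReal ε ^ p * sl p (pd (ex k) (pd (Dv a) u)) y) + C2 * (ENNReal.ofReal ε ^ p * sl p (pd (ex k) (pd (ex k) u)) y) := by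
              gcongr
              · exact i2 _ (hu.pd _)
              · exact i2 _ (hu.pd _)
          _ = _ := by ring
      · intro i
        fin_cases i
        · exact (hfys.rs _ _).cc.meas
        · exact ((hu.pd _).rs _ _).cc.meas
        · exact ((hu.pd _).rs _ _).cc.meas
        · exact hrs.cc.meas
      · intro x
        rw [Fin.sum_univ_four]
        simp only [Matrix.cons_val]
        rw [Gop_cut hrs, hr, rs_Gop' hu a (ex k) ε (κ/y), rs_pd hu, ← hfy, ← hr]
        obtain ⟨b1, b2, b3⟩ := hB y
        set A1 := rs (ex k) ε fy (x, y)
        set A2 := rs (ex k) ε (pd ey u) (x, y)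
        set A3 := rs (ex k) ε (pd (Dv a) u) (x, y)
        set A4 := r (x, y)
        have hκy : |κ / y| ≤ 2 * |κ| := by
          rw [abs_div, abs_of_pos hy0, div_le_iff₀ hy0]
          have := hy.1
          nlinarith [abs_nonneg κ]
        have t1 : |th y * (A1 - κ/y * A2)| ≤ B * (|A1| + 2 * |κ| * |A2|) := by
          rw [abs_mul]
          apply mul_le_mul b1 _ (abs_nonneg _) (by linarith)
          refine (abs_sub _ _).trans ?_
          rw [abs_mul]
          gcongr
        have t2 : |2 * deriv th y * A3| ≤ B * (2 * |A3|) := by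
          rw [abs_mul, abs_mul, abs_two]
          nlinarith [abs_nonneg A3]
        have t3 : |deriv (deriv th) y * A4| ≤ B * |A4| := by
          rw [abs_mul]; gcongr
        refine (abs_add_three _ _ _).trans ((add_le_add (add_le_add t1 t2) t3).trans ?_)
        rw [hc, mul_assoc B (2 + 2 * |κ|), ← mul_add, ← mul_add]
        have := abs_nonneg κ
        have := abs_nonneg A1
        have := abs_nonneg A2
        have := abs_nonneg A3
        have := abs_nonneg A4
        apply mul_le_mul_of_nonneg_left _ (by linarith)
        nlinarith [mul_nonneg (abs_nonneg κ) (abs_nonneg A1), mul_nonneg (abs_nonneg κ) (abs_nonneg A3), mul_nonneg (abs_nonneg κ) (abs_nonneg A4)]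
  calc _ ≤ C * ∫⁻ y in fat, C1 * C2 * (sl p (Lop a κ u) y + ENNReal.ofReal ε ^ p * (sl p (pd (ex k) (pd ey u)) y + sl p (pd (ex k) (pd (Dv a) u)) y + sl p (pd (ex k) (pd (ex k) u)) y)) := by gcongr
    _ = _ := by
      rw [← lintegral_const_mul' _ _ hC]
      simp_rw [mul_assoc]

end

section
variable {N : ℕ}

/-! ### Estimate of the second difference quotient -/

lemma Sm.sd {u : Pt N → ℝ} (hu : Sm u) (ζ : Pt N) (τ : ℝ) : Sm (sd ζ τ u) := by
  have := (((hu.shift (τ • ζ)).add (hu.shift' (τ • ζ))).sub (hu.const_mul 2)).const_mul (1/τ^2)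
  convert this using 1
  funext z; unfold _root_.sd; ring

lemma pd_sd {u : Pt N → ℝ} (hu : Sm u) (ζ : Pt N) (τ : ℝ) (v : Pt N) : pd v (sd ζ τ u) = sd ζ τ (pd v u) := by
  have e : sd ζ τ u = fun z => (1/τ^2) * ((u (z + τ • ζ) + u (z - τ • ζ)) - 2 * u z) := by
    funext z; unfold sd; ring
  rw [e, pd_const_mul (((hu.shift (τ • ζ)).add (hu.shift' (τ • ζ))).sub (hu.const_mul 2)), 
    pd_sub ((hu.shift (τ • ζ)).add (hu.shift' (τ • ζ))) (hu.const_mul 2), pd_add (hu.shift (τ • ζ)) (hu.shift' (τ • ζ)), pd_const_mul hu, pd_shift, pd_shift']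
  funext z; unfold sd; ring

lemma Lop_sd {u : Pt N → ℝ} (hu : Sm u) {ζ : Pt N} (hζ : ζ.2 = 0) (τ : ℝ) (a : Fin N → ℝ) (κ : ℝ) :
    Lop a κ (sd ζ τ u) = sd ζ τ (Lop a κ u) := by
  funext z
  unfold Lop Gop
  simp_rw [pd_sd hu, pd_sd (hu.pd _)]
  unfold sd
  simp only [Prod.snd_add, Prod.snd_sub, Prod.smul_snd, hζ, smul_zero, add_zero, sub_zero]
  rw [← Finset.sum_div, Finset.sum_sub_distrib, Finset.sum_add_distrib, ← Finset.mul_sum]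
  ring

lemma Bc_sd {u : Pt N → ℝ} (hu : Bc u) {ζ : Pt N} (hζ : ζ.2 = 0) (τ : ℝ) : Bc (sd ζ τ u) := by
  obtain ⟨hs, δ, hδ, h⟩ := hu
  refine ⟨hs.sd ζ τ, δ, hδ, fun z h1 h2 => ?_⟩
  rw [pd_sd hs]
  unfold sd
  rw [h z h1 h2, h _ (by simpa [hζ] using h1) (by simpa [hζ] using h2), h _ (by simpa [hζ] using h1) (by simpa [hζ] using h2)]
  simp

lemma sl_shift {p : ℝ} (f : Pt N → ℝ) {v : Pt N} (hv : v.2 = 0) (y : ℝ) : sl p (fun z => f (z + v)) y = sl p f y := by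
  unfold sl
  have : ∀ x, ((x, y) : Pt N) + v = (x + v.1, y) := fun x => by ext <;> simp [hv]
  simp_rw [this]
  exact lintegral_add_right_eq_self (fun x => ‖f (x, y)‖ₑ ^ p) v.1

lemma sl_sd {p : ℝ} (hp : 1 ≤ p) {τ : ℝ} (hτ : 0 < τ) : ∃ C : ENNReal, C ≠ ⊤ ∧ ∀ (f : Pt N → ℝ) (ζ : Pt N) (y : ℝ), Measurable f → ζ.2 = 0 →
    sl p (sd ζ τ f) y ≤ C * sl p f y := by
  refine ⟨ENNReal.ofReal (2/τ^2) ^ p * ((Fintype.card (Fin 3) : ℕ) : ENNReal) ^ (p-1) * 3, ENNReal.mul_ne_top (dom_ne hp _ _) (by simp), fun f ζ y hf hζ => ?_⟩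
  have hz : (τ • ζ).2 = 0 := by simp [hζ]
  have hz' : (-(τ • ζ)).2 = 0 := by simp [hζ]
  have hs := sl_dom (N := N) hp (F := sd ζ τ f) (f := ![fun z => f (z + τ • ζ), fun z => f (z + -(τ • ζ)), f]) (c := 2/τ^2) (y := y) ?_ (by positivity) ?_
  · refine hs.trans (le_of_eq ?_)
    rw [Fin.sum_univ_three]
    simp only [Matrix.cons_val, sl_shift f hz, sl_shift f hz', mul_assoc]
    congr 2
    rw [show (3 : ENNReal) = 1 + 1 + 1 by norm_num]; ring
  · intro i
    fin_cases i
    · exact hf.comp (measurable_add_const _)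
    · exact hf.comp (measurable_add_const _)
    · exact hf
  · intro x
    rw [Fin.sum_univ_three]
    simp only [Matrix.cons_val]
    unfold sd
    rw [abs_div, abs_of_pos (show 0 < τ^2 by positivity), div_mul_eq_mul_div]
    gcongr
    rw [← sub_eq_add_neg]
    refine (abs_sub _ _).trans ?_
    rw [abs_mul, abs_two]
    have := abs_add_le (f ((x, y) + τ • ζ)) (f ((x, y) - τ • ζ))
    have := abs_nonneg (f ((x, y) + τ • ζ))
    have := abs_nonneg (f ((x, y) - τ • ζ))
    linarith

lemma lint_pow_le {p : ℝ} (hp : 1 < p) (S : Set ℝ) {h : ℝ → ENNReal} (hh : Measurable h) :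
    (∫⁻ t in S, h t) ^ p ≤ (volume S) ^ (p / p.conjExponent) * ∫⁻ t in S, h t ^ p := by
  have hpq := Real.HolderConjugate.conjExponent hp
  set q := p.conjExponent with hq
  have p0 : 0 < p := by linarith
  have := ENNReal.lintegral_mul_le_Lp_mul_Lq (volume.restrict S) hpq.symm (f := fun _ => 1) (g := h) (by fun_prop) (by fun_prop)
  simp only [Pi.mul_apply, one_mul, ENNReal.one_rpow, lintegral_one, Measure.restrict_apply_univ] at this
  refine (ENNReal.rpow_le_rpow this p0.le).trans (le_of_eq ?_)
  rw [ENNReal.mul_rpow_of_nonneg _ _ p0.le, ← ENNReal.rpow_mul, ← ENNReal.rpow_mul, one_div_mul_cancel p0.ne', ENNReal.rpow_one, one_div_mul_eq_div]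

lemma E2 {p : ℝ} (hp : 1 < p) (a : Fin N → ℝ) {κ : ℝ} (hκ : -1 < κ) {ε K : ℝ} (hε : 0 < ε) (hK : 1 < K) : ∃ C : ENNReal, C ≠ ⊤ ∧ ∀ (u : Pt N → ℝ) (k : Fin N), Bc u →
    ENNReal.ofReal (2 * K) * (∫⁻ y in thin, sl p (sd (ex k) ε u) y) ≤ 
      (∫⁻ y in Set.Icc (2*K) (4*K), 2 ^ (p-1) * 2 ^ p * sl p (pd (ex k) (pd (ex k) u)) y) + ∫⁻ t in Set.Icc 1 (4*K), C * (Hd κ (fun ρ => (sl p (Lop a κ u) ρ) ^ (1/p)) t) ^ p := by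
  obtain ⟨Cs, hCs, H⟩ := sl_sd (N := N) hp.le hε
  have p0 : 0 < p := by linarith
  have hpq := Real.HolderConjugate.conjExponent hp
  have q0 := hpq.symm.pos
  set V0 : ENNReal := (volume (Set.Icc 1 (4*K))) ^ (p / p.conjExponent) with hV0
  have hV0t : V0 ≠ ⊤ := ENNReal.rpow_ne_top_of_nonneg (by positivity) (by simp)
  set c1 : ENNReal := Cs ^ (1/p) * ENNReal.ofReal (4*K) with hc1
  have hc1t : c1 ≠ ⊤ := ENNReal.mul_ne_top (ENNReal.rpow_ne_top_of_nonneg (by positivity) hCs) ENNReal.ofReal_ne_top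
  set C3 : ENNReal := 2 ^ (p-1) * (c1 ^ p * V0) with hC3
  have hC3t : C3 ≠ ⊤ := ENNReal.mul_ne_top (two_pow_ne_top _) (ENNReal.mul_ne_top (ENNReal.rpow_ne_top_of_nonneg p0.le hc1t) hV0t)
  refine ⟨ENNReal.ofReal (2*K) * C3, ENNReal.mul_ne_top ENNReal.ofReal_ne_top hC3t, fun u k hu => ?_⟩
  have hus := hu.1
  have hk0 : (ex k : Pt N).2 = 0 := rfl
  set Φ : ℝ → ENNReal := fun ρ => (sl p (Lop a κ u) ρ) ^ (1/p) with hΦ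
  have hΦm : Measurable Φ := (sl_meas (Lop_meas hus a κ)).pow_const _
  have hHm := Hd_meas κ hΦm
  set V := sd (ex k) ε u with hV
  have hVb : Bc V := Bc_sd hu hk0 ε
  have hVs : ∀ y, sl p V y ≤ 2 ^ p * sl p (pd (ex k) (pd (ex k) u)) y := by
    intro y
    rw [sl_congr (f := V) (g := Tav (ex k) ε (pd (ex k) (pd (ex k) u))) (fun x => sd_eq hus (ex k) hε.ne' _)]
    exact sl_Tav hp ((hus.pd _).pd _).cc hk0 ε y
  set W := ∫⁻ t in Set.Icc 1 (4*K), (Hd κ Φ t) ^ p with hW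
  have main : ∀ y ∈ thin, ∀ y0 ∈ Set.Icc (2*K) (4*K), sl p V y ≤ 2 ^ (p-1) * 2 ^ p * sl p (pd (ex k) (pd (ex k) u)) y0 + C3 * W := by
    intro y hy y0 hy0
    have hy1 : 0 < y := by linarith [hy.1]
    have hlt : y < y0 := by linarith [hy.2, hy0.1]
    have m1 := MPsl hp (a := a) hκ hVb hy1 hlt
    have m2 : (∫⁻ t in Set.Ioc y y0, ENNReal.ofReal (t ^ (-κ)) * ∫⁻ ρ in Set.Ioc 0 t, ENNReal.ofReal (ρ ^ κ) * (sl p (Lop a κ V) ρ) ^ (1/p)) ≤ c1 * ∫⁻ t in Set.Icc 1 (4*K), Hd κ Φ t := by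
      rw [← lintegral_const_mul' _ _ hc1t]
      refine (setLIntegral_mono' measurableSet_Ioc fun t ht => ?_).trans (lintegral_mono_set fun t ht => ⟨by linarith [ht.1, hy.1], by linarith [ht.2, hy0.2]⟩)
      have ht0 : 0 < t := hy1.trans ht.1
      rw [Hd_conv κ _ ht0, ← mul_assoc, ← ENNReal.ofReal_mul (by positivity), ← Real.rpow_add ht0, neg_add_cancel_left, Real.rpow_one, hc1, mul_comm (Cs ^ (1/p)), mul_assoc]
      have ht4 : t ≤ 4 * K := ht.2.trans hy0.2
      gcongr
      rw [← Hd_const_mul κ Φ (ENNReal.rpow_ne_top_of_nonneg (by positivity) hCs)]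
      apply Hd_mono κ ht0
      intro ρ hρ
      simp only [hΦ]
      rw [← ENNReal.mul_rpow_of_nonneg _ _ (by positivity)]
      apply ENNReal.rpow_le_rpow _ (by positivity)
      rw [hV, Lop_sd hus hk0]
      exact H _ _ _ (Lop_meas hus a κ) hk0
    have m3 := ENNReal.rpow_le_rpow (m1.trans (add_le_add le_rfl m2)) p0.le
    rw [← ENNReal.rpow_mul, one_div_mul_cancel p0.ne', ENNReal.rpow_one] at m3
    refine m3.trans ((pow_add_le hp.le _ _).trans ?_)
    rw [← ENNReal.rpow_mul, one_div_mul_cancel p0.ne', ENNReal.rpow_one, ENNReal.mul_rpow_of_nonneg _ _ p0.le, mul_add, hC3, mul_assoc (2 ^ (p-1)), mul_assoc (2 ^ (p-1)), mul_assoc (c1 ^ p)]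
    gcongr
    · exact hVs y0
    · exact lint_pow_le hp _ hHm
  have main2 : ∀ y0 ∈ Set.Icc (2*K) (4*K), (∫⁻ y in thin, sl p V y) ≤ 2 ^ (p-1) * 2 ^ p * sl p (pd (ex k) (pd (ex k) u)) y0 + C3 * W := by
    intro y0 hy0
    refine (setLIntegral_mono' measurableSet_Icc fun y hy => main y hy y0 hy0).trans ?_
    rw [lintegral_const]
    simp
    norm_num
  have e : ENNReal.ofReal (2*K) * (∫⁻ y in thin, sl p V y) = ∫⁻ y0 in Set.Icc (2*K) (4*K), ∫⁻ y in thin, sl p V y := by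
    rw [lintegral_const, mul_comm, Measure.restrict_apply_univ, Real.volume_Icc, show 4*K-2*K=2*K by ring]
  rw [e]
  refine (setLIntegral_mono' measurableSet_Icc main2).trans ?_
  rw [lintegral_add_right _ measurable_const]
  refine add_le_add le_rfl (le_of_eq ?_)
  rw [lintegral_const, lintegral_const_mul' _ _ (ENNReal.mul_ne_top ENNReal.ofReal_ne_top hC3t), ← hW]
  simp only [Measure.restrict_apply_univ, Real.volume_Icc]
  rw [show 4*K-2*K = 2*K by ring, mul_comm, mul_assoc, hC3]
  ring

end

section
variable {N : ℕ}

/-! ### First absorption estimate -/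

lemma Lop_dil {u : Pt N → ℝ} (hu : Sm u) (a : Fin N → ℝ) (κ : ℝ) {R : ℝ} (hR : 0 < R) (z : Pt N) :
    Lop a κ (dil R u) z = R^2 * Lop a κ u (R • z) := by
  unfold Lop Gop
  simp_rw [pd_pd_dil hu hR, pd_dil hu, dil]
  rw [← Finset.mul_sum]
  have : (R • z).2 = R * z.2 := rfl
  rw [this]
  by_cases hz : z.2 = 0
  · simp [hz]; ring
  · field_simp

lemma Bc_dil {u : Pt N → ℝ} (hu : Bc u) {R : ℝ} (hR : 0 < R) : Bc (dil R u) := by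
  refine ⟨hu.1.dil hR, ?_⟩
  obtain ⟨δ, hδ, h⟩ := hu.2
  refine ⟨δ / R, by positivity, fun z h0 h1 => ?_⟩
  rw [pd_dil hu.1]
  have : (R • z).2 = R * z.2 := rfl
  have h2 := h (R • z) (by rw [this]; positivity) (by rw [this]; rw [le_div_iff₀ hR] at h1; linarith)
  simp [dil, h2]

lemma J_const_mul (m : ℝ) (A : ℝ → ENNReal) {c : ENNReal} (hc : c ≠ ⊤) : J m (fun y => c * A y) = c * J m A := by
  unfold J
  rw [← lintegral_const_mul' _ _ hc]
  congr 1; funext s; ring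

lemma J_add (m : ℝ) {A B : ℝ → ENNReal} (hA : Measurable A) : J m (fun y => A y + B y) = J m A + J m B := by
  unfold J
  rw [← lintegral_add_left (by fun_prop)]
  congr 1; funext s; ring

lemma J_mono (m : ℝ) {A B : ℝ → ENNReal} (h : ∀ y > 0, A y ≤ B y) : J m A ≤ J m B := by
  unfold J
  refine setLIntegral_mono' measurableSet_Ioi fun y hy => ?_
  gcongr
  exact h y hy

lemma layer3 {m a b a' b' a'' b'' : ℝ} (ha : 0 < a) (ha' : 0 < a') (ha'' : 0 < a'') {A0 A1 A2 A3 : ℝ → ENNReal} (h0 : Measurable A0) (h1 : Measurable A1) (h2 : Measurable A2) (h3 : Measurable A3)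
    (h : ∀ R > 0, (∫⁻ s in thin, A0 (R * s)) ≤ (∫⁻ s in Set.Icc a b, A1 (R * s)) + (∫⁻ s in Set.Icc a' b', A2 (R * s)) + ∫⁻ s in Set.Icc a'' b'', A3 (R * s)) :
    lc m 1 2 * J m A0 ≤ lc m a b * J m A1 + lc m a' b' * J m A2 + lc m a'' b'' * J m A3 := by
  have mm : ∀ (A : ℝ → ENNReal) (a b : ℝ), Measurable A → Measurable fun R : ℝ => ENNReal.ofReal (R ^ m) * ∫⁻ s in Set.Icc a b, A (R * s) := by
    intro A a b hA
    apply Measurable.mul (by fun_prop)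
    exact Measurable.lintegral_prod_right' (f := fun w : ℝ × ℝ => A (w.1 * w.2)) (by fun_prop)
  rw [← layer h0 one_pos, ← layer h1 ha, ← layer h2 ha', ← layer h3 ha'']
  rw [← lintegral_add_left (mm _ _ _ h1), ← lintegral_add_left (f := fun R : ℝ => _ + _) ((mm _ _ _ h1).add (mm _ _ _ h2))]
  refine setLIntegral_mono' measurableSet_Ioi fun R hR => ?_
  rw [← mul_add, ← mul_add]
  gcongr
  exact h R hR

lemma lc_scale (m a b : ℝ) {K : ℝ} (hK : 0 < K) (ha : 0 < a) : lc m (K * a) (K * b) = ENNReal.ofReal (K ^ (-m)) * lc m a b := by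
  unfold lc
  rw [← lintegral_const_mul' _ _ (by simp), ← lintegral_indicator measurableSet_Icc, ← lintegral_indicator measurableSet_Icc]
  have := lint_comp_smul (E := ℝ) hK.ne' ((Set.Icc (K*a) (K*b)).indicator fun s => ENNReal.ofReal (s ^ (-m-1)))
  simp only [Module.finrank_self, pow_one, abs_of_pos (inv_pos.2 hK), smul_eq_mul] at this
  have h2 := congrArg (fun x => ENNReal.ofReal K * x) this
  simp only [← mul_assoc, ← ENNReal.ofReal_mul hK.le, mul_inv_cancel₀ hK.ne', ENNReal.ofReal_one, one_mul] at h2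
  rw [← h2, ← lintegral_const_mul' _ _ (by simp)]
  congr 1; funext s
  simp only [Set.indicator_apply, Set.mem_Icc, mul_le_mul_iff_right₀ hK]
  split_ifs with hs
  · rw [← ENNReal.ofReal_mul hK.le, ← ENNReal.ofReal_mul (by positivity), Real.mul_rpow hK.le (by linarith [hs.1])]
    congr 1
    rw [← mul_assoc]
    congr 1
    nth_rewrite 1 [← Real.rpow_one K]
    rw [← Real.rpow_add hK]; congr 1; ring
  · simp

/-- small parameters -/
lemma small_param {c η : ENNReal} (hc : c ≠ ⊤) (hη : η ≠ 0) {s : ℝ} (hs : 0 < s) :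
    ∃ ε : ℝ, 0 < ε ∧ ε < 1 ∧ c * ENNReal.ofReal ε ^ s ≤ η := by
  have h1 : Filter.Tendsto (fun ε : ℝ => c * ENNReal.ofReal ε ^ s) (nhdsWithin 0 (Set.Ioi 0)) (nhds 0) := by
    have : Filter.Tendsto (fun ε : ℝ => c * ENNReal.ofReal ε ^ s) (nhds 0) (nhds (c * ENNReal.ofReal 0 ^ s)) := by
      apply ENNReal.Tendsto.const_mul _ (Or.inr hc)
      exact ((ENNReal.continuous_rpow_const).comp ENNReal.continuous_ofReal).tendsto 0
    simp [hs] at this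
    exact this.mono_left nhdsWithin_le_nhds
  have h2 := h1.eventually (ge_mem_nhds (pos_iff_ne_zero.2 hη))
  have h3 : ∀ᶠ ε : ℝ in nhdsWithin 0 (Set.Ioi 0), ε ∈ Set.Ioo (0:ℝ) 1 := Ioo_mem_nhdsGT one_pos
  obtain ⟨ε, h4, h5⟩ := (h2.and h3).exists
  exact ⟨ε, h5.1, h5.2, h4⟩

lemma E12 {p : ℝ} (hp : 1 < p) (a : Fin N → ℝ) {κ : ℝ} (hκ : -1 < κ) : ∃ C : ENNReal, C ≠ ⊤ ∧ ∀ ε : ℝ, 0 < ε → ε ≤ 1 → ∀ K : ℝ, 1 < K → 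
    ∃ C2 : ENNReal, C2 ≠ ⊤ ∧ ∀ (u : Pt N → ℝ) (k : Fin N), Bc u →
    (∫⁻ y in thin, sl p (pd (ex k) (pd (ex k) u)) y) ≤ 
      (∫⁻ y in fat, (C * sl p (Lop a κ u) y + C * ENNReal.ofReal ε ^ p * (sl p (pd (ex k) (pd ey u)) y + sl p (pd (ex k) (pd (Dv a) u)) y + sl p (pd (ex k) (pd (ex k) u)) y)))
      + (∫⁻ y in Set.Icc (2*K) (4*K), C * ENNReal.ofReal K⁻¹ * sl p (pd (ex k) (pd (ex k) u)) y) + ∫⁻ t in Set.Icc 1 (4*K), C2 * (Hd κ (fun ρ => (sl p (Lop a κ u) ρ) ^ (1/p)) t) ^ p := by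
  obtain ⟨C1, hC1, H1⟩ := E1 (N := N) hp a κ
  have t1 := two_pow_ne_top p
  have t2 := two_pow_ne_top (p-1)
  refine ⟨2 ^ (p-1) * C1 + 2 ^ (p-1) * (2 ^ (p-1) * 2 ^ p), by finiteness, fun ε hε hε1 K hK => ?_⟩
  obtain ⟨C2, hC2, H2⟩ := E2 (N := N) hp a hκ hε hK
  have k0 : 0 < K := by linarith
  refine ⟨2 ^ (p-1) * (ENNReal.ofReal (K⁻¹) * C2), by finiteness, fun u k hu => ?_⟩
  have hus := hu.1
  have h1 := H1 u k ε hus hε hε1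
  have h2 := H2 u k hu
  have h2' : (∫⁻ y in thin, sl p (sd (ex k) ε u) y) ≤ ENNReal.ofReal K⁻¹ * ((∫⁻ y in Set.Icc (2*K) (4*K), 2 ^ (p-1) * 2 ^ p * sl p (pd (ex k) (pd (ex k) u)) y) + ∫⁻ t in Set.Icc 1 (4*K), C2 * (Hd κ (fun ρ => (sl p (Lop a κ u) ρ) ^ (1/p)) t) ^ p) := by
    refine le_trans ?_ (mul_le_mul_right h2 _)
    rw [← mul_assoc, ← ENNReal.ofReal_mul (by positivity)]
    apply le_mul_of_one_le_left' 
    rw [show K⁻¹ * (2 * K) = 2 by field_simp]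
    simp
  have h0 : ∀ y, sl p (pd (ex k) (pd (ex k) u)) y ≤ 2 ^ (p-1) * (sl p (pd (ex k) (pd (ex k) (rs (ex k) ε u))) y + sl p (sd (ex k) ε u) y) := by
    intro y
    refine le_trans (le_of_eq ?_) (sl_add_le hp.le (((hus.rs _ _).pd _).pd _).cc.meas y)
    apply sl_congr
    intro x
    rw [sd_eq hus _ hε.ne', rs_pd hus, rs_pd (hus.pd _)]
    unfold rs; ring
  refine (lintegral_mono fun y => h0 y).trans ?_
  rw [lintegral_const_mul' _ _ t2, lintegral_add_left (sl_meas (((hus.rs _ _).pd _).pd _).cc.meas)]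
  refine (mul_le_mul_right (add_le_add h1 h2') _).trans ?_
  rw [mul_add, mul_add, mul_add, ← add_assoc]
  refine add_le_add (add_le_add ?_ ?_) ?_
  · rw [← lintegral_const_mul' _ _ t2]
    apply lintegral_mono; intro y
    dsimp only
    rw [mul_add, mul_add, mul_assoc (2 ^ (p-1) * C1 + _), ← mul_assoc, ← mul_assoc]
    gcongr <;> exact le_self_add
  · rw [← lintegral_const_mul' _ _ (by finiteness), ← lintegral_const_mul' _ _ t2]
    apply lintegral_mono; intro y
    dsimp only
    rw [← mul_assoc, ← mul_assoc, mul_assoc (2 ^ (p-1)) _ (2 ^ (p-1) * 2 ^ p), mul_comm (ENNReal.ofReal _), ← mul_assoc (2 ^ (p-1))]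
    gcongr; exact le_add_self
  · rw [← lintegral_const_mul' _ _ (by finiteness), ← lintegral_const_mul' _ _ t2]
    apply lintegral_mono; intro y
    dsimp only
    rw [← mul_assoc, ← mul_assoc, ← mul_assoc]


lemma lint_pull {S : Set ℝ} {c : ENNReal} (hc : c ≠ ⊤) {A B : ℝ → ENNReal} (h : ∀ y, A y = c * B y) :
    (∫⁻ y in S, A y) = c * ∫⁻ y in S, B y := by
  rw [← lintegral_const_mul' _ _ hc]; simp_rw [h]

lemma sl_pd_dil {p : ℝ} (hp : 0 < p) {R : ℝ} (hR : 0 < R) {u : Pt N → ℝ} (hu : Sm u) (v w : Pt N) (s : ℝ) :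
    sl p (pd v (pd w (dil R u))) s = scf N p R * sl p (pd v (pd w u)) (R * s) :=
  sl_dil hp hR fun x => by rw [pd_pd_dil hu hR]

lemma sl_Lop_dil {p : ℝ} (hp : 0 < p) {R : ℝ} (hR : 0 < R) {u : Pt N → ℝ} (hu : Sm u) (a : Fin N → ℝ) (κ : ℝ) (s : ℝ) :
    sl p (Lop a κ (dil R u)) s = scf N p R * sl p (Lop a κ u) (R * s) :=
  sl_dil hp hR fun x => by rw [Lop_dil hu _ _ hR]

lemma LemE {p m : ℝ} (hp : 1 < p) (hm : -1 < m) (a : Fin N → ℝ) {κ : ℝ} (h : (m+1)/p < κ + 1) {η : ENNReal} (hη : η ≠ 0) :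
    ∃ C : ENNReal, C ≠ ⊤ ∧ ∀ (u : Pt N → ℝ) (k : Fin N), Bc u →
    J m (sl p (pd (ex k) (pd (ex k) u))) ≤ η * (J m (sl p (pd (ex k) (pd ey u))) + J m (sl p (pd (ex k) (pd (Dv a) u))) + J m (sl p (pd (ex k) (pd (ex k) u))))
      + C * J m (sl p (Lop a κ u)) := by
  have p0 : 0 < p := by linarith
  have hκ : -1 < κ := by
    have : 0 < (m+1)/p := div_pos (by linarith) p0
    linarith
  obtain ⟨C, hC, H⟩ := E12 (N := N) hp a hκ
  obtain ⟨CH, hCH, HH⟩ := Hardy hp h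
  obtain ⟨l0, lt⟩ := lc_ne (m := m) (a := 1) (b := 2) (by norm_num) (by norm_num)
  obtain ⟨-, ft⟩ := lc_ne (m := m) (a := 1/2) (b := 5/2) (by norm_num) (by norm_num)
  obtain ⟨-, gt⟩ := lc_ne (m := m) (a := 2) (b := 4) (by norm_num) (by norm_num)
  have lit : (lc m 1 2)⁻¹ ≠ ⊤ := ENNReal.inv_ne_top.2 l0
  have hη2 : η / 2 ≠ 0 := by simp [hη]
  obtain ⟨ε, he0, he1, he⟩ := small_param (c := (lc m 1 2)⁻¹ * (lc m (1/2) (5/2) * C)) (by finiteness) hη2 p0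
  obtain ⟨K', hk0, hk1, hk⟩ := small_param (c := (lc m 1 2)⁻¹ * (lc m 2 4 * C)) (by finiteness) hη2 (show 0 < m + 1 by linarith)
  set K := K'⁻¹ with hKd
  have hK : 1 < K := (one_lt_inv₀ hk0).2 hk1
  have K0 : 0 < K := by linarith
  obtain ⟨C2, hC2, H2⟩ := H ε he0 he1.le K hK
  obtain ⟨-, ht⟩ := lc_ne (m := m) (a := 1) (b := 4*K) (by norm_num) (by linarith)
  refine ⟨(lc m 1 2)⁻¹ * (lc m (1/2) (5/2) * C + lc m 1 (4*K) * (C2 * CH)), by finiteness, fun u k hu => ?_⟩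
  have hus := hu.1
  set A : ℝ → ENNReal := sl p (pd (ex k) (pd (ex k) u)) with hA
  set Y : ℝ → ENNReal := sl p (pd (ex k) (pd ey u)) with hY
  set D : ℝ → ENNReal := sl p (pd (ex k) (pd (Dv a) u)) with hD
  set f : ℝ → ENNReal := sl p (Lop a κ u) with hf
  have mA : Measurable A := sl_meas ((hus.pd _).pd _).cc.meas
  have mY : Measurable Y := sl_meas ((hus.pd _).pd _).cc.meas
  have mD : Measurable D := sl_meas ((hus.pd _).pd _).cc.meas
  have mf : Measurable f := sl_meas (Lop_meas hus _ _)
  have mF : Measurable fun ρ => f ρ ^ (1/p) := mf.pow_const _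
  have mH := Hd_meas κ mF
  have key := layer3 (m := m) (a := 1/2) (b := 5/2) (a' := 2*K) (b' := 4*K) (a'' := 1) (b'' := 4*K) (by norm_num) (by positivity) (by norm_num)
    (A0 := A) (A1 := fun y => C * f y + C * ENNReal.ofReal ε ^ p * (Y y + D y + A y)) (A2 := fun y => C * ENNReal.ofReal K⁻¹ * A y)
    (A3 := fun t => C2 * (Hd κ (fun ρ => f ρ ^ (1/p)) t) ^ p) mA (by fun_prop) (by fun_prop) (by fun_prop) (by
      intro R hR
      obtain ⟨s0, st⟩ := scf_ne (N := N) p0 hR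
      have := H2 (dil R u) k (Bc_dil hu hR)
      simp only [sl_pd_dil p0 hR hus, sl_Lop_dil p0 hR hus] at this
      have e1 : ∀ t, (Hd κ (fun ρ => (scf N p R * sl p (Lop a κ u) (R * ρ)) ^ (1/p)) t) ^ p = scf N p R * (Hd κ (fun ρ => f ρ ^ (1/p)) (R * t)) ^ p := by
        intro t
        simp only [ENNReal.mul_rpow_of_nonneg _ _ (show 0 ≤ 1/p by positivity)]
        rw [Hd_const_mul κ (fun ρ => sl p (Lop a κ u) (R * ρ) ^ (1/p)) (ENNReal.rpow_ne_top_of_nonneg (by positivity) st), ENNReal.mul_rpow_of_nonneg _ _ p0.le, ← ENNReal.rpow_mul, one_div_mul_cancel p0.ne', ENNReal.rpow_one,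
          Hd_scale κ (fun ρ => f ρ ^ (1/p))]
      simp only [e1] at this
      rw [lint_pull st (fun y => rfl), lint_pull (S := fat) (B := fun y => C * f (R*y) + C * ENNReal.ofReal ε ^ p * (Y (R*y) + D (R*y) + A (R*y))) st (fun y => by simp only [hf, hY, hD, hA]; ring), 
        lint_pull (S := Set.Icc (2*K) (4*K)) (B := fun y => C * ENNReal.ofReal K⁻¹ * A (R*y)) st (fun y => by simp only [hA]; ring), 
        lint_pull (S := Set.Icc 1 (4*K)) (B := fun t => C2 * (Hd κ (fun ρ => f ρ ^ (1/p)) (R * t)) ^ p) st (fun y => by ring), ← mul_add, ← mul_add] at this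
      exact (ENNReal.mul_le_mul_iff_right s0 st).1 this)
  have hHd := HH _ mF
  simp only [← ENNReal.rpow_mul, one_div_mul_cancel p0.ne', ENNReal.rpow_one] at hHd
  rw [J_add m (by fun_prop), J_const_mul m _ hC, J_const_mul m _ (by finiteness), J_const_mul m _ (by finiteness), J_const_mul m _ hC2, J_add m (by fun_prop), J_add m (by fun_prop)] at key
  have hlc : lc m (2*K) (4*K) * ENNReal.ofReal K⁻¹ = lc m 2 4 * ENNReal.ofReal K' ^ (m+1) := by
    rw [mul_comm 2 K, mul_comm 4 K, lc_scale m 2 4 K0 (by norm_num), mul_comm _ (lc m 2 4), mul_assoc, ← ENNReal.ofReal_mul (by positivity), hKd, inv_inv, ENNReal.ofReal_rpow_of_pos hk0, Real.inv_rpow hk0.le, Real.rpow_neg hk0.le, inv_inv, Real.rpow_add hk0, Real.rpow_one]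
  calc J m A = (lc m 1 2)⁻¹ * (lc m 1 2 * J m A) := by rw [← mul_assoc, ENNReal.inv_mul_cancel l0 lt, one_mul]
    _ ≤ _ := mul_le_mul_right key _
    _ ≤ (lc m 1 2)⁻¹ * (lc m (1/2) (5/2) * (C * J m f + C * ENNReal.ofReal ε ^ p * (J m Y + J m D + J m A)) + lc m (2*K) (4*K) * (C * ENNReal.ofReal K⁻¹ * J m A) + lc m 1 (4*K) * (C2 * (CH * J m f))) := by gcongr
    _ = ((lc m 1 2)⁻¹ * (lc m (1/2) (5/2) * C)) * ENNReal.ofReal ε ^ p * (J m Y + J m D + J m A) + ((lc m 1 2)⁻¹ * C) * (lc m (2*K) (4*K) * ENNReal.ofReal K⁻¹) * J m A + ((lc m 1 2)⁻¹ * (lc m (1/2) (5/2) * C + lc m 1 (4*K) * (C2 * CH))) * J m f := by ring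
    _ = ((lc m 1 2)⁻¹ * (lc m (1/2) (5/2) * C)) * ENNReal.ofReal ε ^ p * (J m Y + J m D + J m A) + ((lc m 1 2)⁻¹ * (lc m 2 4 * C)) * ENNReal.ofReal K' ^ (m+1) * J m A + ((lc m 1 2)⁻¹ * (lc m (1/2) (5/2) * C + lc m 1 (4*K) * (C2 * CH))) * J m f := by rw [hlc]; ring
    _ ≤ η / 2 * (J m Y + J m D + J m A) + η / 2 * (J m Y + J m D + J m A) + ((lc m 1 2)⁻¹ * (lc m (1/2) (5/2) * C + lc m 1 (4*K) * (C2 * CH))) * J m f := by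
      gcongr
      exact le_add_self
    _ = _ := by rw [← add_mul, ENNReal.add_halves]

end

section
variable {N : ℕ}

/-! ### Mixed derivatives -/

def CL (m : ℝ) : ENNReal := (lc m 1 2)⁻¹ * lc m (1/2) (5/2)
lemma CL_ne (m : ℝ) : CL m ≠ ⊤ := by
  obtain ⟨l0, lt⟩ := lc_ne (m := m) (a := 1) (b := 2) (by norm_num) (by norm_num)
  obtain ⟨-, ft⟩ := lc_ne (m := m) (a := 1/2) (b := 5/2) (by norm_num) (by norm_num)
  have lit : (lc m 1 2)⁻¹ ≠ ⊤ := ENNReal.inv_ne_top.2 l0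
  unfold CL; finiteness

lemma layerU (m : ℝ) {A0 A1 : ℝ → ENNReal} (h0 : Measurable A0) (h1 : Measurable A1)
    (h : ∀ R > 0, ∃ s : ENNReal, s ≠ 0 ∧ s ≠ ⊤ ∧ (∫⁻ y in thin, s * A0 (R * y)) ≤ ∫⁻ y in fat, s * A1 (R * y)) : J m A0 ≤ CL m * J m A1 := by
  obtain ⟨l0, lt⟩ := lc_ne (m := m) (a := 1) (b := 2) (by norm_num) (by norm_num)
  have key := layer3 (m := m) (a := 1/2) (b := 5/2) (a' := 1) (b' := 2) (a'' := 1) (b'' := 2) (by norm_num) (by norm_num) (by norm_num) h0 h1 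
    (A2 := fun _ => 0) (A3 := fun _ => 0) measurable_const measurable_const (by
      intro R hR
      obtain ⟨s, s0, st, hs⟩ := h R hR
      rw [lintegral_const_mul' _ _ st, lintegral_const_mul' _ _ st] at hs
      have := (ENNReal.mul_le_mul_iff_right s0 st).1 hs
      simpa only [lintegral_zero, add_zero] using this)
  have z : J m (fun _ => 0) = 0 := by simp [J]
  rw [z, mul_zero, add_zero, add_zero] at key
  calc J m A0 = (lc m 1 2)⁻¹ * (lc m 1 2 * J m A0) := by rw [← mul_assoc, ENNReal.inv_mul_cancel l0 lt, one_mul]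
    _ ≤ _ := mul_le_mul_right key _
    _ = _ := by rw [CL, mul_assoc]

lemma pd_pd_cut2 {r : Pt N → ℝ} (hr : Sm r) {v : Pt N} (hv : v.2 = 0) (w : Pt N) (z : Pt N) :
    pd v (pd w (cut r)) z = w.2 * (deriv th z.2 * pd v r z) + th z.2 * pd v (pd w r) z := by
  rw [pd_comm (hr.cut th_smooth)]
  rw [pd_cut th_smooth hr, hv]
  simp only [zero_mul, zero_add]
  rw [pd_cut th_smooth (hr.pd v), pd_comm hr]

lemma F1 {p : ℝ} (hp : 1 < p) (m : ℝ) : ∃ C : ENNReal, C ≠ ⊤ ∧ ∀ (u : Pt N → ℝ) (j k : Fin N), Sm u →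
    J m (sl p (pd (ex j) (pd (ex k) u))) ≤ C * (J m (sl p (pd (ex j) (pd (ex j) u))) + J m (sl p (pd (ex k) (pd (ex k) u)))) := by
  obtain ⟨C, hC, H⟩ := CZ2 hp
  obtain ⟨B, hB1, hB⟩ := th_bdd
  have p0 : 0 < p := by linarith
  have tt := CL_ne m
  have ht : ENNReal.ofReal B ^ p ≠ ⊤ := ENNReal.rpow_ne_top_of_nonneg p0.le ENNReal.ofReal_ne_top
  refine ⟨CL m * (C * ENNReal.ofReal B ^ p), by finiteness, fun u j k hu => ?_⟩
  have ms : ∀ a b : Pt N, Measurable (sl p (pd a (pd b u))) := fun a b => sl_meas ((hu.pd _).pd _).cc.meas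
  have unit : ∀ w : Pt N → ℝ, Sm w → (∫⁻ y in thin, sl p (pd (ex j) (pd (ex k) w)) y) ≤ ∫⁻ y in fat, C * ENNReal.ofReal B ^ p * (sl p (pd (ex j) (pd (ex j) w)) y + sl p (pd (ex k) (pd (ex k) w)) y) := by
    intro w hw
    have hc : Sm (cut w) := hw.cut th_smooth
    have h1 := H N (ex j) (ex k) (cut w) hc
    have h2 : (∫⁻ y in thin, sl p (pd (ex j) (pd (ex k) w)) y) ≤ En p (pd (ex j) (pd (ex k) (cut w))) := by
      refine En_thin ((hc.pd _).pd _).cc.meas fun z hz => ?_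
      rw [pd_pd_cut2 hw rfl, (th_one_nhds hz).self_of_nhds]; simp [ex]
    have h3 : ∀ i, En p (pd (ex i) (pd (ex i) (cut w))) ≤ ∫⁻ y in fat, ENNReal.ofReal B ^ p * sl p (pd (ex i) (pd (ex i) w)) y := by
      intro i
      apply En_fat p0 ((hc.pd _).pd _).cc.meas
      · intro z hz
        rw [pd_pd_cut_ex hw, th_zero hz, zero_mul]
      · intro y hy
        apply sl_le_const p0.le
        intro x
        rw [pd_pd_cut_ex hw, abs_mul]
        gcongr
        exact (hB y).1
    refine h2.trans (h1.trans ((mul_le_mul_right (add_le_add (h3 j) (h3 k)) C).trans (le_of_eq ?_)))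
    have := (sl_meas (p := p) ((hw.pd (ex j)).pd (ex j)).cc.meas)
    rw [← lintegral_add_left (by fun_prop), ← lintegral_const_mul' _ _ hC]
    congr 1; funext y; ring
  have mj := ms (ex j) (ex j)
  have mk := ms (ex k) (ex k)
  have := layerU m (ms (ex j) (ex k)) (A1 := fun y => C * ENNReal.ofReal B ^ p * (sl p (pd (ex j) (pd (ex j) u)) y + sl p (pd (ex k) (pd (ex k) u)) y)) (by fun_prop) (by
    intro R hR
    obtain ⟨s0, st⟩ := scf_ne (N := N) p0 hR
    refine ⟨_, s0, st, ?_⟩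
    have := unit (dil R u) (hu.dil hR)
    simp only [sl_pd_dil p0 hR hu] at this
    refine this.trans (le_of_eq ?_)
    congr 1; funext y; ring)
  rw [J_const_mul m _ (by finiteness), J_add m mj, ← mul_assoc] at this
  exact this

def Uy (u : Pt N → ℝ) (z : Pt N) : ℝ := pd ey u z / z.2
lemma Uy_meas {u : Pt N → ℝ} (hu : Sm u) : Measurable (Uy u) := (hu.pd ey).cc.meas.div measurable_snd

lemma sl_Uy_dil {p : ℝ} (hp : 0 < p) {R : ℝ} (hR : 0 < R) {u : Pt N → ℝ} (hu : Sm u) (s : ℝ) :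
    sl p (Uy (dil R u)) s = scf N p R * sl p (Uy u) (R * s) :=
  sl_dil hp hR fun x => by
    unfold Uy
    rw [pd_dil hu]
    simp only [dil, Prod.smul_mk, smul_eq_mul]
    by_cases hs : s = 0
    · simp [hs]
    · field_simp

lemma F2 {p : ℝ} (hp : 1 < p) (m : ℝ) : ∃ C : ENNReal, C ≠ ⊤ ∧ ∀ ε : ℝ, 0 < ε → ∃ C' : ENNReal, C' ≠ ⊤ ∧ ∀ (u : Pt N → ℝ) (k : Fin N), Sm u →
    J m (sl p (pd (ex k) (pd ey u))) ≤ C * ENNReal.ofReal ε ^ p * (J m (sl p (Uy u)) + J m (sl p (pd ey (pd ey u)))) + C' * J m (sl p (pd (ex k) (pd (ex k) u))) := by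
  obtain ⟨C, hC, H⟩ := CZ2' hp
  obtain ⟨B, hB1, hB⟩ := th_bdd
  have p0 : 0 < p := by linarith
  have tt := CL_ne m
  have ht : ENNReal.ofReal B ^ p ≠ ⊤ := ENNReal.rpow_ne_top_of_nonneg p0.le ENNReal.ofReal_ne_top
  have t5 : ENNReal.ofReal (5/2) ^ p ≠ ⊤ := ENNReal.rpow_ne_top_of_nonneg p0.le ENNReal.ofReal_ne_top
  have t1 := two_pow_ne_top p
  have t2 := two_pow_ne_top (p-1)
  set C0 : ENNReal := 2 ^ (p-1) * (1 + 2 ^ p) with hC0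
  have hC0t : C0 ≠ ⊤ := by finiteness
  set c3 : ENNReal := ENNReal.ofReal (2*B) ^ p * ((Fintype.card (Fin 3) : ℕ) : ENNReal) ^ (p-1) with hc3
  have hc3t : c3 ≠ ⊤ := dom_ne hp.le _ _
  set C4 : ENNReal := 2 ^ (p-1) * (2 ^ p * ENNReal.ofReal (5/2) ^ p + C * (c3 * (C0 * ENNReal.ofReal (5/2) ^ p + C0))) with hC4
  have hC4t : C4 ≠ ⊤ := by finiteness
  refine ⟨CL m * C4, by finiteness, fun ε hε => ?_⟩
  have te : ENNReal.ofReal ε ^ p ≠ ⊤ := ENNReal.rpow_ne_top_of_nonneg p0.le ENNReal.ofReal_ne_top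
  have tei : ENNReal.ofReal ε⁻¹ ^ p ≠ ⊤ := ENNReal.rpow_ne_top_of_nonneg p0.le ENNReal.ofReal_ne_top
  have tei2 : ENNReal.ofReal (ε⁻¹^2) ^ p ≠ ⊤ := ENNReal.rpow_ne_top_of_nonneg p0.le ENNReal.ofReal_ne_top
  set C5 : ENNReal := 2 ^ (p-1) * (C * (ENNReal.ofReal ε⁻¹ ^ p * (ENNReal.ofReal B ^ p * C0) + ENNReal.ofReal ε ^ p * (c3 * (ENNReal.ofReal (ε⁻¹^2) ^ p * 2 ^ p)))) with hC5
  have hC5t : C5 ≠ ⊤ := by finiteness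
  refine ⟨CL m * C5, by finiteness, fun u k hu => ?_⟩
  have hk0 : (ex k : Pt N).2 = 0 := rfl
  have unit : ∀ w : Pt N → ℝ, Sm w → (∫⁻ y in thin, sl p (pd (ex k) (pd ey w)) y) ≤ ∫⁻ y in fat, (C4 * ENNReal.ofReal ε ^ p * (sl p (Uy w) y + sl p (pd ey (pd ey w)) y) + C5 * sl p (pd (ex k) (pd (ex k) w)) y) := by
    intro w hw
    set r := rs (ex k) ε⁻¹ w with hr
    have hrs : Sm r := hw.rs _ _
    have hc : Sm (cut r) := hrs.cut th_smooth
    have hTs : Sm (Tav (ex k) ε⁻¹ (pd ey w)) := (hw.pd _).Tav _ _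
    have mU := sl_meas (p := p) (Uy_meas hw)
    have mA := sl_meas (p := p) ((hw.pd (ex k)).pd (ex k)).cc.meas
    have mYY := sl_meas (p := p) ((hw.pd ey).pd ey).cc.meas
    -- slices of the y-derivative
    have hUy : ∀ y ∈ fat, sl p (pd ey w) y ≤ ENNReal.ofReal (5/2) ^ p * sl p (Uy w) y := by
      intro y hy
      have y0 : 0 < y := by linarith [hy.1]
      apply sl_le_const p0.le
      intro x
      unfold Uy
      rw [abs_div, abs_of_pos y0, mul_div_assoc', le_div_iff₀ y0, mul_comm]
      gcongr
      exact hy.2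
    have h0 : ∀ y, sl p (pd (ex k) (pd ey w)) y ≤ 2 ^ (p-1) * (sl p (pd (ex k) (Tav (ex k) ε⁻¹ (pd ey w))) y + sl p (pd (ex k) (pd ey r)) y) := by
      intro y
      refine le_trans (le_of_eq ?_) (sl_add_le hp.le (hTs.pd _).cc.meas y)
      apply sl_congr
      intro x
      rw [hr, rs_pd hw, rs_pd (hw.pd _), Tav_pd (hw.pd _)]
      unfold rs; ring
    have h1 := H N (ex k) ey (cut r) ε hε hc
    have h2 : (∫⁻ y in thin, sl p (pd (ex k) (pd ey r)) y) ≤ En p (pd (ex k) (pd ey (cut r))) := by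
      refine En_thin ((hc.pd _).pd _).cc.meas fun z hz => ?_
      rw [pd_pd_cut2 hrs rfl, (th_one_nhds hz).self_of_nhds, th_d1_one hz]; simp
    have h3 : En p (pd (ex k) (pd (ex k) (cut r))) ≤ ∫⁻ y in fat, ENNReal.ofReal B ^ p * C0 * sl p (pd (ex k) (pd (ex k) w)) y := by
      apply En_fat p0 ((hc.pd _).pd _).cc.meas
      · intro z hz
        rw [pd_pd_cut_ex hrs, th_zero hz, zero_mul]
      · intro y hy
        refine (sl_le_const (c := B) (g := pd (ex k) (pd (ex k) r)) p0.le ?_).trans ?_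
        · intro x
          rw [pd_pd_cut_ex hrs, abs_mul]
          gcongr
          exact (hB y).1
        · rw [mul_assoc, hr, rs_pd hw, rs_pd (hw.pd _)]
          gcongr
          exact sl_one_sub_Tav0 hp ((hw.pd _).pd _).cc hk0 y
    have h4 : En p (pd ey (pd ey (cut r))) ≤ ∫⁻ y in fat, c3 * (ENNReal.ofReal (ε⁻¹^2) ^ p * 2 ^ p * sl p (pd (ex k) (pd (ex k) w)) y + C0 * (ENNReal.ofReal (5/2) ^ p * sl p (Uy w) y) + C0 * sl p (pd ey (pd ey w)) y) := by
      have ee : ∀ z, pd ey (pd ey (cut r)) z = deriv (deriv th) z.2 * r z + 2 * (deriv th z.2 * pd ey r z) + th z.2 * pd ey (pd ey r) z := by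
        intro z
        rw [pd_pd_cut th_smooth hrs]; simp [ey]
      apply En_fat p0 ((hc.pd _).pd _).cc.meas
      · intro z hz
        rw [ee, th_zero hz, th_d1_zero hz, th_d2_zero hz]; ring
      · intro y hy
        refine (sl_dom (N := N) hp.le (f := ![r, pd ey r, pd ey (pd ey r)]) (c := 2*B) (y := y) ?_ (by positivity) ?_).trans ?_
        · intro i
          fin_cases i
          · exact hrs.cc.meas
          · exact (hrs.pd _).cc.meas
          · exact ((hrs.pd _).pd _).cc.meas
        · intro x
          rw [Fin.sum_univ_three]
          simp only [Matrix.cons_val]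
          rw [ee]
          obtain ⟨b1, b2, b3⟩ := hB y
          refine (abs_add_three _ _ _).trans ?_
          rw [abs_mul, abs_mul, abs_mul, abs_mul, abs_two]
          have i1 := mul_le_mul_of_nonneg_right b3 (abs_nonneg (r (x,y)))
          have i2 := mul_le_mul_of_nonneg_right b2 (abs_nonneg (pd ey r (x,y)))
          have i3 := mul_le_mul_of_nonneg_right b1 (abs_nonneg (pd ey (pd ey r) (x,y)))
          have j1 : 0 ≤ B * |r (x,y)| := by positivity
          have j3 : 0 ≤ B * |pd ey (pd ey r) (x,y)| := by positivity
          dsimp only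
          nlinarith
        · change c3 * _ ≤ _
          rw [Fin.sum_univ_three]
          simp only [Matrix.cons_val]
          refine mul_le_mul_right (add_le_add (add_le_add ?_ ?_) ?_) c3
          · exact sl_one_sub_Tav2 hp hw hk0 y
          · rw [hr, rs_pd hw]
            exact (sl_one_sub_Tav0 hp (hw.pd _).cc hk0 y).trans (mul_le_mul_right (hUy y hy) _)
          · rw [hr, rs_pd hw, rs_pd (hw.pd _)]
            exact sl_one_sub_Tav0 hp ((hw.pd _).pd _).cc hk0 y
    have h5 : (∫⁻ y in thin, sl p (pd (ex k) (Tav (ex k) ε⁻¹ (pd ey w))) y) ≤ ∫⁻ y in fat, ENNReal.ofReal ε ^ p * 2 ^ p * (ENNReal.ofReal (5/2) ^ p * sl p (Uy w) y) := by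
      have hsub : thin ⊆ fat := Set.Icc_subset_Icc (by norm_num) (by norm_num)
      refine (setLIntegral_mono' measurableSet_Icc fun y hy => ?_).trans (lintegral_mono_set hsub)
      refine (sl_pd_Tav hp (hw.pd _) hk0 (inv_pos.2 hε) y).trans ?_
      rw [inv_inv]
      gcongr
      exact hUy y (hsub hy)
    refine (lintegral_mono fun y => h0 y).trans ?_
    rw [lintegral_const_mul' _ _ t2, lintegral_add_left (sl_meas (hTs.pd _).cc.meas)]
    refine (mul_le_mul_right (add_le_add h5 (h2.trans (h1.trans (mul_le_mul_right (add_le_add (mul_le_mul_right h3 _) (mul_le_mul_right h4 _)) C)))) _).trans ?_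
    rw [← lintegral_const_mul' _ _ tei, ← lintegral_const_mul' _ _ te, ← lintegral_add_left (by fun_prop), ← lintegral_const_mul' _ _ hC, ← lintegral_add_left (by fun_prop), ← lintegral_const_mul' _ _ t2]
    refine lintegral_mono fun y => ?_
    dsimp only
    rw [hC4, hC5]
    set a1 := sl p (Uy w) y
    set a2 := sl p (pd ey (pd ey w)) y
    set a3 := sl p (pd (ex k) (pd (ex k) w)) y
    set e1 := ENNReal.ofReal ε ^ p
    set e2 := ENNReal.ofReal ε⁻¹ ^ p
    set e3 := ENNReal.ofReal (ε⁻¹^2) ^ p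
    set s5 := ENNReal.ofReal (5/2) ^ p
    set sB := ENNReal.ofReal B ^ p
    set w1 : ENNReal := 2 ^ (p-1)
    set w2 : ENNReal := 2 ^ p
    clear_value a1 a2 a3 e1 e2 e3 s5 sB w1 w2 C0 c3
    have : w1 * (w2 * s5 + C * (c3 * (C0 * s5 + C0))) * e1 * (a1 + a2) + w1 * (C * (e2 * (sB * C0) + e1 * (c3 * (e3 * w2)))) * a3 = 
      w1 * (e1 * w2 * (s5 * a1) + C * (e2 * (sB * C0 * a3) + e1 * (c3 * (e3 * w2 * a3 + C0 * (s5 * a1) + C0 * a2)))) + (w1 * e1 * (w2 * s5 + C * (c3 * (C0 * s5))) * a2 + w1 * e1 * (C * (c3 * C0)) * a1) := by ring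
    rw [this]
    exact le_self_add
  have mU := sl_meas (p := p) (Uy_meas hu)
  have mA := sl_meas (p := p) ((hu.pd (ex k)).pd (ex k)).cc.meas
  have mYY := sl_meas (p := p) ((hu.pd ey).pd ey).cc.meas
  have := layerU m (sl_meas ((hu.pd ey).pd (ex k)).cc.meas) (A1 := fun y => C4 * ENNReal.ofReal ε ^ p * (sl p (Uy u) y + sl p (pd ey (pd ey u)) y) + C5 * sl p (pd (ex k) (pd (ex k) u)) y) (by fun_prop) (by
    intro R hR
    obtain ⟨s0, st⟩ := scf_ne (N := N) p0 hR
    refine ⟨_, s0, st, ?_⟩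
    have := unit (dil R u) (hu.dil hR)
    simp only [sl_pd_dil p0 hR hu, sl_Uy_dil p0 hR hu] at this
    refine this.trans (le_of_eq ?_)
    congr 1; funext y; ring)
  rw [J_add m (by fun_prop), J_const_mul m _ (by finiteness), J_const_mul m _ (by finiteness), J_add m mU] at this
  refine this.trans (le_of_eq ?_)
  ring

end

section
variable {N : ℕ}

/-! ### Hardy inequality for the drift term, and finiteness -/

def Bop (κ : ℝ) (u : Pt N → ℝ) (z : Pt N) : ℝ := pd ey (pd ey u) z + κ / z.2 * pd ey u z

lemma Bop_meas {u : Pt N → ℝ} (hu : Sm u) (κ : ℝ) : Measurable (Bop κ u) := by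
  have h1 := ((hu.pd ey).pd ey).cc.meas
  have h2 := (hu.pd ey).cc.meas
  have h3 : Measurable fun z : Pt N => κ / z.2 := by fun_prop
  exact h1.add (h3.mul h2)

lemma hasDeriv_y {w : Pt N → ℝ} (hw : Sm w) (x : Fin N → ℝ) (y : ℝ) : HasDerivAt (fun ρ : ℝ => w (x, ρ)) (pd ey w (x, y)) y := by
  have := hasDeriv_line hw (x, 0) ey y
  simpa [ey] using this

lemma hardy_pt {u : Pt N → ℝ} (hu : Bc u) (κ : ℝ) (x : Fin N → ℝ) {y : ℝ} (hy : 0 < y) :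
    ‖Uy u (x, y)‖ₑ ≤ Hd κ (fun ρ => ‖Bop κ u (x, ρ)‖ₑ) y := by
  obtain ⟨hus, δ, hδ, hb⟩ := hu
  rcases le_or_gt y δ with hyd | hyd
  · have : Uy u (x, y) = 0 := by simp [Uy, hb (x, y) hy.le hyd]
    rw [this]; simp
  have hφ : ∀ ρ ∈ Set.uIcc δ y, HasDerivAt (fun ρ => ρ ^ κ * pd ey u (x, ρ)) (ρ ^ κ * Bop κ u (x, ρ)) ρ := by
    intro ρ hρ
    rw [Set.uIcc_of_le hyd.le] at hρ
    have h0 : 0 < ρ := hδ.trans_le hρ.1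
    have h1 := (Real.hasDerivAt_rpow_const (x := ρ) (p := κ) (Or.inl h0.ne')).mul (hasDeriv_y (hus.pd ey) x ρ)
    refine h1.congr_deriv ?_
    unfold Bop
    rw [Real.rpow_sub_one h0.ne']
    dsimp only
    field_simp
    ring
  have hc : ContinuousOn (fun ρ : ℝ => ρ ^ κ * Bop κ u (x, ρ)) (Set.uIcc δ y) := by
    rw [Set.uIcc_of_le hyd.le]
    have hne : ∀ ρ ∈ Set.Icc δ y, ρ ≠ 0 := fun ρ hρ => (hδ.trans_le hρ.1).ne'
    have c1 : Continuous fun ρ : ℝ => pd ey (pd ey u) (x, ρ) := ((hus.pd ey).pd ey).cc.1.comp (by fun_prop)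
    have c2 : Continuous fun ρ : ℝ => pd ey u (x, ρ) := (hus.pd ey).cc.1.comp (by fun_prop)
    apply ContinuousOn.mul
    · exact continuousOn_id.rpow_const fun ρ hρ => Or.inl (hne ρ hρ)
    · exact c1.continuousOn.add ((continuousOn_const.div continuousOn_id hne).mul c2.continuousOn)
  have hI := intervalIntegral.integral_eq_sub_of_hasDerivAt hφ hc.intervalIntegrable
  rw [hb (x, δ) hδ.le le_rfl, mul_zero, sub_zero, intervalIntegral.integral_of_le hyd.le] at hI
  have h2 : ‖y ^ κ * pd ey u (x, y)‖ₑ ≤ ∫⁻ ρ in Set.Ioc 0 y, ENNReal.ofReal (ρ ^ κ) * ‖Bop κ u (x, ρ)‖ₑ := by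
    rw [← hI]
    refine (enorm_integral_le_lintegral_enorm _).trans ((lintegral_mono_set (Set.Ioc_subset_Ioc_left hδ.le)).trans (le_of_eq ?_))
    refine setLIntegral_congr_fun measurableSet_Ioc fun ρ hρ => ?_
    rw [enorm_mul, Real.enorm_eq_ofReal (Real.rpow_nonneg hρ.1.le _)]
  rw [Hd_conv κ _ hy] at h2
  have e : Uy u (x, y) = y ^ (-(κ+1)) * (y ^ κ * pd ey u (x, y)) := by
    unfold Uy
    rw [← mul_assoc, ← Real.rpow_add hy, show -(κ+1)+κ = -1 by ring, Real.rpow_neg_one]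
    dsimp only
    field_simp
  rw [e, enorm_mul, Real.enorm_eq_ofReal (by positivity)]
  refine (mul_le_mul_right h2 _).trans (le_of_eq ?_)
  rw [← mul_assoc, ← ENNReal.ofReal_mul (by positivity), ← Real.rpow_add hy]
  simp

lemma J_swap {p : ℝ} (m : ℝ) {g : Pt N → ℝ} (hg : Measurable g) :
    J m (sl p g) = ∫⁻ x : Fin N → ℝ, J m (fun y => ‖g (x, y)‖ₑ ^ p) := by
  unfold J sl
  have e1 : ∀ y : ℝ, ENNReal.ofReal (y ^ m) * ∫⁻ x : Fin N → ℝ, ‖g (x, y)‖ₑ ^ p = ∫⁻ x : Fin N → ℝ, ENNReal.ofReal (y ^ m) * ‖g (x, y)‖ₑ ^ p := by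
    intro y; rw [lintegral_const_mul' _ _ (by simp)]
  simp_rw [e1]
  rw [lintegral_lintegral_swap]
  apply Measurable.aemeasurable
  have : Measurable fun w : ℝ × (Fin N → ℝ) => g (w.2, w.1) := hg.comp (by fun_prop)
  unfold Function.uncurry
  fun_prop

lemma hardyU {p m κ : ℝ} (hp : 1 < p) (h : (m+1)/p < κ + 1) : ∃ C : ENNReal, C ≠ ⊤ ∧ ∀ u : Pt N → ℝ, Bc u →
    J m (sl p (Uy u)) ≤ C * J m (sl p (Bop κ u)) := by
  obtain ⟨C, hC, H⟩ := Hardy hp h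
  refine ⟨C, hC, fun u hu => ?_⟩
  have hB := Bop_meas hu.1 κ
  rw [J_swap m (Uy_meas hu.1), J_swap m hB, ← lintegral_const_mul' _ _ hC]
  refine lintegral_mono fun x => ?_
  refine le_trans (J_mono m fun y hy => ENNReal.rpow_le_rpow (hardy_pt hu κ x hy) (by linarith)) ?_
  apply H
  have : Measurable fun ρ : ℝ => Bop κ u (x, ρ) := hB.comp (by fun_prop)
  fun_prop

lemma J_fin {p m : ℝ} (hp : 0 < p) (hm : -1 < m) {g : Pt N → ℝ} (hg : Cc g) : J m (sl p g) ≠ ⊤ := by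
  obtain ⟨R, hR0, hR⟩ := HasCompactSupport.rad hg.2
  obtain ⟨M, hM⟩ := hg.2.exists_bound_of_continuous hg.1
  set V : ENNReal := ENNReal.ofReal M ^ p * volume (Metric.closedBall (0 : Fin N → ℝ) R) with hV
  have hVt : V ≠ ⊤ := ENNReal.mul_ne_top (ENNReal.rpow_ne_top_of_nonneg hp.le ENNReal.ofReal_ne_top) measure_closedBall_lt_top.ne
  have h1 : ∀ y, sl p g y ≤ V := by
    intro y
    unfold sl
    rw [hV, ← setLIntegral_const, ← lintegral_indicator measurableSet_closedBall]
    refine lintegral_mono fun x => ?_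
    by_cases hx : x ∈ Metric.closedBall (0 : Fin N → ℝ) R
    · rw [Set.indicator_of_mem hx]
      apply ENNReal.rpow_le_rpow _ hp.le
      rw [← ofReal_norm]
      exact ENNReal.ofReal_le_ofReal (hM _)
    · have : g (x, y) = 0 := by
        apply hR
        have : R < ‖x‖ := by simpa using hx
        exact this.trans_le (norm_fst_le (x, y))
      rw [this]; simp [hp]
  have h2 : ∀ y, R < y → sl p g y = 0 := by
    intro y hy
    unfold sl
    have : ∀ x : Fin N → ℝ, g (x, y) = 0 := fun x => hR _ ((hy.trans_le (le_abs_self y)).trans_le (norm_snd_le (x, y)))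
    simp [this, hp]
  have h3 : J m (sl p g) ≤ V * ∫⁻ y in Set.Ioc 0 R, ENNReal.ofReal (y ^ m) := by
    unfold J
    rw [← lintegral_const_mul' _ _ hVt, ← lintegral_indicator measurableSet_Ioi, ← lintegral_indicator measurableSet_Ioc]
    refine lintegral_mono fun y => ?_
    by_cases hy : y ∈ Set.Ioc 0 R
    · rw [Set.indicator_of_mem hy, Set.indicator_of_mem (show y ∈ Set.Ioi 0 from hy.1), mul_comm]
      gcongr
      exact h1 y
    · by_cases hy2 : y ∈ Set.Ioi (0:ℝ)
      · have : R < y := by by_contra hc; exact hy ⟨hy2, not_lt.1 hc⟩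
        rw [Set.indicator_of_mem hy2, h2 y this]; simp
      · rw [Set.indicator_of_notMem hy2]; simp
  have h4 : (∫⁻ y in Set.Ioc 0 R, ENNReal.ofReal (y ^ m)) ≠ ⊤ := by
    have h1 : IntegrableOn (fun s : ℝ => s ^ m) (Set.Ioc 0 R) := 
      (intervalIntegrable_iff_integrableOn_Ioc_of_le hR0.le).1 (intervalIntegral.intervalIntegrable_rpow' hm)
    exact h1.lintegral_lt_top.ne
  exact ne_top_of_le_ne_top (ENNReal.mul_ne_top hVt h4) h3

lemma absorb {X B h : ENNReal} (hX : X ≠ ⊤) (hh : h ≤ 1/2) (H : X ≤ h * X + B) : X ≤ 2 * B := by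
  have h1 : X ≤ X / 2 + B := H.trans (add_le_add ((mul_le_mul_left hh X).trans (by rw [mul_comm, mul_one_div])) le_rfl)
  have h2 : X / 2 ≤ B := by
    have h3 : X / 2 + X / 2 ≤ X / 2 + B := by rw [ENNReal.add_halves]; exact h1
    exact (ENNReal.add_le_add_iff_left (ENNReal.div_ne_top hX (by simp))).1 h3
  calc X = 2 * (X / 2) := by rw [ENNReal.mul_div_cancel (by simp) (by simp)]
    _ ≤ _ := mul_le_mul_right h2 _

lemma J_dom {p m : ℝ} (hp : 1 ≤ p) {ι : Type} [Fintype ι] {F : Pt N → ℝ} {f : ι → Pt N → ℝ} (hf : ∀ i, Measurable (f i)) {c : ℝ} (hc : 0 ≤ c)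
    (h : ∀ z : Pt N, 0 < z.2 → |F z| ≤ c * ∑ i, |f i z|) :
    J m (sl p F) ≤ ENNReal.ofReal c ^ p * (Fintype.card ι : ENNReal) ^ (p-1) * ∑ i, J m (sl p (f i)) := by
  have h1 : J m (sl p F) ≤ J m (fun y => ENNReal.ofReal c ^ p * (Fintype.card ι : ENNReal) ^ (p-1) * ∑ i, sl p (f i) y) :=
    J_mono m fun y hy => sl_dom hp hf hc fun x => h (x, y) hy
  refine h1.trans (le_of_eq ?_)
  rw [J_const_mul m _ (dom_ne hp c _)]
  congr 1
  unfold J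
  rw [← lintegral_finsetSum _ (fun i _ => by have := sl_meas (p := p) (hf i); fun_prop)]
  simp_rw [Finset.mul_sum]

end

section
variable {N : ℕ}

/-! ### The normalized estimate -/

lemma pd_Dv (a : Fin N → ℝ) (w : Pt N → ℝ) (z : Pt N) : pd (Dv a) w z = pd ey w z + ∑ k, a k * pd (ex k) w z := by
  have : (Dv a : Pt N) = ey + ∑ k, a k • ex k := by
    ext i
    · simp [Dv, ey, ex, Prod.fst_sum, Finset.sum_apply, Pi.single_apply]
    · simp [Dv, ey, ex, Prod.snd_sum]
  rw [this]
  unfold pd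
  simp [map_add, map_sum]

lemma pd_ex_Dv {u : Pt N → ℝ} (hu : Sm u) (a : Fin N → ℝ) (k : Fin N) (z : Pt N) :
    pd (ex k) (pd (Dv a) u) z = pd (ex k) (pd ey u) z + ∑ j, a j * pd (ex j) (pd (ex k) u) z := by
  rw [pd_comm hu, pd_Dv, pd_comm hu ey]

lemma Bop_eq {u : Pt N → ℝ} (hu : Sm u) (a : Fin N → ℝ) (κ : ℝ) (z : Pt N) :
    Bop κ u z = Lop a κ u z - (∑ k, pd (ex k) (pd (ex k) u) z) - 2 * (∑ k, a k * pd (ex k) (pd ey u) z) - ∑ k, ∑ j, a k * (a j * pd (ex j) (pd (ex k) u) z) := by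
  have h1 : pd (Dv a) (pd (Dv a) u) z = pd ey (pd ey u) z + 2 * (∑ k, a k * pd (ex k) (pd ey u) z) + ∑ k, ∑ j, a k * (a j * pd (ex j) (pd (ex k) u) z) := by
    rw [pd_Dv a (pd (Dv a) u), pd_comm hu ey, pd_Dv]
    simp_rw [pd_ex_Dv hu, mul_add, Finset.sum_add_distrib, Finset.mul_sum]
    simp_rw [← Finset.mul_sum]
    ring
  unfold Bop Lop Gop
  rw [h1]; ring

lemma normal_est {p m : ℝ} (hp : 1 < p) (hm : -1 < m) (a : Fin N → ℝ) {κ : ℝ} (h : (m+1)/p < κ + 1) :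
    ∃ C : ENNReal, C ≠ ⊤ ∧ ∀ u : Pt N → ℝ, Bc u →
    (∑ j, ∑ k, J m (sl p (pd (ex j) (pd (ex k) u)))) + (∑ k, J m (sl p (pd (ex k) (pd ey u)))) + J m (sl p (pd ey (pd ey u))) + J m (sl p (Uy u)) ≤ C * J m (sl p (Lop a κ u)) := by
  have p0 : 0 < p := by linarith
  obtain ⟨c1, hc1, H1⟩ := F1 (N := N) hp m
  obtain ⟨c2, hc2, H2⟩ := F2 (N := N) hp m
  obtain ⟨c3, hc3, H3⟩ := hardyU (N := N) hp h
  set M : ℝ := 1 + ∑ k, |a k| with hM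
  have hM0 : 1 ≤ M := by
    have : 0 ≤ ∑ k, |a k| := Finset.sum_nonneg fun _ _ => abs_nonneg _
    linarith
  have haM : ∀ k, |a k| ≤ M := by
    intro k
    have := Finset.single_le_sum (f := fun k => |a k|) (fun i _ => abs_nonneg _) (Finset.mem_univ k)
    linarith
  set b1 : ENNReal := ENNReal.ofReal ((1+M)^2) ^ p * ((Fintype.card (Option (Fin N ⊕ Fin N × Fin N)) : ℕ) : ENNReal) ^ (p-1) with hb1
  have hb1t : b1 ≠ ⊤ := dom_ne hp.le _ _
  set b2 : ENNReal := ENNReal.ofReal (1+|κ|) ^ p * ((Fintype.card (Fin 2) : ℕ) : ENNReal) ^ (p-1) with hb2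
  have hb2t : b2 ≠ ⊤ := dom_ne hp.le _ _
  set b3 : ENNReal := ENNReal.ofReal M ^ p * ((Fintype.card (Option (Fin N)) : ℕ) : ENNReal) ^ (p-1) with hb3
  have hb3t : b3 ≠ ⊤ := dom_ne hp.le _ _
  -- basic estimates, in terms of sums
  have S1 : ∀ u : Pt N → ℝ, Sm u → (∑ j, ∑ k, J m (sl p (pd (ex j) (pd (ex k) u)))) ≤ c1 * (2 * N) * ∑ k, J m (sl p (pd (ex k) (pd (ex k) u))) := by
    intro u hu
    calc _ ≤ ∑ j : Fin N, ∑ k : Fin N, c1 * (J m (sl p (pd (ex j) (pd (ex j) u))) + J m (sl p (pd (ex k) (pd (ex k) u)))) :=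
          Finset.sum_le_sum fun j _ => Finset.sum_le_sum fun k _ => H1 u j k hu
      _ = _ := by
          simp_rw [← Finset.mul_sum, Finset.sum_add_distrib]
          simp [← Finset.mul_sum]
          ring
  have S2 : ∀ u : Pt N → ℝ, Bc u → J m (sl p (Bop κ u)) ≤ b1 * (J m (sl p (Lop a κ u)) + ((∑ k, J m (sl p (pd (ex k) (pd ey u)))) + ∑ j, ∑ k, J m (sl p (pd (ex j) (pd (ex k) u))))) := by
    intro u hu
    have hus := hu.1
    have := J_dom (m := m) hp.le (F := Bop κ u) (f := fun o : Option (Fin N ⊕ Fin N × Fin N) => o.elim (Lop a κ u) (Sum.elim (fun k => pd (ex k) (pd ey u)) (fun jk => pd (ex jk.1) (pd (ex jk.2) u)))) (c := (1+M)^2) ?_ (by positivity) ?_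
    · rw [Fintype.sum_option, Fintype.sum_sum_type, Fintype.sum_prod_type] at this
      exact this
    · rintro (_ | _ | _)
      · exact Lop_meas hus _ _
      · exact ((hus.pd _).pd _).cc.meas
      · exact ((hus.pd _).pd _).cc.meas
    · intro z hz
      rw [Fintype.sum_option, Fintype.sum_sum_type, Fintype.sum_prod_type, Bop_eq hus a]
      simp only [Option.elim, Sum.elim_inl, Sum.elim_inr]
      have i1 : |∑ k, pd (ex k) (pd (ex k) u) z| ≤ ∑ j, ∑ k, |pd (ex j) (pd (ex k) u) z| := by
        refine (Finset.abs_sum_le_sum_abs _ _).trans (Finset.sum_le_sum fun j _ => ?_)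
        exact Finset.single_le_sum (f := fun k => |pd (ex j) (pd (ex k) u) z|) (fun i _ => abs_nonneg _) (Finset.mem_univ j)
      have i2 : |∑ k, a k * pd (ex k) (pd ey u) z| ≤ M * ∑ k, |pd (ex k) (pd ey u) z| := by
        rw [Finset.mul_sum]
        refine (Finset.abs_sum_le_sum_abs _ _).trans (Finset.sum_le_sum fun j _ => ?_)
        rw [abs_mul]; gcongr; exact haM j
      have i3 : |∑ k, ∑ j, a k * (a j * pd (ex j) (pd (ex k) u) z)| ≤ M * (M * ∑ j, ∑ k, |pd (ex j) (pd (ex k) u) z|) := by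
        rw [Finset.sum_comm (f := fun j k => |pd (ex j) (pd (ex k) u) z|)]
        simp_rw [Finset.mul_sum]
        refine (Finset.abs_sum_le_sum_abs _ _).trans (Finset.sum_le_sum fun k _ => ?_)
        refine (Finset.abs_sum_le_sum_abs _ _).trans (Finset.sum_le_sum fun j _ => ?_)
        rw [abs_mul, abs_mul]; gcongr
        · exact haM k
        · exact haM j
      have n1 : 0 ≤ ∑ k, |pd (ex k) (pd ey u) z| := Finset.sum_nonneg fun _ _ => abs_nonneg _
      have n2 : 0 ≤ ∑ j, ∑ k, |pd (ex j) (pd (ex k) u) z| := Finset.sum_nonneg fun _ _ => Finset.sum_nonneg fun _ _ => abs_nonneg _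
      have n3 := abs_nonneg (Lop a κ u z)
      set T1 := ∑ k, pd (ex k) (pd (ex k) u) z
      set T2 := ∑ k, a k * pd (ex k) (pd ey u) z
      set T3 := ∑ k, ∑ j, a k * (a j * pd (ex j) (pd (ex k) u) z)
      set Z1 := ∑ k, |pd (ex k) (pd ey u) z|
      set Z2 := ∑ j, ∑ k, |pd (ex j) (pd (ex k) u) z|
      set L := Lop a κ u z
      have : |L - T1 - 2 * T2 - T3| ≤ |L| + |T1| + 2 * |T2| + |T3| := by
        have := abs_sub (L - T1 - 2 * T2) T3
        have := abs_sub (L - T1) (2 * T2)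
        have := abs_sub L T1
        have : |2 * T2| = 2 * |T2| := by rw [abs_mul, abs_two]
        linarith
      have q1 : 0 ≤ M * Z2 := by positivity
      have q2 : 0 ≤ M * |L| := by positivity
      have q3 : 0 ≤ M * (M * |L|) := by positivity
      have q4 : 0 ≤ M * (M * Z1) := by positivity
      nlinarith
  have S3 : ∀ u : Pt N → ℝ, Bc u → J m (sl p (pd ey (pd ey u))) ≤ b2 * (1 + c3) * J m (sl p (Bop κ u)) := by
    intro u hu
    have hus := hu.1
    have := J_dom (m := m) hp.le (F := pd ey (pd ey u)) (f := ![Bop κ u, Uy u]) (c := 1+|κ|) ?_ (by positivity) ?_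
    · rw [Fin.sum_univ_two] at this
      simp only [Matrix.cons_val] at this
      refine this.trans ?_
      change b2 * _ ≤ _
      rw [mul_assoc b2, add_mul, one_mul]
      gcongr
      exact H3 u hu
    · intro i
      fin_cases i
      · exact Bop_meas hus _
      · exact Uy_meas hus
    · intro z hz
      rw [Fin.sum_univ_two]
      simp only [Matrix.cons_val]
      have e : pd ey (pd ey u) z = Bop κ u z - κ * Uy u z := by
        unfold Bop Uy; field_simp; ring
      rw [e]
      have h1 := abs_sub (Bop κ u z) (κ * Uy u z)
      rw [abs_mul] at h1
      have : 0 ≤ |κ| * |Bop κ u z| := by positivity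
      have := abs_nonneg (Uy u z)
      nlinarith
  have S4 : ∀ (u : Pt N → ℝ) (k : Fin N), Bc u → J m (sl p (pd (ex k) (pd (Dv a) u))) ≤ b3 * ((∑ k, J m (sl p (pd (ex k) (pd ey u)))) + ∑ j, ∑ k, J m (sl p (pd (ex j) (pd (ex k) u)))) := by
    intro u k hu
    have hus := hu.1
    have := J_dom (m := m) hp.le (F := pd (ex k) (pd (Dv a) u)) (f := fun o : Option (Fin N) => o.elim (pd (ex k) (pd ey u)) (fun j => pd (ex j) (pd (ex k) u))) (c := M) ?_ (by positivity) ?_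
    · rw [Fintype.sum_option] at this
      refine this.trans ?_
      change b3 * _ ≤ _
      simp only [Option.elim]
      refine mul_le_mul_right (add_le_add ?_ (Finset.sum_le_sum fun j _ => ?_)) _
      · exact Finset.single_le_sum (f := fun k => J m (sl p (pd (ex k) (pd ey u)))) (fun i _ => bot_le) (Finset.mem_univ k)
      · exact Finset.single_le_sum (f := fun k => J m (sl p (pd (ex j) (pd (ex k) u)))) (fun i _ => bot_le) (Finset.mem_univ k)
    · rintro (_ | _)
      · exact ((hus.pd _).pd _).cc.meas
      · exact ((hus.pd _).pd _).cc.meas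
    · intro z hz
      rw [Fintype.sum_option, pd_ex_Dv hus]
      simp only [Option.elim]
      refine (abs_add_le _ _).trans ?_
      rw [mul_add, Finset.mul_sum]
      refine add_le_add (le_mul_of_one_le_left (abs_nonneg _) hM0) ?_
      refine (Finset.abs_sum_le_sum_abs _ _).trans (Finset.sum_le_sum fun j _ => ?_)
      rw [abs_mul]; gcongr; exact haM j
  -- absorb the mixed derivatives
  have hNt : (N : ENNReal) ≠ ⊤ := ENNReal.natCast_ne_top N
  obtain ⟨ε, he0, -, he⟩ := small_param (c := N * c2 * (c3 + b2 * (1 + c3)) * b1) (η := 1/2) (s := p) (by finiteness) (by simp) p0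
  obtain ⟨c5, hc5, H5⟩ := H2 ε he0
  have fin : ∀ u : Pt N → ℝ, Bc u → ∀ v w : Pt N, J m (sl p (pd v (pd w u))) ≠ ⊤ := fun u hu v w => J_fin p0 hm ((hu.1.pd _).pd _).cc
  set c6 : ENNReal := 2 * (1 + c1 * (2 * N) + c5) with hc6
  have hc6t : c6 ≠ ⊤ := by finiteness
  have S5 : ∀ u : Pt N → ℝ, Bc u → (∑ k, J m (sl p (pd (ex k) (pd ey u)))) ≤ c6 * (J m (sl p (Lop a κ u)) + ∑ k, J m (sl p (pd (ex k) (pd (ex k) u)))) := by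
    intro u hu
    set Y := ∑ k, J m (sl p (pd (ex k) (pd ey u))) with hY
    set A := ∑ k, J m (sl p (pd (ex k) (pd (ex k) u))) with hA
    set f := J m (sl p (Lop a κ u)) with hf
    have hYt : Y ≠ ⊤ := ENNReal.sum_ne_top.2 fun k _ => fin u hu _ _
    have h1 : Y ≤ ∑ k : Fin N, (c2 * ENNReal.ofReal ε ^ p * ((c3 + b2 * (1 + c3)) * (b1 * (f + (Y + c1 * (2 * N) * A)))) + c5 * J m (sl p (pd (ex k) (pd (ex k) u)))) := by
      refine Finset.sum_le_sum fun k _ => (H5 u k hu.1).trans ?_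
      refine add_le_add (mul_le_mul_right ?_ _) le_rfl
      rw [add_mul]
      have hB := (S2 u hu).trans (mul_le_mul_right (add_le_add le_rfl (add_le_add le_rfl (S1 u hu.1))) b1)
      exact add_le_add ((H3 u hu).trans (mul_le_mul_right hB _)) ((S3 u hu).trans (mul_le_mul_right hB _))
    have h2 : Y ≤ (N * c2 * (c3 + b2 * (1 + c3)) * b1 * ENNReal.ofReal ε ^ p) * Y + ((N * c2 * (c3 + b2 * (1 + c3)) * b1 * ENNReal.ofReal ε ^ p) * (f + c1 * (2 * N) * A) + c5 * A) := by
      refine h1.trans (le_of_eq ?_)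
      rw [Finset.sum_add_distrib, show (∑ k : Fin N, c5 * J m (sl p (pd (ex k) (pd (ex k) u)))) = c5 * A by rw [← Finset.mul_sum], Finset.sum_const, Finset.card_univ, Fintype.card_fin, nsmul_eq_mul]
      ring
    refine (absorb hYt he h2).trans ?_
    have h3 : (1:ENNReal)/2 ≤ 1 := by simp
    calc _ ≤ 2 * (1 * (f + c1 * (2 * N) * A) + c5 * A) := by gcongr; exact he.trans h3
      _ ≤ 2 * (1 * (f + c1 * (2 * N) * A) + c5 * A) + 2 * ((c1 * (2 * N) + c5) * f + A) := le_self_add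
      _ = c6 * (f + A) - 0 := by rw [hc6, tsub_zero]; ring
      _ ≤ _ := by simp
  -- absorb the tangential derivatives
  set c7 : ENNReal := c6 + b3 * (c6 + c1 * (2 * N)) + 1 with hc7
  have hc7t : c7 ≠ ⊤ := by finiteness
  obtain ⟨η, hη0, hη⟩ : ∃ η : ENNReal, η ≠ 0 ∧ N * η * c7 ≤ 1/2 := by
    obtain ⟨η, h1, -, h2⟩ := small_param (c := N * c7) (η := 1/2) (s := 1) (by finiteness) (by simp) one_pos
    refine ⟨ENNReal.ofReal η, by simpa using h1, ?_⟩
    rw [ENNReal.rpow_one] at h2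
    calc _ = _ := by ring
      _ ≤ _ := h2
  obtain ⟨c8, hc8, H8⟩ := LemE (N := N) hp hm a h hη0
  set c9 : ENNReal := 2 * (1 + N * c8) with hc9
  have S6 : ∀ u : Pt N → ℝ, Bc u → (∑ k, J m (sl p (pd (ex k) (pd (ex k) u)))) ≤ c9 * J m (sl p (Lop a κ u)) := by
    intro u hu
    have s5 := S5 u hu
    have s1 := S1 u hu.1
    set Y := ∑ k, J m (sl p (pd (ex k) (pd ey u))) with hY
    set A := ∑ k, J m (sl p (pd (ex k) (pd (ex k) u))) with hA
    set f := J m (sl p (Lop a κ u)) with hf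
    have hAt : A ≠ ⊤ := ENNReal.sum_ne_top.2 fun k _ => fin u hu _ _
    have h1 : A ≤ ∑ k : Fin N, (η * (c7 * (f + A)) + c8 * f) := by
      refine Finset.sum_le_sum fun k _ => (H8 u k hu).trans ?_
      refine add_le_add (mul_le_mul_right ?_ _) le_rfl
      have g1 : J m (sl p (pd (ex k) (pd ey u))) ≤ c6 * (f + A) :=
        (Finset.single_le_sum (f := fun k => J m (sl p (pd (ex k) (pd ey u)))) (fun i _ => bot_le) (Finset.mem_univ k)).trans s5
      have g2 : J m (sl p (pd (ex k) (pd (ex k) u))) ≤ A :=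
        Finset.single_le_sum (f := fun k => J m (sl p (pd (ex k) (pd (ex k) u)))) (fun i _ => bot_le) (Finset.mem_univ k)
      have g3 := (S4 u k hu).trans (mul_le_mul_right (add_le_add s5 s1) _)
      calc _ ≤ c6 * (f + A) + b3 * (c6 * (f + A) + c1 * (2 * N) * A) + A := add_le_add (add_le_add g1 g3) g2
        _ ≤ c6 * (f + A) + b3 * (c6 * (f + A) + c1 * (2 * N) * (f + A)) + (f + A) := by
            gcongr <;> exact le_add_self
        _ = _ := by rw [hc7]; ring
    have h2 : A ≤ (N * η * c7) * A + ((N * η * c7) * f + N * c8 * f) := by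
      refine h1.trans (le_of_eq ?_)
      simp
      ring
    refine (absorb hAt hη h2).trans ?_
    calc _ ≤ 2 * (1 * f + N * c8 * f) := by gcongr; exact hη.trans (by simp)
      _ = _ := by rw [hc9]; ring
  have hc9t : c9 ≠ ⊤ := by finiteness
  set K1 : ENNReal := c6 * (1 + c9) with hK1
  set K2 : ENNReal := c1 * (2 * N) * c9 with hK2
  set K3 : ENNReal := b1 * (1 + (K1 + K2)) with hK3
  refine ⟨K2 + K1 + b2 * (1 + c3) * K3 + c3 * K3, by finiteness, fun u hu => ?_⟩
  have s6 := S6 u hu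
  have y1 : (∑ k, J m (sl p (pd (ex k) (pd ey u)))) ≤ K1 * J m (sl p (Lop a κ u)) := by
    refine (S5 u hu).trans ((mul_le_mul_right (add_le_add le_rfl s6) _).trans (le_of_eq ?_))
    rw [hK1]; ring
  have y2 : (∑ j, ∑ k, J m (sl p (pd (ex j) (pd (ex k) u)))) ≤ K2 * J m (sl p (Lop a κ u)) := by
    refine (S1 u hu.1).trans ((mul_le_mul_right s6 _).trans (le_of_eq ?_))
    rw [hK2]; ring
  have y3 : J m (sl p (Bop κ u)) ≤ K3 * J m (sl p (Lop a κ u)) := by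
    refine (S2 u hu).trans ((mul_le_mul_right (add_le_add le_rfl (add_le_add y1 y2)) _).trans (le_of_eq ?_))
    rw [hK3]; ring
  have y4 := (S3 u hu).trans (mul_le_mul_right y3 _)
  have y5 := (H3 u hu).trans (mul_le_mul_right y3 _)
  refine (add_le_add (add_le_add (add_le_add y2 y1) y4) y5).trans (le_of_eq ?_)
  ring

end

section
variable {N : ℕ}

lemma pd_exp (v : Pt N) (w : Pt N → ℝ) (z : Pt N) : pd v w z = (∑ k, v.1 k * pd (ex k) w z) + v.2 * pd ey w z := by
  have : v = (∑ k, v.1 k • ex k) + v.2 • ey := by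
    ext i
    · simp [ey, ex, Prod.fst_sum, Finset.sum_apply, Pi.single_apply]
    · simp [ey, ex, Prod.snd_sum]
  conv_lhs => rw [this]
  unfold pd
  simp [map_add, map_sum]

lemma hess_exp {u : Pt N → ℝ} (hu : Sm u) (v w : Pt N) (z : Pt N) :
    pd v (pd w u) z = (∑ i, ∑ j, v.1 i * w.1 j * pd (ex i) (pd (ex j) u) z)
      + (∑ i, (v.1 i * w.2 + v.2 * w.1 i) * pd (ex i) (pd ey u) z) + v.2 * w.2 * pd ey (pd ey u) z := by
  have h : ∀ a : Pt N, pd a (pd w u) z = (∑ k, w.1 k * pd a (pd (ex k) u) z) + w.2 * pd a (pd ey u) z := by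
    intro a
    rw [pd_comm hu a w, pd_exp w]
    simp_rw [pd_comm hu a]
  rw [pd_exp v]
  simp_rw [h, mul_add, add_mul, Finset.sum_add_distrib, Finset.mul_sum, pd_comm hu ey (ex _)]
  simp_rw [← mul_assoc]
  ring

lemma dir_est {p : ℝ} (hp : 1 < p) (v : Pt N) : ∃ C : ENNReal, C ≠ ⊤ ∧ ∀ (m : ℝ) (g : Pt N → ℝ), Sm g →
    J m (sl p (pd v g)) ≤ C * ((∑ k, J m (sl p (pd (ex k) g))) + J m (sl p (pd ey g))) := by
  set M : ℝ := |v.2| + ∑ k, |v.1 k| with hM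
  have hs : 0 ≤ ∑ k, |v.1 k| := Finset.sum_nonneg fun _ _ => abs_nonneg _
  have haM : ∀ k, |v.1 k| ≤ M := by
    intro k
    have := Finset.single_le_sum (f := fun k => |v.1 k|) (fun i _ => abs_nonneg _) (Finset.mem_univ k)
    have := abs_nonneg v.2
    linarith
  refine ⟨ENNReal.ofReal M ^ p * ((Fintype.card (Option (Fin N)) : ℕ) : ENNReal) ^ (p-1), dom_ne hp.le _ _, fun m g hg => ?_⟩
  have := J_dom (m := m) hp.le (F := pd v g) (f := fun o : Option (Fin N) => o.elim (pd ey g) fun k => pd (ex k) g) (c := M) ?_ (by positivity) ?_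
  · rw [Fintype.sum_option] at this
    rw [add_comm (∑ k, _)]
    exact this
  · intro i
    cases i
    · exact (hg.pd _).1.continuous.measurable
    · exact (hg.pd _).1.continuous.measurable
  · intro z _
    rw [Fintype.sum_option, pd_exp v, mul_add, Finset.mul_sum, add_comm (_ * _)]
    refine (abs_add_le _ _).trans (add_le_add ((Finset.abs_sum_le_sum_abs _ _).trans (Finset.sum_le_sum fun k _ => ?_)) ?_)
    · rw [abs_mul]; exact mul_le_mul_of_nonneg_right (haM k) (abs_nonneg _)
    · rw [abs_mul]; exact mul_le_mul_of_nonneg_right (by linarith) (abs_nonneg _)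

lemma hess_est {p m : ℝ} (hp : 1 < p) (hm : -1 < m) (a : Fin N → ℝ) {κ : ℝ} (h : (m+1)/p < κ + 1) (v w : Pt N) :
    ∃ C : ENNReal, C ≠ ⊤ ∧ ∀ u : Pt N → ℝ, Bc u → J m (sl p (pd v (pd w u))) ≤ C * J m (sl p (Lop a κ u)) := by
  obtain ⟨c1, hc1, H1⟩ := dir_est hp v
  obtain ⟨c2, hc2, H2⟩ := dir_est hp w
  obtain ⟨c3, hc3, H3⟩ := normal_est hp hm a h
  refine ⟨c1 * (c2 * ((2 : ENNReal) * c3)), by finiteness, fun u hu => ?_⟩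
  have hus := hu.1
  refine (H1 m _ (hus.pd w)).trans ?_
  rw [mul_assoc]
  refine mul_le_mul_right ?_ _
  simp_rw [pd_comm hus _ w]
  refine (add_le_add (Finset.sum_le_sum fun k _ => H2 m _ (hus.pd _)) (H2 m _ (hus.pd _))).trans ?_
  rw [← Finset.mul_sum, ← mul_add, mul_assoc]
  refine mul_le_mul_right ?_ _
  rw [mul_assoc]
  refine le_trans ?_ (mul_le_mul_right (H3 u hu) 2)
  simp_rw [pd_comm hus ey (ex _), Finset.sum_add_distrib]
  rw [Finset.sum_comm]
  generalize (∑ j, ∑ k, J m (sl p (pd (ex j) (pd (ex k) u)))) = A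
  generalize (∑ k, J m (sl p (pd (ex k) (pd ey u)))) = B
  generalize J m (sl p (pd ey (pd ey u))) = D
  calc A + B + (B + D) ≤ (A + B + (B + D)) + (A + D + 2 * J m (sl p (Uy u))) := le_self_add
    _ = _ := by ring

/-- the linear change of variables -/
def Tm (S : Matrix (Fin N) (Fin N) ℝ) (b : Fin N → ℝ) : Pt N →L[ℝ] Pt N :=
  LinearMap.toContinuousLinearMap
    ((S.mulVecLin.comp (LinearMap.fst ℝ _ ℝ) + (LinearMap.snd ℝ (Fin N → ℝ) ℝ).smulRight b).prod (LinearMap.snd ℝ _ ℝ))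

lemma Tm_apply (S : Matrix (Fin N) (Fin N) ℝ) (b : Fin N → ℝ) (z : Pt N) : Tm S b z = (S.mulVec z.1 + z.2 • b, z.2) := by
  simp [Tm]

lemma pd_T {g : Pt N → ℝ} (hg : Sm g) (T : Pt N →L[ℝ] Pt N) (v : Pt N) : pd v (g ∘ T) = pd (T v) g ∘ T := by
  funext z
  unfold pd
  rw [fderiv_comp z (hg.diff _) T.differentiableAt]
  simp

lemma Sm_T {g : Pt N → ℝ} (hg : Sm g) {S R : Matrix (Fin N) (Fin N) ℝ} (hR : R * S = 1) (b : Fin N → ℝ) : Sm (g ∘ Tm S b) := by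
  refine ⟨hg.1.comp (Tm S b).contDiff, ?_⟩
  refine hg.2.comp_isClosedEmbedding ?_
  have hinj : Function.Injective (Tm S b) := by
    intro z w h
    rw [Tm_apply, Tm_apply, Prod.mk.injEq] at h
    obtain ⟨h1, h2⟩ := h
    rw [h2] at h1
    have h3 := congrArg R.mulVec (add_right_cancel h1)
    rw [Matrix.mulVec_mulVec, Matrix.mulVec_mulVec, hR, Matrix.one_mulVec, Matrix.one_mulVec] at h3
    exact Prod.ext h3 h2
  exact (LinearMap.isClosedEmbedding_of_injective (f := (Tm S b).toLinearMap) (LinearMap.ker_eq_bot.2 hinj))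

lemma sl_T {p : ℝ} {g : Pt N → ℝ} (hg : Measurable g) {S : Matrix (Fin N) (Fin N) ℝ} (hS : S.det ≠ 0) (b : Fin N → ℝ) (y : ℝ) :
    sl p (g ∘ Tm S b) y = ENNReal.ofReal |S.det⁻¹| * sl p g y := by
  unfold sl
  have hm : Measurable fun x : Fin N → ℝ => ‖g (x + y • b, y)‖ₑ ^ p := by fun_prop
  have h1 : ∫⁻ x : Fin N → ℝ, ‖g (x, y)‖ₑ ^ p = ∫⁻ x : Fin N → ℝ, ‖g (x + y • b, y)‖ₑ ^ p :=
    (lintegral_add_right_eq_self (fun x : Fin N → ℝ => ‖g (x, y)‖ₑ ^ p) (y • b)).symm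
  have h2 := Real.map_matrix_volume_pi_eq_smul_volume_pi hS
  have h3 := lintegral_map (μ := volume) hm (Matrix.toLin' S).continuous_of_finiteDimensional.measurable
  rw [h2, lintegral_smul_measure] at h3
  rw [h1, ← smul_eq_mul, h3]
  simp [Tm_apply]

lemma J_T {p m : ℝ} {g : Pt N → ℝ} (hg : Measurable g) {S : Matrix (Fin N) (Fin N) ℝ} (hS : S.det ≠ 0) (b : Fin N → ℝ) :
    J m (sl p (g ∘ Tm S b)) = ENNReal.ofReal |S.det⁻¹| * J m (sl p g) := by
  rw [← J_const_mul m _ ENNReal.ofReal_ne_top]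
  exact congrArg (J m) (funext fun y => sl_T hg hS b y)
end

section
variable {N : ℕ}

lemma trHess_exp {u : Pt N → ℝ} (hu : Sm u) (Q : Matrix (Fin N) (Fin N) ℝ) (q : Fin N → ℝ) (γ : ℝ) (z : Pt N) :
    trHess (blockA Q q γ) u z = (∑ i, ∑ j, Q i j * pd (ex i) (pd (ex j) u) z)
      + (∑ i, 2 * q i * pd (ex i) (pd ey u) z) + γ * pd ey (pd ey u) z := by
  unfold trHess
  simp only [Fin.sum_univ_castSucc, blockA, bvec, Matrix.of_apply, Fin.val_castSucc, Fin.is_lt, Fin.val_last, lt_irrefl,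
    dite_true, dite_false, Fin.eta, Finset.sum_add_distrib, pd_comm hu ey (ex _)]
  have : ∀ i : Fin N, 2 * q i * pd (ex i) (pd ey u) z = q i * pd (ex i) (pd ey u) z + q i * pd (ex i) (pd ey u) z := fun i => by ring
  simp_rw [this, Finset.sum_add_distrib]
  ring

open scoped MatrixOrder ComplexOrder Matrix.Norms.L2Operator in
lemma schur {Q : Matrix (Fin N) (Fin N) ℝ} {q : Fin N → ℝ} {γ : ℝ} (hγ : 0 < γ)
    (hsym : (blockA Q q γ).IsSymm) (hpos : (blockA Q q γ).PosDef) :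
    ∃ S R : Matrix (Fin N) (Fin N) ℝ, R * S = 1 ∧ S * R = 1 ∧ S.det ≠ 0 ∧
      ∀ i j, ∑ k, S i k * S j k = Q i j / γ - q i * q j / γ ^ 2 := by
  set M : Matrix (Fin N) (Fin N) ℝ := Matrix.of fun i j => Q i j / γ - q i * q j / γ ^ 2 with hM
  have hQ : ∀ i j, Q j i = Q i j := by
    intro i j
    have := hsym.apply i.castSucc j.castSucc
    simpa [blockA] using this
  have hMh : M.IsHermitian := by
    ext i j
    simp [hM, hQ i j, mul_comm (q j)]
  have hMp : M.PosDef := by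
    refine .of_dotProduct_mulVec_pos hMh fun x hx => ?_
    set s := ∑ i, q i * x i with hs
    set X : Fin (N+1) → ℝ := Fin.snoc (α := fun _ => ℝ) x (-s/γ) with hX
    have hX0 : X ≠ 0 := by
      intro h
      apply hx
      funext i
      have := congrFun h i.castSucc
      simpa [hX] using this
    have h1 := hpos.dotProduct_mulVec_pos hX0
    have h2 : star X ⬝ᵥ (blockA Q q γ).mulVec X = (∑ i, ∑ j, x i * (Q i j * x j)) - s^2/γ := by
      simp only [dotProduct, Matrix.mulVec, Fin.sum_univ_castSucc, blockA, Matrix.of_apply, Fin.val_castSucc, Fin.is_lt, Fin.val_last, lt_irrefl,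
        dite_true, dite_false, Fin.eta, hX, Fin.snoc_castSucc, Fin.snoc_last, Pi.star_apply, star_trivial, mul_add, Finset.sum_add_distrib, Finset.mul_sum]
      have e1 : ∑ i, x i * (q i * (-s/γ)) = -s^2/γ := by
        have : ∀ i, x i * (q i * (-s/γ)) = (q i * x i) * (-s/γ) := fun i => by ring
        simp_rw [this]
        rw [← Finset.sum_mul, ← hs]; ring
      have e2 : ∑ i, -s/γ * (q i * x i) = -s^2/γ := by
        rw [← Finset.mul_sum, ← hs]; ring
      rw [e1, e2]
      field_simp
      ring
    have h3 : star x ⬝ᵥ M.mulVec x = γ⁻¹ * ((∑ i, ∑ j, x i * (Q i j * x j)) - s^2/γ) := by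
      simp only [dotProduct, Matrix.mulVec, hM, Matrix.of_apply, Pi.star_apply, star_trivial, Finset.mul_sum]
      have e : ∀ i j, x i * ((Q i j / γ - q i * q j / γ ^ 2) * x j) = γ⁻¹ * (x i * (Q i j * x j)) - (γ^2)⁻¹ * ((q i * x i) * (q j * x j)) := fun i j => by
        field_simp
      simp_rw [e, Finset.sum_sub_distrib, ← Finset.mul_sum, ← Finset.sum_mul, ← hs]
      field_simp
    rw [h3, ← h2]
    positivity
  obtain ⟨B, hB⟩ := (CStarAlgebra.nonneg_iff_eq_star_mul_self (a := M)).1 hMp.posSemidef.nonneg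
  have hdet : B.det ≠ 0 := by
    intro h
    have := hMp.det_pos
    rw [hB, Matrix.det_mul, h, mul_zero] at this
    exact lt_irrefl _ this
  have hdt : IsUnit (B.transpose).det := by rw [Matrix.det_transpose]; exact hdet.isUnit
  refine ⟨B.transpose, (B.transpose)⁻¹, Matrix.nonsing_inv_mul _ hdt, Matrix.mul_nonsing_inv _ hdt, hdt.ne_zero, fun i j => ?_⟩
  have := congrFun (congrFun hB i) j
  simp only [hM, Matrix.of_apply, Matrix.mul_apply, Matrix.star_apply, star_trivial] at this
  rw [this]
  simp

lemma transfer {u : Pt N → ℝ} (hu : Sm u) {S : Matrix (Fin N) (Fin N) ℝ} {Q : Matrix (Fin N) (Fin N) ℝ} {q d a : Fin N → ℝ} {γ c : ℝ} (hγ : 0 < γ) (hc : c ≠ 0)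
    (hS : ∀ i j, ∑ k, S i k * S j k = Q i j / γ - q i * q j / γ ^ 2)
    (ha : S.mulVec a + c⁻¹ • d = γ⁻¹ • q) (z : Pt N) :
    pd ey (u ∘ Tm S (c⁻¹ • d)) z = c⁻¹ * ((∑ i, d i * pd (ex i) u (Tm S (c⁻¹ • d) z)) + c * pd ey u (Tm S (c⁻¹ • d) z)) ∧
    Gop a (u ∘ Tm S (c⁻¹ • d)) z = γ⁻¹ * trHess (blockA Q q γ) u (Tm S (c⁻¹ • d) z) := by
  set T := Tm S (c⁻¹ • d) with hT
  constructor
  · rw [pd_T hu, Function.comp, pd_exp]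
    simp only [hT, Tm_apply, ey, Matrix.mulVec_zero, zero_add, one_smul, Pi.smul_apply, smul_eq_mul, mul_add, Finset.mul_sum]
    field_simp
  · have hpp : ∀ v w : Pt N, pd v (pd w (u ∘ T)) z = pd (T v) (pd (T w) u) (T z) := fun v w => by
      rw [pd_T hu, pd_T (hu.pd _)]; rfl
    have hTk : ∀ k, T (ex k) = (fun i => S i k, 0) := by
      intro k
      rw [hT, Tm_apply]
      simp [ex]
      rfl
    have hTd : T (Dv a) = (γ⁻¹ • q, 1) := by
      rw [hT, Tm_apply]
      simp [Dv, ← ha]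
    unfold Gop
    simp_rw [hpp, hTk, hTd, trHess_exp hu]
    have hk : ∀ k ζ, pd ((fun i => S i k, 0) : Pt N) (pd ((fun i => S i k, 0) : Pt N) u) ζ = _ := fun k ζ => hess_exp hu _ _ ζ
    simp_rw [hk]
    rw [hess_exp hu (γ⁻¹ • q, 1)]
    generalize T z = ζ
    simp only [Pi.smul_apply, smul_eq_mul, mul_zero, zero_mul, add_zero, Finset.sum_const_zero, mul_one, one_mul]
    have hsw : ∀ H : Fin N → Fin N → ℝ, ∑ k, ∑ i, ∑ j, S i k * S j k * H i j = ∑ i, ∑ j, (Q i j / γ - q i * q j / γ ^ 2) * H i j := by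
      intro H
      rw [Finset.sum_comm]
      refine Finset.sum_congr rfl fun i _ => ?_
      rw [Finset.sum_comm]
      refine Finset.sum_congr rfl fun j _ => ?_
      rw [← Finset.sum_mul, hS]
    rw [hsw (fun i j => pd (ex i) (pd (ex j) u) ζ)]
    simp_rw [mul_add, Finset.mul_sum]
    rw [← add_assoc, ← add_assoc, ← Finset.sum_add_distrib]
    simp_rw [← Finset.sum_add_distrib]
    congr 1
    · refine Finset.sum_congr rfl fun i _ => ?_
      congr 1
      · refine Finset.sum_congr rfl fun j _ => ?_
        field_simp
        ring
      · ring
    · field_simp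
end

section
variable {N : ℕ}

/-- the drift `v·∇u` -/
def Vop (d : Fin N → ℝ) (c : ℝ) (u : Pt N → ℝ) (z : Pt N) : ℝ := (∑ i, d i * pd (ex i) u z) + c * pd ey u z

/-- the drift divided by `y` -/
def Vy (d : Fin N → ℝ) (c : ℝ) (u : Pt N → ℝ) (z : Pt N) : ℝ := Vop d c u z / z.2

/-- the full operator with `α = 0` -/
def Lo (Q : Matrix (Fin N) (Fin N) ℝ) (q : Fin N → ℝ) (γ : ℝ) (d : Fin N → ℝ) (c : ℝ) (u : Pt N → ℝ) (z : Pt N) : ℝ :=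
  trHess (blockA Q q γ) u z + Vy d c u z

/-- the oblique boundary condition -/
def Bv (d : Fin N → ℝ) (c : ℝ) (u : Pt N → ℝ) : Prop :=
  Sm u ∧ ∃ δ > 0, ∀ z : Pt N, 0 ≤ z.2 → z.2 ≤ δ → Vop d c u z = 0

lemma Sm.Vop {u : Pt N → ℝ} (hu : Sm u) (d : Fin N → ℝ) (c : ℝ) : Sm (Vop d c u) :=
  (Sm.sum Finset.univ fun i => (hu.pd (ex i)).const_mul (d i)).add ((hu.pd ey).const_mul c)

lemma Sm.trHess {u : Pt N → ℝ} (hu : Sm u) (A : Matrix (Fin (N+1)) (Fin (N+1)) ℝ) : Sm (trHess A u) :=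
  Sm.sum Finset.univ fun i => Sm.sum Finset.univ fun j => ((hu.pd (bvec j)).pd (bvec i)).const_mul (A i j)

lemma Vy_meas {u : Pt N → ℝ} (hu : Sm u) (d : Fin N → ℝ) (c : ℝ) : Measurable (Vy d c u) :=
  (hu.Vop d c).cc.meas.div measurable_snd

lemma Lo_meas {u : Pt N → ℝ} (hu : Sm u) (Q : Matrix (Fin N) (Fin N) ℝ) (q : Fin N → ℝ) (γ : ℝ) (d : Fin N → ℝ) (c : ℝ) :
    Measurable (Lo Q q γ d c u) := (hu.trHess _).cc.meas.add (Vy_meas hu d c)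

lemma J_cmul {p m : ℝ} (hp : 1 < p) (c : ℝ) : ∃ C : ENNReal, C ≠ ⊤ ∧ ∀ g : Pt N → ℝ, Measurable g →
    J m (sl p (fun z => c * g z)) ≤ C * J m (sl p g) := by
  refine ⟨ENNReal.ofReal |c| ^ p * ((Fintype.card Unit : ℕ) : ENNReal) ^ (p-1), dom_ne hp.le _ _, fun g hg => ?_⟩
  have := J_dom (m := m) hp.le (F := fun z => c * g z) (f := fun _ : Unit => g) (c := |c|) (fun _ => hg) (abs_nonneg _)
    (fun z _ => by simp [abs_mul])
  simpa using this

lemma Lo_fin {p m : ℝ} (hp : 1 < p) (hm : -1 < m) (Q : Matrix (Fin N) (Fin N) ℝ) (q : Fin N → ℝ) (γ : ℝ) {d : Fin N → ℝ} {c : ℝ}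
    {u : Pt N → ℝ} (hu : Bv d c u) : J m (sl p (Lo Q q γ d c u)) ≠ ⊤ := by
  obtain ⟨hs, δ, hδ, h⟩ := hu
  have p0 : 0 < p := by linarith
  have := J_dom (m := m) hp.le (F := Lo Q q γ d c u) (f := ![trHess (blockA Q q γ) u, Vop d c u]) (c := 1+δ⁻¹) ?_ (by positivity) ?_
  · refine ne_top_of_le_ne_top ?_ this
    refine ENNReal.mul_ne_top (dom_ne hp.le _ _) (ENNReal.sum_ne_top.2 fun i _ => ?_)
    fin_cases i
    · exact J_fin p0 hm (hs.trHess _).cc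
    · exact J_fin p0 hm (hs.Vop d c).cc
  · intro i
    fin_cases i
    · exact (hs.trHess _).cc.meas
    · exact (hs.Vop d c).cc.meas
  · intro z hz
    rw [Fin.sum_univ_two]
    simp only [Matrix.cons_val]
    have hδ' : 0 < δ⁻¹ := by positivity
    have h2 : |Vy d c u z| ≤ δ⁻¹ * |Vop d c u z| := by
      unfold Vy
      rcases le_total z.2 δ with h3 | h3
      · rw [h z hz.le h3]; simp
      · rw [abs_div, abs_of_pos hz, div_eq_mul_inv, mul_comm]
        gcongr
    have h4 := abs_add_le (trHess (blockA Q q γ) u z) (Vy d c u z)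
    have h5 := abs_nonneg (trHess (blockA Q q γ) u z)
    have h6 := abs_nonneg (Vop d c u z)
    unfold Lo
    nlinarith [mul_nonneg hδ'.le h5]

lemma main_est {p m : ℝ} (hp : 1 < p) (hm : -1 < m) {Q : Matrix (Fin N) (Fin N) ℝ} {q : Fin N → ℝ} {γ : ℝ} (hγ : 0 < γ)
    (hsym : (blockA Q q γ).IsSymm) (hpos : (blockA Q q γ).PosDef) (d : Fin N → ℝ) {c : ℝ} (hc : c ≠ 0)
    (h : (m+1)/p < c/γ + 1) :
    (∀ v w : Pt N, ∃ C : ENNReal, C ≠ ⊤ ∧ ∀ u : Pt N → ℝ, Bv d c u → J m (sl p (pd v (pd w u))) ≤ C * J m (sl p (Lo Q q γ d c u))) ∧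
    (∃ C : ENNReal, C ≠ ⊤ ∧ ∀ u : Pt N → ℝ, Bv d c u → J m (sl p (Vy d c u)) ≤ C * J m (sl p (Lo Q q γ d c u))) := by
  obtain ⟨S, R, hRS, hSR, hdet, hS⟩ := schur hγ hsym hpos
  set b : Fin N → ℝ := c⁻¹ • d with hb
  set a : Fin N → ℝ := R.mulVec (γ⁻¹ • q - b) with ha
  have ha' : S.mulVec a + b = γ⁻¹ • q := by
    rw [ha, Matrix.mulVec_mulVec, hSR, Matrix.one_mulVec]; simp
  set T := Tm S b with hT
  have hT2 : ∀ z, (T z).2 = z.2 := fun z => by rw [hT, Tm_apply]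
  have tr : ∀ u : Pt N → ℝ, Sm u → ∀ z, pd ey (u ∘ T) z = c⁻¹ * Vop d c u (T z) ∧ Gop a (u ∘ T) z = γ⁻¹ * trHess (blockA Q q γ) u (T z) :=
    fun u hu z => transfer hu hγ hc hS ha' z
  have hBc : ∀ u : Pt N → ℝ, Bv d c u → Bc (u ∘ T) := by
    rintro u ⟨hu, δ, hδ, h⟩
    refine ⟨Sm_T hu hRS b, δ, hδ, fun z h0 h1 => ?_⟩
    rw [(tr u hu z).1, h (T z) (by rwa [hT2]) (by rwa [hT2]), mul_zero]
  have hL : ∀ u : Pt N → ℝ, Sm u → Lop a (c/γ) (u ∘ T) = (fun z => γ⁻¹ * Lo Q q γ d c u z) ∘ T := by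
    intro u hu
    funext z
    unfold Lop
    rw [(tr u hu z).1, (tr u hu z).2]
    simp only [Function.comp, Lo, Vy, hT2]
    field_simp
  set k := ENNReal.ofReal |S.det⁻¹| with hk
  have hk0 : k ≠ 0 := by
    rw [hk]; simp [hdet]
  have hkt : k ≠ ⊤ := ENNReal.ofReal_ne_top
  obtain ⟨c1, hc1, H1⟩ := J_cmul (N := N) (m := m) hp γ⁻¹
  have hLJ : ∀ u : Pt N → ℝ, Sm u → J m (sl p (Lop a (c/γ) (u ∘ T))) ≤ k * (c1 * J m (sl p (Lo Q q γ d c u))) := by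
    intro u hu
    have hml := Lo_meas hu Q q γ d c
    rw [hL u hu, J_T (hml.const_mul _) hdet]
    exact mul_le_mul_right (H1 _ hml) _
  constructor
  · intro v w
    have sur : ∀ v : Pt N, T (R.mulVec (v.1 - v.2 • b), v.2) = v := by
      intro v
      rw [hT, Tm_apply]
      simp only [Matrix.mulVec_mulVec, hSR, Matrix.one_mulVec, sub_add_cancel]
    obtain ⟨v', hv⟩ : ∃ v', T v' = v := ⟨_, sur v⟩
    obtain ⟨w', hw⟩ : ∃ v', T v' = w := ⟨_, sur w⟩
    obtain ⟨c2, hc2, H2⟩ := hess_est hp hm a h v' w'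
    refine ⟨c2 * c1, by finiteness, fun u hu => ?_⟩
    have h3 := (H2 _ (hBc u hu)).trans (mul_le_mul_right (hLJ u hu.1) _)
    rw [pd_T hu.1, pd_T (hu.1.pd _), hv, hw, J_T ((hu.1.pd _).pd _).cc.meas hdet, mul_left_comm] at h3
    rw [mul_assoc]
    exact (ENNReal.mul_le_mul_iff_right hk0 hkt).1 h3
  · obtain ⟨c2, hc2, H2⟩ := normal_est hp hm a h
    obtain ⟨c3, hc3, H3⟩ := J_cmul (N := N) (m := m) hp c
    refine ⟨c3 * (c2 * c1), by finiteness, fun u hu => ?_⟩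
    have h3 : J m (sl p (Uy (u ∘ T))) ≤ c2 * (k * (c1 * J m (sl p (Lo Q q γ d c u)))) :=
      le_add_self.trans ((H2 _ (hBc u hu)).trans (mul_le_mul_right (hLJ u hu.1) _))
    have h4 : (fun z => c * Uy (u ∘ T) z) = Vy d c u ∘ T := by
      funext z
      unfold Uy
      rw [(tr u hu.1 z).1]
      simp only [Function.comp, Vy, hT2]
      field_simp
    have h5 := (H3 _ (Uy_meas (hBc u hu).1)).trans (mul_le_mul_right h3 _)
    rw [h4, J_T (Vy_meas hu.1 d c) hdet, mul_left_comm c2, mul_left_comm c3] at h5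
    rw [mul_assoc, mul_assoc]
    exact (ENNReal.mul_le_mul_iff_right hk0 hkt).1 h5

lemma J_prod {p m : ℝ} {g : Pt N → ℝ} (hg : Measurable g) :
    J m (sl p g) = ∫⁻ z in {z : Pt N | 0 < z.2}, ENNReal.ofReal (z.2 ^ m) * ‖g z‖ₑ ^ p := by
  have hset : {z : Pt N | 0 < z.2} = Set.univ ×ˢ Set.Ioi (0:ℝ) := by ext z; simp
  have hm1 : Measurable fun z : Pt N => ENNReal.ofReal (z.2 ^ m) * ‖g z‖ₑ ^ p := by fun_prop
  rw [hset, Measure.volume_eq_prod, ← Measure.prod_restrict, Measure.restrict_univ, lintegral_prod_symm' _ hm1]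
  unfold J sl
  refine lintegral_congr fun y => ?_
  exact (lintegral_const_mul' _ _ ENNReal.ofReal_ne_top).symm

lemma Lpm_eq {p m α : ℝ} (hp : 1 < p) {F g : Pt N → ℝ} (hg : Measurable g) (hF : ∀ z : Pt N, 0 < z.2 → F z = z.2 ^ α * g z) :
    LpmNorm N p m F = (J (m + α * p) (sl p g) ^ (1/p)).toReal := by
  have p0 : 0 < p := by linarith
  have hms : MeasurableSet {z : Pt N | 0 < z.2} := measurableSet_lt measurable_const measurable_snd
  unfold LpmNorm
  rw [setIntegral_congr_fun (g := fun z : Pt N => z.2 ^ (m + α * p) * |g z| ^ p) hms, integral_eq_lintegral_of_nonneg_ae, J_prod hg,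
    ENNReal.toReal_rpow]
  · congr 2
    refine setLIntegral_congr_fun hms fun z hz => ?_
    have hz' : 0 < z.2 := hz
    rw [ENNReal.ofReal_mul (by positivity), ← ENNReal.ofReal_rpow_of_nonneg (abs_nonneg _) p0.le, ← Real.norm_eq_abs, ofReal_norm]
  · filter_upwards [ae_restrict_mem hms] with z hz
    have hz' : 0 < z.2 := hz
    positivity
  · exact (by fun_prop : Measurable fun z : Pt N => z.2 ^ (m + α * p) * |g z| ^ p).aestronglyMeasurable
  · intro z hz
    have hz' : 0 < z.2 := hz
    dsimp only
    rw [hF z hz', abs_mul, abs_of_pos (by positivity), Real.mul_rpow (by positivity) (abs_nonneg _), ← Real.rpow_mul hz'.le, Real.rpow_add hz']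
    ring

lemma toR {A B C : ENNReal} {p : ℝ} (hp : 1 < p) (hC : C ≠ ⊤) (hB : B ≠ ⊤) (h : A ≤ C * B) :
    (A ^ (1/p)).toReal ≤ (C ^ (1/p)).toReal * (B ^ (1/p)).toReal := by
  have p0 : 0 < 1/p := by positivity
  rw [← ENNReal.toReal_mul, ← ENNReal.mul_rpow_of_nonneg _ _ p0.le]
  exact ENNReal.toReal_mono (ENNReal.rpow_ne_top_of_nonneg p0.le (ENNReal.mul_ne_top hC hB)) (ENNReal.rpow_le_rpow h p0.le)
end

/-- Elliptic estimate for the degenerate operator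
`ℒu = y^α Tr(A D²u) + y^{α-1} v·∇u` with oblique derivative boundary condition,
on the core `𝒞_v` of smooth compactly supported functions with
`d·∇_x u + c ∂_y u ≡ 0` near `{y = 0}`. -/
theorem statement0 (N : ℕ) (hN : 1 ≤ N) (p m α : ℝ) (hp : 1 < p) (hα : α < 2)
    (Q : Matrix (Fin N) (Fin N) ℝ) (q : Fin N → ℝ) (γ : ℝ) (hγ : 0 < γ)
    (hsym : (blockA Q q γ).IsSymm) (hposdef : (blockA Q q γ).PosDef)
    (d : Fin N → ℝ) (c : ℝ) (hc : c ≠ 0)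
    (h1 : max (-α) 0 < (m + 1) / p) (h2 : (m + 1) / p < c / γ + 1 - α) :
    ∃ C > 0, ∀ u : Pt N → ℝ, ContDiff ℝ (⊤ : ℕ∞) u → HasCompactSupport u →
      (∃ δ > 0, ∀ z : Pt N, 0 ≤ z.2 → z.2 ≤ δ →
        (∑ i, d i * pd (ex i) u z) + c * pd ey u z = 0) →
      (∑ i, ∑ j, LpmNorm N p m fun z => z.2 ^ α * pd (ex i) (pd (ex j) u) z)
        + (LpmNorm N p m fun z => z.2 ^ α * pd ey (pd ey u) z)
        + (∑ i, LpmNorm N p m fun z => z.2 ^ α * pd (ex i) (pd ey u) z)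
        + (LpmNorm N p m fun z =>
            z.2 ^ (α - 1) * ((∑ i, d i * pd (ex i) u z) + c * pd ey u z))
      ≤ C * LpmNorm N p m fun z =>
          z.2 ^ α * trHess (blockA Q q γ) u z
            + z.2 ^ (α - 1) * ((∑ i, d i * pd (ex i) u z) + c * pd ey u z) := by
  have p0 : 0 < p := by linarith
  have hmax1 : -α < (m + 1) / p := lt_of_le_of_lt (le_max_left _ _) h1
  have hm : -1 < m + α * p := by
    rw [lt_div_iff₀ p0] at hmax1
    linarith
  have hk : (m + α * p + 1) / p < c / γ + 1 := by
    have : (m + α * p + 1) / p = (m + 1) / p + α := by field_simp; ring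
    rw [this]; linarith
  obtain ⟨H, C4, hC4, H4⟩ := main_est hp hm hγ hsym hposdef d hc hk
  choose Cf hCf HC using H
  set r : ENNReal → ℝ := fun A => (A ^ (1/p)).toReal with hr
  have hr0 : ∀ A, 0 ≤ r A := fun A => ENNReal.toReal_nonneg
  have hC0 : 0 ≤ (∑ i, ∑ j, r (Cf (ex i) (ex j))) + r (Cf ey ey) + (∑ i, r (Cf (ex i) ey)) + r C4 := by
    have e1 : 0 ≤ ∑ i : Fin N, ∑ j : Fin N, r (Cf (ex i) (ex j)) := Finset.sum_nonneg fun _ _ => Finset.sum_nonneg fun _ _ => hr0 _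
    have e2 : 0 ≤ ∑ i : Fin N, r (Cf (ex i) ey) := Finset.sum_nonneg fun _ _ => hr0 _
    have e3 := hr0 (Cf ey ey)
    have e4 := hr0 C4
    linarith
  refine ⟨(∑ i, ∑ j, r (Cf (ex i) (ex j))) + r (Cf ey ey) + (∑ i, r (Cf (ex i) ey)) + r C4 + 1, by linarith, fun u hu1 hu2 hu3 => ?_⟩
  have hs : Sm u := ⟨hu1, hu2⟩
  have hB : Bv d c u := ⟨hs, hu3⟩
  have hfin := Lo_fin hp hm Q q γ hB
  have hpow : ∀ z : Pt N, 0 < z.2 → z.2 ^ (α - 1) * Vop d c u z = z.2 ^ α * Vy d c u z := by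
    intro z hz
    rw [Real.rpow_sub hz, Real.rpow_one, Vy]
    ring
  have hR : (LpmNorm N p m fun z =>
          z.2 ^ α * trHess (blockA Q q γ) u z
            + z.2 ^ (α - 1) * ((∑ i, d i * pd (ex i) u z) + c * pd ey u z)) = r (J (m + α * p) (sl p (Lo Q q γ d c u))) :=
    Lpm_eq hp (Lo_meas hs Q q γ d c) fun z hz => by
      have := hpow z hz
      unfold Vop at this
      rw [this, Lo, mul_add]
  have hV : (LpmNorm N p m fun z =>
            z.2 ^ (α - 1) * ((∑ i, d i * pd (ex i) u z) + c * pd ey u z)) = r (J (m + α * p) (sl p (Vy d c u))) :=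
    Lpm_eq hp (Vy_meas hs d c) fun z hz => hpow z hz
  have hH : ∀ v w : Pt N, (LpmNorm N p m fun z => z.2 ^ α * pd v (pd w u) z) = r (J (m + α * p) (sl p (pd v (pd w u)))) :=
    fun v w => Lpm_eq hp ((hs.pd w).pd v).cc.meas fun z _ => rfl
  rw [hR, hV]
  simp_rw [hH]
  have hb : ∀ v w : Pt N, r (J (m + α * p) (sl p (pd v (pd w u)))) ≤ r (Cf v w) * r (J (m + α * p) (sl p (Lo Q q γ d c u))) :=
    fun v w => toR hp (hCf v w) hfin (HC v w u hB)
  have hb4 : r (J (m + α * p) (sl p (Vy d c u))) ≤ r C4 * r (J (m + α * p) (sl p (Lo Q q γ d c u))) :=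
    toR hp hC4 hfin (H4 u hB)
  have hX := hr0 (J (m + α * p) (sl p (Lo Q q γ d c u)))
  generalize r (J (m + α * p) (sl p (Lo Q q γ d c u))) = X at *
  simp_rw [add_mul, Finset.sum_mul, one_mul]
  have e1 := Finset.sum_le_sum fun (i : Fin N) (_ : i ∈ Finset.univ) => Finset.sum_le_sum fun (j : Fin N) (_ : j ∈ Finset.univ) => hb (ex i) (ex j)
  have e2 := Finset.sum_le_sum fun (i : Fin N) (_ : i ∈ Finset.univ) => hb (ex i) ey
  have e3 := hb ey ey
  linarith
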